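/- arXiv:1407.0673 — 2 statements merged into one kernel-verified Lean document; each statement's English description precedes it below -/
import Mathlib

section
/- Let n ≥ 3, 0 < α < 1 and 2−n < γ < 0. There exists a constant C > 0, depending only on n, α and γ, such that every u ∈ C^{2,α}_γ(ℝⁿ₊) satisfies the global weighted Schauder estimate ‖u‖_{C^{2,α}_γ(ℝⁿ₊)} ≤ C ‖Δu‖_{C^{0,α}_{γ−2}(ℝⁿ₊)} + C ‖∂u/∂xₙ‖_{C^{1,α}_{γ−1}(∂ℝⁿ₊)}. -/
open MeasureTheory Metric Filter
open scoped ENNReal Topology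

noncomputable section

/-- The closed half-space `{x : x k ≥ 0}`, where `k` is the distinguished (last) coordinate. -/
def upperHalf (n : ℕ) (k : Fin n) : Set (EuclideanSpace ℝ (Fin n)) := {x | 0 ≤ x k}

/-- Membership in the weighted space `C^k_γ(S)`. -/
def MemCgamma (m : ℕ) (k : ℕ) (γ : ℝ) (S : Set (EuclideanSpace ℝ (Fin m)))
    (u : EuclideanSpace ℝ (Fin m) → ℝ) : Prop :=
  ContDiffOn ℝ k u S ∧
    ∀ i, i ≤ k → ∃ M : ℝ, ∀ x ∈ S,
      (1 + ‖x‖) ^ (-γ + (i : ℝ)) * ‖iteratedFDerivWithin ℝ i u S x‖ ≤ M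

/-- Membership in the weighted Hölder space `C^{k,α}_γ(S)`. -/
def WMemHolder (m : ℕ) (k : ℕ) (α γ : ℝ) (S : Set (EuclideanSpace ℝ (Fin m)))
    (u : EuclideanSpace ℝ (Fin m) → ℝ) : Prop :=
  MemCgamma m k γ S u ∧
    ∃ M : ℝ, ∀ x ∈ S, ∀ y ∈ S, x ≠ y →
      dist x y ≤ min (1 + ‖x‖) (1 + ‖y‖) / 2 →
        (min (1 + ‖x‖) (1 + ‖y‖)) ^ (-γ + (k : ℝ) + α) *
            ‖iteratedFDerivWithin ℝ k u S x - iteratedFDerivWithin ℝ k u S y‖ ≤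
          M * dist x y ^ α

/-- The weighted Hölder norm `‖u‖_{C^{k,α}_γ(S)} = Σ_{i ≤ k} sup_S ρ^{-γ+i}‖Dⁱu‖ + [u]_{k,α,γ}`. -/
def wHolderNorm (m : ℕ) (k : ℕ) (α γ : ℝ) (S : Set (EuclideanSpace ℝ (Fin m)))
    (u : EuclideanSpace ℝ (Fin m) → ℝ) : ℝ :=
  (∑ i ∈ Finset.range (k + 1),
    sSup {t : ℝ | ∃ x ∈ S,
      t = (1 + ‖x‖) ^ (-γ + (i : ℝ)) * ‖iteratedFDerivWithin ℝ i u S x‖}) +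
  sSup {t : ℝ | ∃ x ∈ S, ∃ y ∈ S, x ≠ y ∧
    dist x y ≤ min (1 + ‖x‖) (1 + ‖y‖) / 2 ∧
    t = (min (1 + ‖x‖) (1 + ‖y‖)) ^ (-γ + (k : ℝ) + α) *
        ‖iteratedFDerivWithin ℝ k u S x - iteratedFDerivWithin ℝ k u S y‖ /
          dist x y ^ α}

/-- The Euclidean Laplacian `Δu = Σᵢ ∂²u/∂xᵢ²`, computed with derivatives within `S`. -/
def lapWithin (n : ℕ) (S : Set (EuclideanSpace ℝ (Fin n)))
    (u : EuclideanSpace ℝ (Fin n) → ℝ) (x : EuclideanSpace ℝ (Fin n)) : ℝ :=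
  ∑ i : Fin n, iteratedFDerivWithin ℝ 2 u S x
    ![EuclideanSpace.single i 1, EuclideanSpace.single i 1]

/-- The identification of `ℝ^{n-1}` with the boundary hyperplane `{xₙ = 0} ⊂ ℝⁿ`. -/
def emb (n : ℕ) (x' : EuclideanSpace ℝ (Fin (n - 1))) : EuclideanSpace ℝ (Fin n) :=
  ∑ i : Fin (n - 1), x' i • EuclideanSpace.single (Fin.castLE (Nat.sub_le n 1) i) 1

/-- The `i`-th standard basis vector of `ℝⁿ`. -/
def coordVec {n : ℕ} (i : Fin n) : EuclideanSpace ℝ (Fin n) := EuclideanSpace.single i 1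

theorem add_smul_coordVec_apply {n : ℕ} (x : EuclideanSpace ℝ (Fin n)) (τ : ℝ) (i j : Fin n) :
    (x + τ • coordVec i) j = x j + if j = i then τ else 0 := by
  simp [coordVec]

theorem norm_coordVec {n : ℕ} (i : Fin n) : ‖coordVec i‖ = 1 := by
  simp [coordVec]

theorem dist_add_smul_coordVec_self {n : ℕ} (x : EuclideanSpace ℝ (Fin n)) {τ : ℝ} (hτ : 0 ≤ τ)
    (i : Fin n) : dist (x + τ • coordVec i) x = τ := by
  rw [dist_eq_norm, add_sub_cancel_left, norm_smul, norm_coordVec, Real.norm_of_nonneg hτ, mul_one]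

theorem add_smul_coordVec_mem {n : ℕ} {N : Fin n} {x : EuclideanSpace ℝ (Fin n)}
    (hx : x ∈ upperHalf n N) {τ : ℝ} (hτ : 0 ≤ τ) (i : Fin n) :
    x + τ • coordVec i ∈ upperHalf n N := by
  have hx' : 0 ≤ x N := hx
  change 0 ≤ (x + τ • coordVec i) N
  rw [add_smul_coordVec_apply]
  split_ifs <;> linarith

theorem isClosed_upperHalf (n : ℕ) (N : Fin n) : IsClosed (upperHalf n N) :=
  isClosed_le continuous_const (by fun_prop)

/-- `f'` is the `i`-th partial derivative of `f` on the half-space, one-sided at the boundary when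
`i` is the normal direction. -/
def HasPartial {n : ℕ} (N i : Fin n) (f f' : EuclideanSpace ℝ (Fin n) → ℝ) : Prop :=
  ∀ x ∈ upperHalf n N, HasDerivWithinAt (fun τ : ℝ => f (x + τ • coordVec i)) (f' x)
    {τ : ℝ | x + τ • coordVec i ∈ upperHalf n N} 0

namespace HasPartial

variable {n : ℕ} {N i : Fin n} {f f' g g' : EuclideanSpace ℝ (Fin n) → ℝ}

theorem hasDerivWithinAt_line (h : HasPartial N i f f') {x : EuclideanSpace ℝ (Fin n)} {τ₀ : ℝ}
    (hx : x + τ₀ • coordVec i ∈ upperHalf n N) :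
    HasDerivWithinAt (fun τ : ℝ => f (x + τ • coordVec i)) (f' (x + τ₀ • coordVec i))
      {τ : ℝ | x + τ • coordVec i ∈ upperHalf n N} τ₀ := by
  have h1 := h _ hx
  have h2 : HasDerivWithinAt (fun τ : ℝ => τ - τ₀) 1
      {τ : ℝ | x + τ • coordVec i ∈ upperHalf n N} τ₀ :=
    ((hasDerivAt_id τ₀).sub_const τ₀).hasDerivWithinAt
  have key : ∀ τ : ℝ, x + τ₀ • coordVec i + (τ - τ₀) • coordVec i = x + τ • coordVec i := by
    intro τ; module
  have h1' := (show (0 : ℝ) = (fun τ : ℝ => τ - τ₀) τ₀ by simp) ▸ h1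
  have h3 := HasDerivWithinAt.comp (h := fun τ : ℝ => τ - τ₀) τ₀ h1' h2 (fun τ hτ => by
    change _ ∈ upperHalf n N
    rw [key]
    exact hτ)
  simpa only [Function.comp_def, key, mul_one] using h3

theorem hasDerivAt_line (h : HasPartial N i f f') {x : EuclideanSpace ℝ (Fin n)} {τ₀ : ℝ}
    (hx : (i ≠ N ∧ x ∈ upperHalf n N) ∨ 0 < (x + τ₀ • coordVec i) N) :
    HasDerivAt (fun τ : ℝ => f (x + τ • coordVec i)) (f' (x + τ₀ • coordVec i)) τ₀ := by
  have hmem : x + τ₀ • coordVec i ∈ upperHalf n N := by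
    rcases hx with ⟨h1, h2⟩ | h1
    · have h2' : 0 ≤ x N := h2
      change 0 ≤ (x + τ₀ • coordVec i) N
      rw [add_smul_coordVec_apply, if_neg (Ne.symm h1)]; linarith
    · exact h1.le
  refine (h.hasDerivWithinAt_line hmem).hasDerivAt ?_
  rcases hx with ⟨h1, h2⟩ | h1
  · convert Filter.univ_mem using 1
    ext τ
    have h2' : 0 ≤ x N := h2
    simp only [Set.mem_univ, iff_true]
    change 0 ≤ (x + τ • coordVec i) N
    rw [add_smul_coordVec_apply, if_neg (Ne.symm h1)]; linarith
  · have hc : Continuous fun τ : ℝ => (x + τ • coordVec i) N := by fun_prop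
    filter_upwards [hc.continuousAt.eventually (lt_mem_nhds h1)] with τ hτ
    exact le_of_lt hτ

theorem exists_sub_eq (h : HasPartial N i f f') {x : EuclideanSpace ℝ (Fin n)}
    (hx : x ∈ upperHalf n N) {s : ℝ} (hs : 0 ≤ s) :
    ∃ θ, 0 ≤ θ ∧ θ ≤ s ∧ f (x + s • coordVec i) - f x = s * f' (x + θ • coordVec i) := by
  rcases hs.eq_or_lt with rfl | hs'
  · exact ⟨0, le_rfl, le_rfl, by simp⟩
  obtain ⟨θ, ⟨h0, h1⟩, hθ⟩ := exists_hasDerivAt_eq_slope (fun τ : ℝ => f (x + τ • coordVec i))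
    (fun τ => f' (x + τ • coordVec i)) hs' (fun τ hτ =>
      (h.hasDerivWithinAt_line (add_smul_coordVec_mem hx hτ.1 i)).continuousWithinAt.mono
        (fun σ hσ => add_smul_coordVec_mem hx hσ.1 i)) (fun τ hτ => by
      refine h.hasDerivAt_line ?_
      by_cases hi : i = N
      · right
        have hx' : 0 ≤ x N := hx
        rw [add_smul_coordVec_apply, if_pos hi.symm]; linarith [hτ.1]
      · exact Or.inl ⟨hi, hx⟩)
  refine ⟨θ, h0.le, h1.le, ?_⟩
  rw [hθ]
  simp only [zero_smul, add_zero, sub_zero]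
  field_simp

theorem shift (h : HasPartial N i f f') {a : EuclideanSpace ℝ (Fin n)} (ha : a ∈ upperHalf n N) :
    HasPartial N i (fun x => f (x + a)) (fun x => f' (x + a)) := by
  intro x hx
  have ha' : 0 ≤ a N := ha
  have hx' : 0 ≤ x N := hx
  have hxa : x + a ∈ upperHalf n N := by
    change 0 ≤ (x + a) N
    simp only [PiLp.add_apply]; linarith
  have key : ∀ τ : ℝ, x + τ • coordVec i + a = x + a + τ • coordVec i := fun τ => by abel
  simp only [key]
  refine (h _ hxa).mono fun τ hτ => ?_
  have hτ' : 0 ≤ (x + τ • coordVec i) N := hτ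
  change 0 ≤ (x + a + τ • coordVec i) N
  rw [← key, PiLp.add_apply]; linarith

theorem add (h : HasPartial N i f f') (hg : HasPartial N i g g') :
    HasPartial N i (fun x => f x + g x) (fun x => f' x + g' x) :=
  fun x hx => (h x hx).fun_add (hg x hx)

theorem sub (h : HasPartial N i f f') (hg : HasPartial N i g g') :
    HasPartial N i (fun x => f x - g x) (fun x => f' x - g' x) :=
  fun x hx => (h x hx).fun_sub (hg x hx)

theorem const_mul (h : HasPartial N i f f') (c : ℝ) :
    HasPartial N i (fun x => c * f x) (fun x => c * f' x) :=
  fun x hx => (h x hx).const_mul c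

theorem dilate (h : HasPartial N i f f') {s : ℝ} (hs : 0 < s) :
    HasPartial N i (fun x => f (s • x)) (fun x => s * f' (s • x)) := by
  intro x hx
  have hmem : ∀ y : EuclideanSpace ℝ (Fin n), y ∈ upperHalf n N → s • y ∈ upperHalf n N := by
    intro y hy
    have hy' : 0 ≤ y N := hy
    change 0 ≤ (s • y) N
    simp only [PiLp.smul_apply, smul_eq_mul]; positivity
  have h1 := h _ (hmem x hx)
  have h2 : HasDerivWithinAt (fun τ : ℝ => s * τ) s
      {τ : ℝ | x + τ • coordVec i ∈ upperHalf n N} 0 := by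
    simpa using ((hasDerivAt_id (0 : ℝ)).const_mul s).hasDerivWithinAt
  have key : ∀ τ : ℝ, s • x + (s * τ) • coordVec i = s • (x + τ • coordVec i) := by
    intro τ; module
  rw [← mul_zero s] at h1
  have h3 := HasDerivWithinAt.comp 0 h1 h2 (fun τ hτ => by
    change _ ∈ upperHalf n N
    rw [key]
    exact hmem _ hτ)
  simpa only [Function.comp_def, key, mul_comm _ s] using h3

end HasPartial

/-- `u` is continuous on the half-space, with first partial derivatives `p` and symmetric second
partial derivatives `P`. -/
structure HasSecondPartials {n : ℕ} (N : Fin n) (u : EuclideanSpace ℝ (Fin n) → ℝ)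
    (p : Fin n → EuclideanSpace ℝ (Fin n) → ℝ)
    (P : Fin n → Fin n → EuclideanSpace ℝ (Fin n) → ℝ) : Prop where
  cont : ContinuousOn u (upperHalf n N)
  fst : ∀ i, HasPartial N i u (p i)
  snd : ∀ i j, HasPartial N i (p j) (P i j)
  symm : ∀ i j, ∀ x ∈ upperHalf n N, P i j x = P j i x

theorem upperHalf_add {n : ℕ} {N : Fin n} {x y : EuclideanSpace ℝ (Fin n)}
    (hx : x ∈ upperHalf n N) (hy : y ∈ upperHalf n N) : x + y ∈ upperHalf n N :=
  show 0 ≤ x N + y N from add_nonneg hx hy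

/-- The mixed difference `f(x+a+b) - f(x+a) - f(x+b) + f(x)`. -/
def mixedDiff {n : ℕ} (a b : EuclideanSpace ℝ (Fin n)) (f : EuclideanSpace ℝ (Fin n) → ℝ)
    (x : EuclideanSpace ℝ (Fin n)) : ℝ :=
  f (x + (a + b)) - f (x + a) - f (x + b) + f x

theorem HasPartial.mixedDiff {n : ℕ} {N i : Fin n} {f f' : EuclideanSpace ℝ (Fin n) → ℝ}
    (h : HasPartial N i f f') {a b : EuclideanSpace ℝ (Fin n)}
    (ha : a ∈ upperHalf n N) (hb : b ∈ upperHalf n N) :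
    HasPartial N i (mixedDiff a b f) (mixedDiff a b f') :=
  (((h.shift (upperHalf_add ha hb)).sub (h.shift ha)).sub (h.shift hb)).add h

namespace HasSecondPartials

variable {n : ℕ} {N : Fin n} {u : EuclideanSpace ℝ (Fin n) → ℝ}
  {p : Fin n → EuclideanSpace ℝ (Fin n) → ℝ} {P : Fin n → Fin n → EuclideanSpace ℝ (Fin n) → ℝ}

theorem mixedDiff (h : HasSecondPartials N u p P) {a b : EuclideanSpace ℝ (Fin n)}
    (ha : a ∈ upperHalf n N) (hb : b ∈ upperHalf n N) :
    HasSecondPartials N (mixedDiff a b u) (fun i => mixedDiff a b (p i))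
      (fun i j => mixedDiff a b (P i j)) where
  cont := by
    have hs : ∀ c ∈ upperHalf n N, ContinuousOn (fun x => u (x + c)) (upperHalf n N) :=
      fun c hc => h.cont.comp (by fun_prop) (fun x hx => upperHalf_add hx hc)
    exact (((hs _ (upperHalf_add ha hb)).sub (hs a ha)).sub (hs b hb)).add h.cont
  fst i := (h.fst i).mixedDiff ha hb
  snd i j := (h.snd i j).mixedDiff ha hb
  symm i j x hx := by
    simp only [_root_.mixedDiff]
    rw [h.symm i j _ (upperHalf_add hx (upperHalf_add ha hb)), h.symm i j _ (upperHalf_add hx ha),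
      h.symm i j _ (upperHalf_add hx hb), h.symm i j _ hx]

theorem const_mul (h : HasSecondPartials N u p P) (c : ℝ) :
    HasSecondPartials N (fun x => c * u x) (fun i x => c * p i x) (fun i j x => c * P i j x) where
  cont := h.cont.const_mul c
  fst i := (h.fst i).const_mul c
  snd i j := (h.snd i j).const_mul c
  symm i j x hx := by rw [h.symm i j x hx]

theorem dilate (h : HasSecondPartials N u p P) {s : ℝ} (hs : 0 < s) :
    HasSecondPartials N (fun x => u (s • x)) (fun i x => s * p i (s • x))
      (fun i j x => s * (s * P i j (s • x))) where
  cont := h.cont.comp (by fun_prop) (fun x hx => by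
    have hx' : 0 ≤ x N := hx
    change 0 ≤ (s • x) N
    simp only [PiLp.smul_apply, smul_eq_mul]; positivity)
  fst i := (h.fst i).dilate hs
  snd i j := ((h.snd i j).dilate hs).const_mul s
  symm i j x hx := by
    rw [h.symm i j]
    have hx' : 0 ≤ x N := hx
    change 0 ≤ (s • x) N
    simp only [PiLp.smul_apply, smul_eq_mul]; positivity

end HasSecondPartials

/-- Mean value form of the mixed difference. -/
theorem exists_mixedDiff_eq {n : ℕ} {N a b : Fin n} {f f' f'' : EuclideanSpace ℝ (Fin n) → ℝ}
    (h : HasPartial N a f f') (h' : HasPartial N b f' f'') {x : EuclideanSpace ℝ (Fin n)}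
    (hx : x ∈ upperHalf n N) {s t : ℝ} (hs : 0 ≤ s) (ht : 0 ≤ t) :
    ∃ θ τ, 0 ≤ θ ∧ θ ≤ s ∧ 0 ≤ τ ∧ τ ≤ t ∧
      mixedDiff (s • coordVec a) (t • coordVec b) f x
        = s * t * f'' (x + θ • coordVec a + τ • coordVec b) := by
  have hb : t • coordVec b ∈ upperHalf n N := by
    have := add_smul_coordVec_mem (x := 0) (N := N) (n := n) (by simp [upperHalf]) ht b
    simpa using this
  obtain ⟨θ, h0, h1, hθ⟩ := ((h.shift hb).sub h).exists_sub_eq hx hs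
  obtain ⟨τ, h2, h3, hτ⟩ := h'.exists_sub_eq (add_smul_coordVec_mem hx h0 a) ht
  refine ⟨θ, τ, h0, h1, h2, h3, ?_⟩
  rw [hτ] at hθ
  rw [mul_assoc, ← hθ, mixedDiff, ← add_assoc]
  ring

theorem nonpos_of_isLocalMax_of_hasDerivAt {φ φ' : ℝ → ℝ} {d : ℝ}
    (hφ : ∀ᶠ τ in 𝓝 0, HasDerivAt φ (φ' τ) τ) (hφ' : HasDerivAt φ' d 0) (hmax : IsLocalMax φ 0) :
    d ≤ 0 := by
  by_contra! hd
  have h1 : deriv φ =ᶠ[𝓝 0] φ' := hφ.mono fun τ hτ => hτ.deriv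
  have h2 : deriv (deriv φ) 0 = d := by rw [h1.deriv_eq, hφ'.deriv]
  have hmin : IsLocalMin φ 0 := isLocalMin_of_deriv_deriv_pos (by rw [h2]; exact hd)
    hmax.deriv_eq_zero hφ.self_of_nhds.continuousAt
  have h3 : φ =ᶠ[𝓝 0] fun _ => φ 0 := by
    filter_upwards [hmin, hmax] with τ h h'
    exact le_antisymm h' h
  have h4 : deriv (deriv φ) 0 = 0 := by
    rw [h3.deriv.deriv_eq]; simp
  linarith

theorem hasDerivAt_quadratic (a β κ τ : ℝ) :
    HasDerivAt (fun τ : ℝ => a + β * τ + κ * τ ^ 2) (β + κ * (2 * τ)) τ := by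
  have := (((hasDerivAt_id τ).const_mul β).const_add a).fun_add
    (((hasDerivAt_id τ).fun_pow 2).const_mul κ)
  simpa using this

theorem EuclideanSpace.dist_sq_eq_sum {n : ℕ} (x y : EuclideanSpace ℝ (Fin n)) :
    dist x y ^ 2 = ∑ i, (x i - y i) ^ 2 := by
  rw [dist_eq_norm, EuclideanSpace.norm_sq_eq]
  simp [sq_abs]

theorem abs_sub_apply_le_dist {n : ℕ} (x y : EuclideanSpace ℝ (Fin n)) (i : Fin n) :
    |x i - y i| ≤ dist x y := by
  rw [dist_eq_norm]
  simpa using PiLp.norm_apply_le (x - y) i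

/-- Reflection of `y` across the hyperplane through `c` orthogonal to the `k`-th axis. -/
def reflectAt {n : ℕ} (c : EuclideanSpace ℝ (Fin n)) (k : Fin n) (y : EuclideanSpace ℝ (Fin n)) :
    EuclideanSpace ℝ (Fin n) :=
  y + (-2 * (y k - c k)) • coordVec k

section reflectAt

variable {n : ℕ} (c : EuclideanSpace ℝ (Fin n)) (k : Fin n)

theorem reflectAt_apply (y : EuclideanSpace ℝ (Fin n)) (j : Fin n) :
    reflectAt c k y j = if j = k then 2 * c k - y k else y j := by
  rw [reflectAt, add_smul_coordVec_apply]
  split_ifs with h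
  · subst h; ring
  · ring

theorem reflectAt_add_smul (y : EuclideanSpace ℝ (Fin n)) (τ : ℝ) (i : Fin n) :
    reflectAt c k (y + τ • coordVec i)
      = reflectAt c k y + ((if i = k then -1 else 1) * τ) • coordVec i := by
  ext j
  simp only [reflectAt_apply, add_smul_coordVec_apply]
  by_cases h1 : j = k <;> by_cases h2 : i = k <;> by_cases h3 : j = i <;>
    simp_all
  ring

theorem dist_reflectAt (y : EuclideanSpace ℝ (Fin n)) : dist (reflectAt c k y) c = dist y c := by
  have : dist (reflectAt c k y) c ^ 2 = dist y c ^ 2 := by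
    rw [EuclideanSpace.dist_sq_eq_sum, EuclideanSpace.dist_sq_eq_sum]
    refine Finset.sum_congr rfl fun j _ => ?_
    rw [reflectAt_apply]
    split_ifs with h
    · subst h; ring
    · rfl
  exact (pow_left_inj₀ dist_nonneg dist_nonneg two_ne_zero).1 this

theorem continuous_reflectAt : Continuous (reflectAt c k) := by
  unfold reflectAt; fun_prop

end reflectAt

theorem dist_sq_add_smul_coordVec {n : ℕ} (y c : EuclideanSpace ℝ (Fin n)) (τ : ℝ) (i : Fin n) :
    dist (y + τ • coordVec i) c ^ 2 = dist y c ^ 2 + 2 * (y i - c i) * τ + τ ^ 2 := by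
  have : ∀ j, ((y + τ • coordVec i) j - c j) ^ 2
      = (y j - c j) ^ 2 + if j = i then 2 * (y i - c i) * τ + τ ^ 2 else 0 := by
    intro j
    rw [add_smul_coordVec_apply]
    split_ifs with h
    · subst h; ring
    · ring
  rw [EuclideanSpace.dist_sq_eq_sum, EuclideanSpace.dist_sq_eq_sum, Finset.sum_congr rfl
    fun j _ => this j, Finset.sum_add_distrib, Finset.sum_ite_eq' Finset.univ i]
  simp; ring

theorem HasSecondPartials.sub_reflectAt_le_aux {n : ℕ} {N k : Fin n}
    {v : EuclideanSpace ℝ (Fin n) → ℝ}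
    {p : Fin n → EuclideanSpace ℝ (Fin n) → ℝ} {P : Fin n → Fin n → EuclideanSpace ℝ (Fin n) → ℝ}
    (h : HasSecondPartials N v p P) {c : EuclideanSpace ℝ (Fin n)} (hc : c ∈ upperHalf n N)
    {R m Φ Ψ η : ℝ} (hR : 0 < R) (hm : 0 ≤ m) (hΦ : 0 ≤ Φ) (hΨ : 0 ≤ Ψ) (hη : 0 < η)
    (hk : k ≠ N ∨ R < c N)
    (hv : ∀ y ∈ upperHalf n N, dist y c ≤ R → 2 * |v y - v c| ≤ m * R ^ 2)
    (hL : ∀ y ∈ upperHalf n N, dist y c ≤ R → |∑ i, P i i y| ≤ Φ)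
    (hB : ∀ y, y N = 0 → dist y c ≤ R → |p N y| ≤ Ψ)
    {y : EuclideanSpace ℝ (Fin n)} (hy : y ∈ upperHalf n N) (hyR : dist y c ≤ R)
    (hyk : c k ≤ y k) :
    v y - v (reflectAt c k y) ≤ m * dist y c ^ 2
      + (n * m + Φ + η) * ((y k - c k) * (2 * R - (y k - c k)))
      + (2 * Ψ + η) * (R - (y N - c N)) := by
  set σ := reflectAt c k with hσ
  set q := n * m + Φ + η with hq
  have hq0 : 0 < q := by positivity
  set b : EuclideanSpace ℝ (Fin n) → ℝ := fun y => m * dist y c ^ 2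
      + q * ((y k - c k) * (2 * R - (y k - c k))) + (2 * Ψ + η) * (R - (y N - c N)) with hb
  change v y - v (σ y) ≤ b y
  have hσH : ∀ y ∈ upperHalf n N, dist y c ≤ R → σ y ∈ upperHalf n N := by
    intro y hy hyR
    have hy' : 0 ≤ y N := hy
    change 0 ≤ σ y N
    rw [hσ, reflectAt_apply]
    split_ifs with hNk
    · rcases hk with hk | hk
      · exact absurd hNk.symm hk
      · have := (abs_le.1 ((abs_sub_apply_le_dist y c k).trans hyR)).2
        rw [← hNk] at this ⊢
        linarith
    · exact hy'
  set D := upperHalf n N ∩ closedBall c R ∩ {y | c k ≤ y k} with hD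
  have hDc : IsCompact D := by
    refine ((isCompact_closedBall c R).inter_left (isClosed_upperHalf n N)).inter_right ?_
    exact isClosed_le continuous_const (by fun_prop)
  have hcont : ContinuousOn (fun y => v y - v (σ y) - b y) D := by
    refine ((h.cont.mono fun y hy => hy.1.1).sub (h.cont.comp
      (continuous_reflectAt c k).continuousOn fun y hy => hσH y hy.1.1 hy.1.2)).sub ?_
    have : Continuous b := by rw [hb]; fun_prop
    exact this.continuousOn
  have hyD : y ∈ D := ⟨⟨hy, hyR⟩, hyk⟩
  obtain ⟨z, hzD, hz⟩ := hDc.exists_isMaxOn ⟨y, hyD⟩ hcont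
  by_contra! hcon
  have hpos : 0 < v z - v (σ z) - b z := by
    have := hz hyD
    simp only [Set.mem_ofPred_eq] at this
    linarith
  obtain ⟨⟨hzH, hzR⟩, hzk⟩ := hzD
  rw [mem_closedBall] at hzR
  have hzk : c k ≤ z k := hzk
  have hzH' : 0 ≤ z N := hzH
  have hzkR := (abs_le.1 ((abs_sub_apply_le_dist z c k).trans hzR)).2
  have hzNR := (abs_le.1 ((abs_sub_apply_le_dist z c N).trans hzR)).2
  have hb2 : 0 ≤ q * ((z k - c k) * (2 * R - (z k - c k))) :=
    mul_nonneg hq0.le (mul_nonneg (by linarith) (by linarith))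
  have hb3 : 0 ≤ (2 * Ψ + η) * (R - (z N - c N)) :=
    mul_nonneg (by linarith) (by linarith)
  have hzR' : dist z c < R := by
    refine lt_of_le_of_ne hzR fun heq => ?_
    have h1 := hv z hzH hzR
    have h2 := hv (σ z) (hσH z hzH hzR) ((dist_reflectAt c k z).le.trans hzR)
    have h3 := le_abs_self (v z - v c)
    have h4 := neg_abs_le (v (σ z) - v c)
    have : b z = m * R ^ 2 + q * ((z k - c k) * (2 * R - (z k - c k)))
      + (2 * Ψ + η) * (R - (z N - c N)) := by simp only [hb, heq]
    linarith
  have hzk' : c k < z k := by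
    refine lt_of_le_of_ne hzk fun heq => ?_
    have hσz : σ z = z := by
      rw [hσ, reflectAt, ← heq]; simp
    rw [hσz] at hpos
    have : 0 ≤ m * dist z c ^ 2 := by positivity
    have : 0 ≤ b z := by simp only [hb]; linarith
    linarith
  have hmax : ∀ i, (i ≠ N ∨ 0 < z N) →
      IsLocalMax (fun τ : ℝ => v (z + τ • coordVec i) - v (σ (z + τ • coordVec i))
        - b (z + τ • coordVec i)) 0 := by
    intro i hi
    have e0 : z + (0 : ℝ) • coordVec i = z := by simp
    have c1 : Continuous fun τ : ℝ => dist (z + τ • coordVec i) c := by fun_prop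
    have c2 : Continuous fun τ : ℝ => (z + τ • coordVec i) k := by fun_prop
    have c3 : Continuous fun τ : ℝ => (z + τ • coordVec i) N := by fun_prop
    have c4 : ∀ᶠ τ : ℝ in 𝓝 0, 0 ≤ (z + τ • coordVec i) N := by
      rcases hi with hi | hi
      · refine Eventually.of_forall fun τ => ?_
        rw [add_smul_coordVec_apply, if_neg (Ne.symm hi)]; linarith
      · exact ((c3.tendsto 0).eventually_const_lt (u := 0) (by rw [e0]; exact hi)).mono
          fun τ hτ => le_of_lt hτ
    filter_upwards [(c1.tendsto 0).eventually_lt_const (u := R) (by rw [e0]; exact hzR'),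
      (c2.tendsto 0).eventually_const_lt (u := c k) (by rw [e0]; exact hzk'), c4]
      with τ h1 h2 h3
    simp only [e0]
    exact hz ⟨⟨h3, le_of_lt h1⟩, le_of_lt h2⟩
  rcases hzH'.eq_or_lt with hzN | hzN
  · -- boundary maximum
    have hkN : k ≠ N := by
      rintro rfl
      have : 0 ≤ c k := hc
      linarith
    have hσzN : σ z N = 0 := by rw [hσ, reflectAt_apply, if_neg hkN.symm, hzN]
    have hset : {τ : ℝ | z + τ • coordVec N ∈ upperHalf n N} = Set.Ici 0 := by
      ext τ
      change 0 ≤ (z + τ • coordVec N) N ↔ 0 ≤ τ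
      rw [add_smul_coordVec_apply, if_pos rfl, ← hzN, zero_add]
    have hset' : {τ : ℝ | σ z + τ • coordVec N ∈ upperHalf n N} = Set.Ici 0 := by
      ext τ
      change 0 ≤ (σ z + τ • coordVec N) N ↔ 0 ≤ τ
      rw [add_smul_coordVec_apply, if_pos rfl, hσzN, zero_add]
    have d1 := h.fst N z hzH
    have d2 := h.fst N (σ z) (hσH z hzH hzR)
    rw [hset] at d1
    rw [hset'] at d2
    have d3 : HasDerivWithinAt (fun τ : ℝ => b (z + τ • coordVec N))
        (m * (2 * (z N - c N)) - (2 * Ψ + η)) (Set.Ici 0) 0 := by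
      have : (fun τ : ℝ => b (z + τ • coordVec N)) = fun τ => (b z
          + (m * (2 * (z N - c N)) - (2 * Ψ + η)) * τ) + m * τ ^ 2 := by
        ext τ
        simp only [hb, dist_sq_add_smul_coordVec, add_smul_coordVec_apply, if_neg hkN]
        simp only [if_true]
        ring
      rw [this]
      simpa using (hasDerivAt_quadratic (b z) (m * (2 * (z N - c N)) - (2 * Ψ + η)) m
        0).hasDerivWithinAt
    have d := (d1.fun_sub d2).fun_sub d3
    have hloc : IsLocalMaxOn (fun τ : ℝ => v (z + τ • coordVec N) - v (σ z + τ • coordVec N)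
        - b (z + τ • coordVec N)) (Set.Ici 0) 0 := by
      have c1 : Continuous fun τ : ℝ => dist (z + τ • coordVec N) c := by fun_prop
      filter_upwards [mem_nhdsWithin_of_mem_nhds ((c1.tendsto 0).eventually_lt_const
        (u := R) (by simpa using hzR')), self_mem_nhdsWithin]
        with τ h1 h2
      have h2' : (0 : ℝ) ≤ τ := h2
      have h3 : σ (z + τ • coordVec N) = σ z + τ • coordVec N := by
        rw [hσ, reflectAt_add_smul, if_neg hkN.symm, one_mul]
      rw [← h3]
      have h4 : z + τ • coordVec N ∈ D := by
        refine ⟨⟨add_smul_coordVec_mem hzH h2' N, le_of_lt h1⟩, ?_⟩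
        change c k ≤ (z + τ • coordVec N) k
        rw [add_smul_coordVec_apply, if_neg hkN]; linarith
      simpa using hz h4
    have h5 := hloc.hasFDerivWithinAt_nonpos d.hasFDerivWithinAt
      (y := 1) (mem_posTangentConeAt_of_segment_subset (by
        rw [zero_add, segment_eq_Icc zero_le_one]; exact fun x hx => hx.1))
    simp only [ContinuousLinearMap.toSpanSingleton_apply, one_smul] at h5
    have h6 := hB z hzN.symm hzR
    have h7 := hB (σ z) hσzN ((dist_reflectAt c k z).le.trans hzR)
    have h8 := neg_abs_le (p N z)
    have h9 := le_abs_self (p N (σ z))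
    have h10 : 0 ≤ m * c N := mul_nonneg hm hc
    rw [← hzN] at h5
    linarith
  · have hσzN : 0 < σ z N := by
      rw [hσ, reflectAt_apply]
      split_ifs with hNk
      · rcases hk with hk | hk
        · exact absurd hNk.symm hk
        · rw [← hNk] at hzkR ⊢; linarith
      · exact hzN
    have key : ∀ i, P i i z - P i i (σ z) ≤ 2 * m - if i = k then 2 * q else 0 := by
      intro i
      set s : ℝ := if i = k then -1 else 1 with hs
      have hss : s * s = 1 := by rw [hs]; split_ifs <;> norm_num
      set β : ℝ := 2 * m * (z i - c i) + (if k = i then q * (2 * R - 2 * (z k - c k)) else 0)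
        - (if N = i then 2 * Ψ + η else 0) with hβ
      set κ : ℝ := m - if i = k then q else 0 with hκ
      have hbline : ∀ τ : ℝ, b (z + τ • coordVec i) = (b z + β * τ) + κ * τ ^ 2 := by
        intro τ
        simp only [hb, dist_sq_add_smul_coordVec, add_smul_coordVec_apply, hβ, hκ]
        by_cases h1 : k = i
        · subst h1
          simp only [if_true]
          split_ifs <;> ring
        · rw [if_neg h1, if_neg h1, if_neg (Ne.symm h1)]
          split_ifs <;> ring
      have hline : ∀ (f f' : EuclideanSpace ℝ (Fin n) → ℝ), HasPartial N i f f' →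
          ∀ᶠ τ : ℝ in 𝓝 0, HasDerivAt (fun τ : ℝ => f (z + τ • coordVec i))
            (f' (z + τ • coordVec i)) τ ∧
            HasDerivAt (fun τ : ℝ => f (σ z + (s * τ) • coordVec i))
            (s * f' (σ z + (s * τ) • coordVec i)) τ := by
        intro f f' hf
        have c1 : Continuous fun τ : ℝ => (z + τ • coordVec i) N := by fun_prop
        have c2 : Continuous fun τ : ℝ => (σ z + (s * τ) • coordVec i) N := by fun_prop
        filter_upwards [(c1.tendsto 0).eventually_const_lt (u := 0) (by simpa using hzN),
          (c2.tendsto 0).eventually_const_lt (u := 0) (by simpa using hσzN)] with τ h1 h2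
        refine ⟨hf.hasDerivAt_line (Or.inr h1), ?_⟩
        have h3 := hf.hasDerivAt_line (Or.inr h2)
        have h4 : HasDerivAt (fun τ : ℝ => s * τ) s τ := by
          simpa using (hasDerivAt_id τ).const_mul s
        have h5 := HasDerivAt.comp (h := fun τ : ℝ => s * τ) τ h3 h4
        rw [mul_comm] at h5
        exact h5
      have hφ := hmax i (Or.inr hzN)
      simp only [hσ, reflectAt_add_smul, hbline] at hφ
      rw [← hσ, ← hs] at hφ
      have hd := nonpos_of_isLocalMax_of_hasDerivAt
        (φ' := fun τ => p i (z + τ • coordVec i) - s * p i (σ z + (s * τ) • coordVec i)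
          - (β + κ * (2 * τ)))
        (d := P i i z - s * (s * P i i (σ z)) - κ * 2) ?_ ?_ hφ
      · rw [← mul_assoc, hss, one_mul, hκ] at hd
        split_ifs at hd ⊢ <;> linarith
      · filter_upwards [hline _ _ (h.fst i)] with τ hτ
        exact (hτ.1.fun_sub hτ.2).fun_sub (hasDerivAt_quadratic (b z) β κ τ)
      · obtain ⟨h1, h2⟩ := (hline _ _ (h.snd i i)).self_of_nhds
        have h3 := (((hasDerivAt_id (0 : ℝ)).const_mul 2).const_mul κ).const_add β
        have := (h1.fun_sub (h2.const_mul s)).fun_sub h3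
        simpa using this
    have hsum := Finset.sum_le_sum fun i (_ : i ∈ Finset.univ) => key i
    rw [Finset.sum_sub_distrib, Finset.sum_sub_distrib, Finset.sum_ite_eq' Finset.univ k] at hsum
    simp only [Finset.sum_const, Finset.card_univ, Fintype.card_fin, nsmul_eq_mul,
      Finset.mem_univ, if_true] at hsum
    have h1 := (abs_le.1 (hL z hzH hzR)).1
    have h2 := (abs_le.1 (hL (σ z) (hσH z hzH hzR) ((dist_reflectAt c k z).le.trans hzR))).2
    linarith

theorem HasSecondPartials.sub_le_of_bounds {n : ℕ} {N k : Fin n}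
    {v : EuclideanSpace ℝ (Fin n) → ℝ}
    {p : Fin n → EuclideanSpace ℝ (Fin n) → ℝ} {P : Fin n → Fin n → EuclideanSpace ℝ (Fin n) → ℝ}
    (h : HasSecondPartials N v p P) {x : EuclideanSpace ℝ (Fin n)} (hx : x ∈ upperHalf n N)
    {R M Φ Ψ σ a : ℝ} (hR : 1 ≤ R) (hΦ : 0 ≤ Φ) (hΨ : 0 ≤ Ψ)
    (hσ0 : 0 ≤ σ) (hσ1 : σ ≤ 1) (hk : k ≠ N ∨ R < x N)
    (hv : ∀ y ∈ upperHalf n N, dist y x ≤ R + 1 → |v y - a| ≤ M)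
    (hL : ∀ y ∈ upperHalf n N, dist y x ≤ R + 1 → |∑ i, P i i y| ≤ Φ)
    (hB : ∀ y, y N = 0 → dist y x ≤ R + 1 → |p N y| ≤ Ψ) :
    v (x + σ • coordVec k) - v x ≤ 4 * (n + 1) * M / R + (Φ + 2 * Ψ) * R := by
  have hM : 0 ≤ M := (abs_nonneg _).trans (hv x hx (by simp; linarith))
  have hR0 : 0 < R := by linarith
  set c := x + (σ / 2) • coordVec k with hc
  have hcH : c ∈ upperHalf n N := add_smul_coordVec_mem hx (by linarith) k
  have hdc : dist c x = σ / 2 := dist_add_smul_coordVec_self x (by linarith) k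
  have hd : ∀ y, dist y c ≤ R → dist y x ≤ R + 1 := fun y hy => by
    linarith [dist_triangle y c x]
  have hck : c k = x k + σ / 2 := by rw [hc, add_smul_coordVec_apply, if_pos rfl]
  set m := 4 * M / R ^ 2 with hm
  have hm0 : 0 ≤ m := by positivity
  have hmR : m * R ^ 2 = 4 * M := by rw [hm]; field_simp
  have hyc : x + σ • coordVec k = c + (σ / 2) • coordVec k := by rw [hc]; module
  have hdy : dist (x + σ • coordVec k) c = σ / 2 := by
    rw [hyc]; exact dist_add_smul_coordVec_self c (by linarith) k
  have hyk : (x + σ • coordVec k) k = x k + σ := by rw [add_smul_coordVec_apply, if_pos rfl]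
  have hrefl : reflectAt c k (x + σ • coordVec k) = x := by
    rw [reflectAt, hck, hyk]; module
  refine le_of_forall_pos_le_add fun η hη => ?_
  have hη' : 0 < η / (2 * R) := by positivity
  have key := h.sub_reflectAt_le_aux hcH hR0 hm0 hΦ hΨ hη' (k := k) ?_ ?_
    (fun y hy hyc => hL y hy (hd y hyc)) (fun y hy hyc => hB y hy (hd y hyc))
    (add_smul_coordVec_mem hx hσ0 k) (by rw [hdy]; linarith) (by rw [hck, hyk]; linarith)
  · rw [hrefl, hdy, hyk, hck] at key
    have hN : 0 ≤ (x + σ • coordVec k) N - c N := by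
      rw [hyc, add_smul_coordVec_apply]; split_ifs <;> linarith
    have e1 : x k + σ - (x k + σ / 2) = σ / 2 := by ring
    rw [e1] at key
    have i1 : m * (σ / 2) ^ 2 ≤ m * R := by
      refine mul_le_mul_of_nonneg_left ?_ hm0
      nlinarith
    have i2 : (n * m + Φ + η / (2 * R)) * (σ / 2 * (2 * R - σ / 2))
        ≤ (n * m + Φ + η / (2 * R)) * R := by
      refine mul_le_mul_of_nonneg_left ?_ (by positivity)
      nlinarith
    have i3 : (2 * Ψ + η / (2 * R)) * (R - ((x + σ • coordVec k) N - c N))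
        ≤ (2 * Ψ + η / (2 * R)) * R := by
      refine mul_le_mul_of_nonneg_left ?_ (by positivity)
      linarith
    have e2 : m * R = 4 * M / R := by rw [hm]; field_simp
    have e3 : 4 * (n + 1) * M / R = (n + 1) * (m * R) := by rw [e2]; ring
    have e4 : η / (2 * R) * R = η / 2 := by field_simp
    rw [e3]
    nlinarith
  · rcases hk with hk | hk
    · exact Or.inl hk
    · right
      rw [hc, add_smul_coordVec_apply]; split_ifs <;> linarith
  · intro y hy hyc
    rw [hmR]
    have h1 := abs_le.1 (hv y hy (hd y hyc))
    have h2 := abs_le.1 (hv c hcH (by linarith))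
    have : |v y - v c| ≤ 2 * M := abs_le.2 ⟨by linarith [h1.1, h2.2], by linarith [h1.2, h2.1]⟩
    linarith

/-- Oscillation bound in a coordinate direction for a function with bounded Laplacian and bounded
normal derivative on the boundary, obtained from the maximum principle. -/
theorem HasSecondPartials.abs_sub_le_of_bounds {n : ℕ} {N k : Fin n}
    {v : EuclideanSpace ℝ (Fin n) → ℝ}
    {p : Fin n → EuclideanSpace ℝ (Fin n) → ℝ} {P : Fin n → Fin n → EuclideanSpace ℝ (Fin n) → ℝ}
    (h : HasSecondPartials N v p P) {x : EuclideanSpace ℝ (Fin n)} (hx : x ∈ upperHalf n N)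
    {R M Φ Ψ σ a : ℝ} (hR : 1 ≤ R) (hΦ : 0 ≤ Φ) (hΨ : 0 ≤ Ψ)
    (hσ0 : 0 ≤ σ) (hσ1 : σ ≤ 1) (hk : k ≠ N ∨ R < x N)
    (hv : ∀ y ∈ upperHalf n N, dist y x ≤ R + 1 → |v y - a| ≤ M)
    (hL : ∀ y ∈ upperHalf n N, dist y x ≤ R + 1 → |∑ i, P i i y| ≤ Φ)
    (hB : ∀ y, y N = 0 → dist y x ≤ R + 1 → |p N y| ≤ Ψ) :
    |v (x + σ • coordVec k) - v x| ≤ 4 * (n + 1) * M / R + (Φ + 2 * Ψ) * R := by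
  have h1 := h.sub_le_of_bounds hx hR hΦ hΨ hσ0 hσ1 hk hv hL hB
  have h2 := (h.const_mul (-1)).sub_le_of_bounds hx hR hΦ hΨ hσ0 hσ1 hk (M := M) (a := -a)
    (fun y hy hyx => by
      rw [show -1 * v y - -a = -(v y - a) by ring, abs_neg]; exact hv y hy hyx)
    (fun y hy hyx => by
      rw [← Finset.mul_sum, neg_one_mul, abs_neg]; exact hL y hy hyx)
    (fun y hy hyx => by rw [neg_one_mul, abs_neg]; exact hB y hy hyx)
  exact abs_le.2 ⟨by linarith, h1⟩

/-- Hölder bounds, on the part of the ball `B(x, K)` in the half-space, for the second derivatives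
(`S`), the Laplacian (`F`) and the tangential gradient of the Neumann datum (`G`) of `u`. -/
structure HolderData {n : ℕ} (N : Fin n) (α : ℝ) (u : EuclideanSpace ℝ (Fin n) → ℝ)
    (p : Fin n → EuclideanSpace ℝ (Fin n) → ℝ) (P : Fin n → Fin n → EuclideanSpace ℝ (Fin n) → ℝ)
    (x : EuclideanSpace ℝ (Fin n)) (K S F G : ℝ) : Prop where
  sec : HasSecondPartials N u p P
  hess : ∀ i j, ∀ y ∈ upperHalf n N, ∀ z ∈ upperHalf n N, dist y x ≤ K → dist z x ≤ K →
    |P i j y - P i j z| ≤ S * dist y z ^ α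
  lap : ∀ y ∈ upperHalf n N, ∀ z ∈ upperHalf n N, dist y x ≤ K → dist z x ≤ K →
    |∑ i, P i i y - ∑ i, P i i z| ≤ F * dist y z ^ α
  bdry : ∀ j, j ≠ N → ∀ y z, y N = 0 → z N = 0 → dist y x ≤ K → dist z x ≤ K →
    |P j N y - P j N z| ≤ G * dist y z ^ α
  nonneg : 0 ≤ S ∧ 0 ≤ F ∧ 0 ≤ G

theorem HolderData.recenter {n : ℕ} {N : Fin n} {α : ℝ} {u : EuclideanSpace ℝ (Fin n) → ℝ}
    {p : Fin n → EuclideanSpace ℝ (Fin n) → ℝ} {P : Fin n → Fin n → EuclideanSpace ℝ (Fin n) → ℝ}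
    {x : EuclideanSpace ℝ (Fin n)} {K S F G : ℝ} (h : HolderData N α u p P x K S F G)
    {x' : EuclideanSpace ℝ (Fin n)} {K' : ℝ} (hK : dist x' x + K' ≤ K) :
    HolderData N α u p P x' K' S F G := by
  have hd : ∀ y, dist y x' ≤ K' → dist y x ≤ K := fun y hy => by
    linarith [dist_triangle y x' x]
  exact ⟨h.sec, fun i j y hy z hz h1 h2 => h.hess i j y hy z hz (hd y h1) (hd z h2),
    fun y hy z hz h1 h2 => h.lap y hy z hz (hd y h1) (hd z h2),
    fun j hj y z hy hz h1 h2 => h.bdry j hj y z hy hz (hd y h1) (hd z h2), h.nonneg⟩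

theorem smul_coordVec_mem {n : ℕ} (N i : Fin n) {t : ℝ} (ht : 0 ≤ t) :
    t • coordVec i ∈ upperHalf n N := by
  have := add_smul_coordVec_mem (x := 0) (N := N) (n := n) (by simp [upperHalf]) ht i
  simpa using this

theorem HasPartial.exists_mixedDiff_eq {n : ℕ} {N b : Fin n}
    {f f' : EuclideanSpace ℝ (Fin n) → ℝ} (h : HasPartial N b f f')
    {a x : EuclideanSpace ℝ (Fin n)} (ha : a ∈ upperHalf n N) (hx : x ∈ upperHalf n N) {t : ℝ}
    (ht : 0 ≤ t) : ∃ θ, 0 ≤ θ ∧ θ ≤ t ∧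
      _root_.mixedDiff a (t • coordVec b) f x
      = t * (f' (x + θ • coordVec b + a) - f' (x + θ • coordVec b)) := by
  obtain ⟨θ, h0, h1, hθ⟩ := ((h.shift ha).sub h).exists_sub_eq hx ht
  refine ⟨θ, h0, h1, ?_⟩
  rw [← hθ, _root_.mixedDiff, add_comm a, ← add_assoc]
  ring

theorem mixedDiff_comm {n : ℕ} (a b : EuclideanSpace ℝ (Fin n))
    (f : EuclideanSpace ℝ (Fin n) → ℝ) (x : EuclideanSpace ℝ (Fin n)) :
    mixedDiff a b f x = mixedDiff b a f x := by
  rw [mixedDiff, mixedDiff, add_comm a b]; ring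

theorem exists_rpow_le {α δ : ℝ} (hα : 0 < α) (hδ : 0 < δ) :
    ∃ ε : ℝ, 0 < ε ∧ ε ≤ 1 / 2 ∧ 2 * (2 * ε) ^ α ≤ δ := by
  have hc : ContinuousAt (fun ε : ℝ => 2 * (2 * ε) ^ α) 0 := by
    refine ContinuousAt.mul continuousAt_const (ContinuousAt.rpow_const (by fun_prop) (Or.inr hα.le))
  have h0 : (fun ε : ℝ => 2 * (2 * ε) ^ α) 0 < δ := by
    simpa [Real.zero_rpow hα.ne'] using hδ
  have h1 := (hc.tendsto.eventually_lt_const h0).filter_mono (nhdsWithin_le_nhds (s := Set.Ioi 0))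
  have h2 : ∀ᶠ ε : ℝ in 𝓝[>] 0, ε ≤ 1 / 2 :=
    ((eventually_le_nhds (by norm_num : (0 : ℝ) < 1 / 2))).filter_mono nhdsWithin_le_nhds
  obtain ⟨ε, h3, h4, h5⟩ := (h1.and (h2.and self_mem_nhdsWithin)).exists
  exact ⟨ε, h5, h4, h3.le⟩

theorem exists_mul_rpow_div_le {α δ : ℝ} (C : ℝ) (hα : α < 1) (hδ : 0 < δ) :
    ∃ R : ℝ, 1 ≤ R ∧ C * (3 * R) ^ α / R ≤ δ := by
  have h1 : Tendsto (fun R : ℝ => C * 3 ^ α * R ^ (-(1 - α))) atTop (𝓝 (C * 3 ^ α * 0)) :=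
    (tendsto_rpow_neg_atTop (by linarith)).const_mul _
  rw [mul_zero] at h1
  obtain ⟨R, h2, h3⟩ := ((h1.eventually_lt_const hδ).and (eventually_ge_atTop 1)).exists
  refine ⟨R, h3, ?_⟩
  have hR : 0 < R := by linarith
  rw [neg_sub, Real.rpow_sub hR, Real.rpow_one] at h2
  rw [Real.mul_rpow (by norm_num) hR.le]
  refine le_of_eq_of_le ?_ h2.le
  ring

/-- Up to a small multiple of the Hölder constant of the Hessian, tangential second derivatives
are controlled in tangential directions; in the interior this holds in all directions. -/
theorem exists_hess_control_tangential {n : ℕ} (N : Fin n) {α : ℝ} (hα₁ : 0 < α) (hα₂ : α < 1)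
    {δ : ℝ} (hδ : 0 < δ) :
    ∃ K C : ℝ, 1 ≤ K ∧ 0 ≤ C ∧ ∀ u p P x S F G, x ∈ upperHalf n N →
      HolderData N α u p P x K S F G → ∀ i j k, ((i ≠ N ∧ j ≠ N ∧ k ≠ N) ∨ K ≤ x N) →
      ∀ σ : ℝ, 0 ≤ σ → σ ≤ 1 → |P i j (x + σ • coordVec k) - P i j x| ≤ δ * S + C * (F + G) := by
  obtain ⟨ε, hε0, hε1, hε⟩ := exists_rpow_le hα₁ (half_pos hδ)
  obtain ⟨R, hR1, hR⟩ := exists_mul_rpow_div_le (4 * (n + 1)) hα₂ (half_pos hδ)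
  have hR0 : 0 < R := by linarith
  refine ⟨R + 3, 2 * R / ε ^ 2, by linarith, by positivity, ?_⟩
  intro u p P x S F G hx h i j k hijk σ hσ0 hσ1
  obtain ⟨hS, hF, hG⟩ := h.nonneg
  have hεα : ε ^ α ≤ 1 := Real.rpow_le_one hε0.le (by linarith) hα₁.le
  have hai := smul_coordVec_mem N i hε0.le
  have haj := smul_coordVec_mem N j hε0.le
  have hv := ((h.sec.mixedDiff hai haj).const_mul (ε ^ 2)⁻¹)
  set v := fun y => (ε ^ 2)⁻¹ * mixedDiff (ε • coordVec i) (ε • coordVec j) u y with hvdef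
  have hvP : ∀ y ∈ upperHalf n N, dist y x ≤ R + 2 → ∃ z ∈ upperHalf n N, dist z y ≤ 2 * ε ∧
      v y = P i j z := by
    intro y hy hyx
    obtain ⟨θ, τ, h0, h1, h2, h3, h4⟩ := _root_.exists_mixedDiff_eq (h.sec.fst i) (h.sec.snd j i)
      hy hε0.le hε0.le
    have hz1 := add_smul_coordVec_mem hy h0 i
    have hz := add_smul_coordVec_mem hz1 h2 j
    refine ⟨_, hz, ?_, ?_⟩
    · have := dist_triangle (y + θ • coordVec i + τ • coordVec j) (y + θ • coordVec i) y
      rw [dist_add_smul_coordVec_self _ h0, dist_add_smul_coordVec_self _ h2] at this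
      linarith
    · rw [hvdef]
      simp only
      rw [h4, h.sec.symm i j _ hz]
      field_simp
  have hclose : ∀ y ∈ upperHalf n N, dist y x ≤ R + 2 → |v y - P i j y| ≤ S * (2 * ε) ^ α := by
    intro y hy hyx
    obtain ⟨z, hz, hzy, hvz⟩ := hvP y hy hyx
    rw [hvz]
    refine (h.hess i j z hz y hy (by linarith [dist_triangle z y x]) (by linarith)).trans ?_
    gcongr
  have key := hv.abs_sub_le_of_bounds (k := k) (σ := σ) (Φ := 2 * F / ε ^ 2) (Ψ := G / ε ^ 2)
    (M := S * (3 * R) ^ α) (a := P i j x) (R := R) hx hR1 (by positivity) (by positivity) hσ0 hσ1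
    ?_ ?_ ?_ ?_
  · have h1 := abs_le.1 (hclose x hx (by simp; linarith))
    have hxσ : dist (x + σ • coordVec k) x = σ := dist_add_smul_coordVec_self x hσ0 k
    have h2 := abs_le.1 (hclose _ (add_smul_coordVec_mem hx hσ0 k) (by linarith))
    have h3 := abs_le.1 key
    have h4 : 4 * (n + 1) * (S * (3 * R) ^ α) / R ≤ δ / 2 * S := by
      rw [show 4 * (n + 1) * (S * (3 * R) ^ α) / R = 4 * (n + 1) * (3 * R) ^ α / R * S by ring]
      gcongr
    have h5 : 2 * (S * (2 * ε) ^ α) ≤ δ / 2 * S := by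
      rw [show 2 * (S * (2 * ε) ^ α) = 2 * (2 * ε) ^ α * S by ring]
      gcongr
    have h6 : (2 * F / ε ^ 2 + 2 * (G / ε ^ 2)) * R = 2 * R / ε ^ 2 * (F + G) := by ring
    rw [h6] at h3
    exact abs_le.2 ⟨by linarith [h1.1, h1.2, h2.1, h2.2, h3.1],
      by linarith [h1.1, h1.2, h2.1, h2.2, h3.2]⟩
  · rcases hijk with h1 | h1
    · exact Or.inl h1.2.2
    · right; linarith
  · intro y hy hyx
    obtain ⟨z, hz, hzy, hvz⟩ := hvP y hy (by linarith)
    rw [hvz]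
    have hzx := dist_triangle z y x
    refine (h.hess i j z hz x hx (by linarith) (by simp; linarith)).trans ?_
    gcongr
    linarith
  · intro y hy hyx
    rw [← Finset.mul_sum, abs_mul, abs_of_nonneg (by positivity), inv_mul_eq_div]
    gcongr
    have e1 : ∑ l, mixedDiff (ε • coordVec i) (ε • coordVec j) (P l l) y
        = (∑ l, P l l (y + ε • coordVec j + ε • coordVec i) - ∑ l, P l l (y + ε • coordVec j))
          - (∑ l, P l l (y + ε • coordVec i) - ∑ l, P l l y) := by
      simp only [← Finset.sum_sub_distrib]
      refine Finset.sum_congr rfl fun l _ => ?_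
      rw [mixedDiff, add_comm (ε • coordVec i), ← add_assoc]; ring
    rw [e1]
    have hstep : ∀ z ∈ upperHalf n N, dist z x ≤ R + 2 →
        |∑ l, P l l (z + ε • coordVec i) - ∑ l, P l l z| ≤ F := by
      intro z hz hzx
      have hd := dist_add_smul_coordVec_self z hε0.le i
      refine (h.lap _ (add_smul_coordVec_mem hz hε0.le i) z hz
        (by linarith [dist_triangle (z + ε • coordVec i) z x]) (by linarith)).trans ?_
      rw [hd]
      exact mul_le_of_le_one_right hF hεα
    have hd := dist_add_smul_coordVec_self y hε0.le j
    have h1 := abs_le.1 (hstep _ (add_smul_coordVec_mem hy hε0.le j)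
      (by linarith [dist_triangle (y + ε • coordVec j) y x]))
    have h2 := abs_le.1 (hstep y hy (by linarith))
    exact abs_le.2 ⟨by linarith [h1.1, h2.2], by linarith [h1.2, h2.1]⟩
  · intro y hy hyx
    rcases hijk with ⟨hi, hj, -⟩ | hK
    · have hyH : y ∈ upperHalf n N := hy.ge
      rw [abs_mul, abs_of_nonneg (by positivity), inv_mul_eq_div]
      gcongr
      obtain ⟨θ, h0, h1, h2⟩ := (h.sec.snd j N).exists_mixedDiff_eq hai hyH hε0.le
      rw [h2, abs_mul, abs_of_nonneg hε0.le]
      have hz : (y + θ • coordVec j) N = 0 := by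
        rw [add_smul_coordVec_apply, if_neg (Ne.symm hj), hy, add_zero]
      have hz' : (y + θ • coordVec j + ε • coordVec i) N = 0 := by
        rw [add_smul_coordVec_apply, if_neg (Ne.symm hi), hz, add_zero]
      have hd := dist_add_smul_coordVec_self y h0 j
      have hd' := dist_add_smul_coordVec_self (y + θ • coordVec j) hε0.le i
      have t1 := dist_triangle (y + θ • coordVec j) y x
      have t2 := dist_triangle (y + θ • coordVec j + ε • coordVec i) (y + θ • coordVec j) x
      have h3 := h.bdry j hj _ _ hz' hz (by linarith) (by linarith)
      rw [hd'] at h3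
      have h4 : G * ε ^ α ≤ G := mul_le_of_le_one_right hG hεα
      nlinarith [abs_nonneg (P j N (y + θ • coordVec j + ε • coordVec i)
        - P j N (y + θ • coordVec j))]
    · exfalso
      have := (abs_le.1 ((abs_sub_apply_le_dist y x N).trans hyx)).1
      linarith

/-- At points at height at most `K₀`, increments of `P i j` over steps of length at most `1` in
the direction `k` are bounded by `δ * S + C * (F + G)`. -/
def HessBound {n : ℕ} (N : Fin n) (α δ K₀ : ℝ) (i j k : Fin n) (K C : ℝ) : Prop :=
  ∀ u p P x S F G, x ∈ upperHalf n N → x N ≤ K₀ → HolderData N α u p P x K S F G →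
    ∀ σ : ℝ, 0 ≤ σ → σ ≤ 1 → |P i j (x + σ • coordVec k) - P i j x| ≤ δ * S + C * (F + G)

theorem HessBound.mono {n : ℕ} {N : Fin n} {α δ K₀ : ℝ} {i j k : Fin n} {K C K' C' : ℝ}
    (h : HessBound N α δ K₀ i j k K C) (hK : K ≤ K') (hC : C ≤ C') :
    HessBound N α δ K₀ i j k K' C' := by
  intro u p P x S F G hx hxK hd σ h0 h1
  obtain ⟨hS, hF, hG⟩ := hd.nonneg
  refine (h u p P x S F G hx hxK (hd.recenter (by simpa using hK)) σ h0 h1).trans ?_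
  gcongr

/-- `HessBound` holds for every small parameter and every height. -/
def HessControl {n : ℕ} (N : Fin n) (α : ℝ) (i j k : Fin n) : Prop :=
  ∀ K₀ δ : ℝ, 0 < δ → ∃ K C, HessBound N α δ K₀ i j k K C

theorem exists_forall_of_mono {ι : Type*} [Fintype ι] {Q : ι → ℝ → ℝ → Prop}
    (hQ : ∀ i K C K' C', K ≤ K' → C ≤ C' → Q i K C → Q i K' C') (h : ∀ i, ∃ K C, Q i K C)
    (A : ℝ) : ∃ K C, A ≤ K ∧ 0 ≤ C ∧ ∀ i, Q i K C := by
  choose K C hKC using h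
  have hs : ∀ (f : ι → ℝ) i, f i ≤ ∑ i, |f i| := fun f i =>
    (le_abs_self _).trans
      (Finset.single_le_sum (f := fun i => |f i|) (fun _ _ => abs_nonneg _) (Finset.mem_univ i))
  refine ⟨max A (∑ i, |K i|), ∑ i, |C i|, le_max_left _ _,
    Finset.sum_nonneg fun _ _ => abs_nonneg _, fun i => ?_⟩
  exact hQ i _ _ _ _ ((hs K i).trans (le_max_right _ _)) (hs C i) (hKC i)

theorem HessControl.exists_ge {n : ℕ} {N : Fin n} {α : ℝ} {i j k : Fin n}
    (h : HessControl N α i j k) (K₀ A : ℝ) {δ : ℝ} (hδ : 0 < δ) :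
    ∃ K C, A ≤ K ∧ 0 ≤ C ∧ HessBound N α δ K₀ i j k K C := by
  obtain ⟨K, C, h1, h2, h3⟩ := exists_forall_of_mono (ι := Unit)
    (Q := fun _ => HessBound N α δ K₀ i j k) (fun _ _ _ _ _ h1 h2 h => h.mono h1 h2)
    (fun _ => h K₀ δ hδ) A
  exact ⟨K, C, h1, h2, h3 ()⟩

theorem HessControl.symm {n : ℕ} {N : Fin n} {α : ℝ} {i j k : Fin n}
    (h : HessControl N α i j k) : HessControl N α j i k := by
  intro K₀ δ hδ
  obtain ⟨K, C, hKC⟩ := h K₀ δ hδ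
  refine ⟨K, C, fun u p P x S F G hx hxK hd σ h0 h1 => ?_⟩
  rw [hd.sec.symm j i _ hx, hd.sec.symm j i _ (add_smul_coordVec_mem hx h0 k)]
  exact hKC u p P x S F G hx hxK hd σ h0 h1

theorem hessControl_tangential {n : ℕ} {N : Fin n} {α : ℝ} (hα₁ : 0 < α) (hα₂ : α < 1)
    {i j k : Fin n} (hi : i ≠ N) (hj : j ≠ N) (hk : k ≠ N) : HessControl N α i j k := by
  intro K₀ δ hδ
  obtain ⟨K, C, -, -, h⟩ := exists_hess_control_tangential N hα₁ hα₂ hδ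
  exact ⟨K, C, fun u p P x S F G hx _ hd => h u p P x S F G hx hd i j k (Or.inl ⟨hi, hj, hk⟩)⟩

theorem hessControl_normal_normal {n : ℕ} {N : Fin n} {α : ℝ} (hα : 0 < α) {k : Fin n}
    (h : ∀ l, l ≠ N → HessControl N α l l k) : HessControl N α N N k := by
  intro K₀ δ hδ
  have hn : (0 : ℝ) < n := by exact_mod_cast Fin.pos N
  obtain ⟨K, C, hK, hC, hKC⟩ := exists_forall_of_mono
    (Q := fun (l : Fin n) K C => l ≠ N → HessBound N α (δ / n) K₀ l l k K C)
    (fun _ _ _ _ _ h1 h2 h h' => (h h').mono h1 h2) (fun l => by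
      by_cases hl : l = N
      · exact ⟨0, 0, fun h' => absurd hl h'⟩
      · obtain ⟨K, C, hKC⟩ := h l hl K₀ (δ / n) (by positivity)
        exact ⟨K, C, fun _ => hKC⟩) 1
  refine ⟨K, 1 + n * C, fun u p P x S F G hx hxK hd σ h0 h1 => ?_⟩
  obtain ⟨hS, hF, hG⟩ := hd.nonneg
  have hsplit : ∀ y, P N N y = ∑ l, P l l y - ∑ l ∈ Finset.univ.erase N, P l l y := fun y => by
    rw [← Finset.add_sum_erase _ _ (Finset.mem_univ N)]; ring
  have hdist := dist_add_smul_coordVec_self x h0 k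
  have hlap : |∑ l, P l l (x + σ • coordVec k) - ∑ l, P l l x| ≤ F := by
    refine (hd.lap _ (add_smul_coordVec_mem hx h0 k) x hx (by linarith) (by simp; linarith)).trans ?_
    rw [hdist]
    exact mul_le_of_le_one_right hF (Real.rpow_le_one h0 h1 hα.le)
  have hrest : |∑ l ∈ Finset.univ.erase N, P l l (x + σ • coordVec k)
      - ∑ l ∈ Finset.univ.erase N, P l l x| ≤ n * (δ / n * S + C * (F + G)) := by
    rw [← Finset.sum_sub_distrib]
    refine (Finset.abs_sum_le_sum_abs _ _).trans ?_
    refine (Finset.sum_le_card_nsmul _ _ (δ / n * S + C * (F + G)) fun l hl =>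
      hKC l (Finset.ne_of_mem_erase hl) u p P x S F G hx hxK hd σ h0 h1).trans ?_
    rw [nsmul_eq_mul]
    refine mul_le_mul_of_nonneg_right ?_ (by positivity)
    exact_mod_cast (Finset.card_le_univ _).trans (by simp)
  rw [hsplit, hsplit x]
  have e : n * (δ / n * S + C * (F + G)) = δ * S + n * C * (F + G) := by field_simp
  rw [e] at hrest
  have a1 := abs_le.1 hlap
  have a2 := abs_le.1 hrest
  exact abs_le.2 ⟨by linarith [a1.1, a2.2], by linarith [a1.2, a2.1]⟩

/-- A bound on mixed differences of `p a` controls increments of `P b a`. -/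
theorem HolderData.abs_sub_le_of_mixedDiff {n : ℕ} {N a b k : Fin n} {α : ℝ} (hα : 0 < α)
    {u : EuclideanSpace ℝ (Fin n) → ℝ}
    {p : Fin n → EuclideanSpace ℝ (Fin n) → ℝ} {P : Fin n → Fin n → EuclideanSpace ℝ (Fin n) → ℝ}
    {x : EuclideanSpace ℝ (Fin n)} {K S F G : ℝ} (h : HolderData N α u p P x K S F G)
    (hx : x ∈ upperHalf n N) (hK : 3 ≤ K) {σ ε B : ℝ} (hσ0 : 0 ≤ σ) (hσ1 : σ ≤ 1)
    (hε0 : 0 < ε) (hε1 : ε ≤ 1)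
    (hB : |mixedDiff (σ • coordVec k) (ε • coordVec b) (p a) x| ≤ B) :
    |P b a (x + σ • coordVec k) - P b a x| ≤ 2 * ε ^ α * S + B / ε := by
  obtain ⟨hS, hF, hG⟩ := h.nonneg
  obtain ⟨θ, h0, h1, h2⟩ := (h.sec.snd b a).exists_mixedDiff_eq (smul_coordVec_mem N k hσ0) hx
    hε0.le
  have hxσ := add_smul_coordVec_mem hx hσ0 k
  have hxθ := add_smul_coordVec_mem hx h0 b
  have hxσθ := add_smul_coordVec_mem hxσ h0 b
  have e : x + θ • coordVec b + σ • coordVec k = x + σ • coordVec k + θ • coordVec b := by abel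
  rw [e] at h2
  have d1 := dist_add_smul_coordVec_self x hσ0 k
  have d2 := dist_add_smul_coordVec_self x h0 b
  have d3 := dist_add_smul_coordVec_self (x + σ • coordVec k) h0 b
  have d4 := dist_triangle (x + σ • coordVec k + θ • coordVec b) (x + σ • coordVec k) x
  have c1 := h.hess b a _ hxσθ _ hxσ (by linarith) (by linarith)
  have c2 := h.hess b a _ hxθ _ hx (by linarith) (by simp; linarith)
  rw [d3] at c1
  rw [d2] at c2
  have hθ : S * θ ^ α ≤ S * ε ^ α := by gcongr
  rw [h2, abs_mul, abs_of_pos hε0, mul_comm, ← le_div_iff₀ hε0] at hB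
  have c1 := abs_le.1 c1
  have c2 := abs_le.1 c2
  have c3 := abs_le.1 hB
  exact abs_le.2 ⟨by linarith [c1.2, c2.1, c3.1], by linarith [c1.1, c2.2, c3.2]⟩

theorem exists_rpow_le' {α δ : ℝ} (hα : 0 < α) (hδ : 0 < δ) :
    ∃ ε : ℝ, 0 < ε ∧ ε ≤ 1 / 2 ∧ 2 * ε ^ α ≤ δ := by
  obtain ⟨ε, h0, h1, h2⟩ := exists_rpow_le hα hδ
  refine ⟨ε, h0, h1, le_trans ?_ h2⟩
  gcongr
  linarith

theorem HessControl.cross {n : ℕ} {N a b k : Fin n} {α : ℝ} (hα : 0 < α)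
    (h : HessControl N α k a b) : HessControl N α b a k := by
  intro K₀ δ hδ
  obtain ⟨ε, hε0, hε1, hε⟩ := exists_rpow_le' hα (half_pos hδ)
  obtain ⟨K, C, hK, hC, hKC⟩ := h.exists_ge (K₀ + 1) 2 (δ := ε * (δ / 2)) (by positivity)
  refine ⟨K + 1, C / ε, fun u p P x S F G hx hxK hd σ h0 h1 => ?_⟩
  obtain ⟨hS, hF, hG⟩ := hd.nonneg
  refine (hd.abs_sub_le_of_mixedDiff hα hx (by linarith) h0 h1 hε0 (by linarith)
    (B := ε * (δ / 2) * S + C * (F + G)) ?_).trans ?_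
  · rw [mixedDiff_comm]
    obtain ⟨θ, t0, t1, t2⟩ := (hd.sec.snd k a).exists_mixedDiff_eq
      (smul_coordVec_mem N b hε0.le) hx h0
    rw [t2, abs_mul, abs_of_nonneg h0]
    have hxθ := add_smul_coordVec_mem hx t0 k
    have d1 := dist_add_smul_coordVec_self x t0 k
    have hN : (x + θ • coordVec k) N ≤ K₀ + 1 := by
      rw [add_smul_coordVec_apply]; split_ifs <;> linarith
    exact (mul_le_of_le_one_left (abs_nonneg _) h1).trans (hKC u p P _ S F G hxθ hN
      (hd.recenter (by linarith)) ε hε0.le (by linarith))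
  · have : (ε * (δ / 2) * S + C * (F + G)) / ε = δ / 2 * S + C / ε * (F + G) := by field_simp
    rw [this]
    have := mul_le_mul_of_nonneg_right hε hS
    linarith

theorem hessControl_normal_tangential {n : ℕ} {N j k : Fin n} {α : ℝ} (hα : 0 < α)
    (hj : j ≠ N) (hk : k ≠ N) (h : HessControl N α N N j) : HessControl N α j N k := by
  intro K₀ δ hδ
  obtain ⟨ε, hε0, hε1, hε⟩ := exists_rpow_le' hα (half_pos hδ)
  set T := 2 * max K₀ 1 with hT
  have hT0 : 0 < T := by
    have := le_max_right K₀ 1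
    rw [hT]; linarith
  obtain ⟨K, C, hK, hC, hKC⟩ := h.exists_ge K₀ 2 (δ := ε / T * (δ / 2)) (by positivity)
  refine ⟨K + T + 1, 1 + T * C / ε, fun u p P x S F G hx hxK hd σ h0 h1 => ?_⟩
  obtain ⟨hS, hF, hG⟩ := hd.nonneg
  set B := ε / T * (δ / 2) * S + C * (F + G) with hB
  have hB0 : 0 ≤ B := by positivity
  refine (hd.abs_sub_le_of_mixedDiff hα hx (by linarith) h0 h1 hε0 (by linarith)
    (B := ε * G + T * B) ?_).trans ?_
  · have hxN : 0 ≤ x N := hx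
    have hxT : 2 * x N ≤ T := by rw [hT]; linarith [le_max_left K₀ 1]
    set x₀ := x + (-x N) • coordVec N with hx₀
    have hx₀N : x₀ N = 0 := by rw [hx₀, add_smul_coordVec_apply, if_pos rfl]; ring
    have hx₀H : x₀ ∈ upperHalf n N := hx₀N.ge
    have hxx : x = x₀ + x N • coordVec N := by rw [hx₀]; module
    have hdx : dist x₀ x = x N := by
      conv_lhs => rw [hxx]
      rw [dist_comm]
      exact dist_add_smul_coordVec_self x₀ hxN N
    have hσk := smul_coordVec_mem N k h0
    have hεj := smul_coordVec_mem N j hε0.le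
    obtain ⟨θ, t0, t1, t2⟩ := ((hd.sec.snd N N).mixedDiff hσk hεj).exists_sub_eq hx₀H hxN
    rw [← hxx] at t2
    have hbd : |mixedDiff (σ • coordVec k) (ε • coordVec j) (p N) x₀| ≤ ε * G := by
      obtain ⟨τ, s0, s1, s2⟩ := (hd.sec.snd j N).exists_mixedDiff_eq hσk hx₀H hε0.le
      rw [s2, abs_mul, abs_of_pos hε0]
      gcongr
      have hz : (x₀ + τ • coordVec j) N = 0 := by
        rw [add_smul_coordVec_apply, if_neg (Ne.symm hj), hx₀N, add_zero]
      have hz' : (x₀ + τ • coordVec j + σ • coordVec k) N = 0 := by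
        rw [add_smul_coordVec_apply, if_neg (Ne.symm hk), hz, add_zero]
      have d1 := dist_add_smul_coordVec_self x₀ s0 j
      have d2 := dist_add_smul_coordVec_self (x₀ + τ • coordVec j) h0 k
      have d3 := dist_triangle (x₀ + τ • coordVec j) x₀ x
      have d4 := dist_triangle (x₀ + τ • coordVec j + σ • coordVec k) (x₀ + τ • coordVec j) x
      have := hd.bdry j hj _ _ hz' hz (by linarith) (by linarith)
      rw [d2] at this
      exact this.trans (mul_le_of_le_one_right hG (Real.rpow_le_one h0 h1 hα.le))
    have hNN : |mixedDiff (σ • coordVec k) (ε • coordVec j) (P N N) (x₀ + θ • coordVec N)|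
        ≤ 2 * B := by
      set y := x₀ + θ • coordVec N with hy
      have hyH : y ∈ upperHalf n N := add_smul_coordVec_mem hx₀H t0 N
      have hyN : y N = θ := by rw [hy, add_smul_coordVec_apply, if_pos rfl, hx₀N, zero_add]
      have hyσ := add_smul_coordVec_mem hyH h0 k
      have d1 : dist y x₀ = θ := dist_add_smul_coordVec_self x₀ t0 N
      have d2 := dist_triangle y x₀ x
      have d3 := dist_add_smul_coordVec_self y h0 k
      have d4 := dist_triangle (y + σ • coordVec k) y x
      have b1 := hKC u p P y S F G hyH (by linarith) (hd.recenter (by linarith)) ε hε0.le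
        (by linarith)
      have b2 := hKC u p P (y + σ • coordVec k) S F G hyσ
        (by rw [add_smul_coordVec_apply, if_neg (Ne.symm hk)]; linarith)
        (hd.recenter (by linarith)) ε hε0.le (by linarith)
      rw [mixedDiff, ← add_assoc]
      have b1 := abs_le.1 b1
      have b2 := abs_le.1 b2
      exact abs_le.2 ⟨by linarith [b1.2, b2.1], by linarith [b1.1, b2.2]⟩
    rw [sub_eq_iff_eq_add] at t2
    rw [t2]
    refine (abs_add_le _ _).trans ?_
    rw [abs_mul, abs_of_nonneg hxN]
    have : x N * |mixedDiff (σ • coordVec k) (ε • coordVec j) (P N N) (x₀ + θ • coordVec N)|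
        ≤ x N * (2 * B) := by gcongr
    have : 2 * x N * B ≤ T * B := by gcongr
    linarith
  · have : (ε * G + T * B) / ε = G + δ / 2 * S + T * C / ε * (F + G) := by
      rw [hB]; field_simp; ring
    rw [this]
    have := mul_le_mul_of_nonneg_right hε hS
    linarith

theorem hessControl {n : ℕ} (N : Fin n) {α : ℝ} (hα₁ : 0 < α) (hα₂ : α < 1) (i j k : Fin n) :
    HessControl N α i j k := by
  have hNN : ∀ k, k ≠ N → HessControl N α N N k := fun k hk =>
    hessControl_normal_normal hα₁ fun l hl => hessControl_tangential hα₁ hα₂ hl hl hk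
  have hjN : ∀ j k, j ≠ N → k ≠ N → HessControl N α j N k := fun j k hj hk =>
    hessControl_normal_tangential hα₁ hj hk (hNN j hj)
  have hijN : ∀ i j, i ≠ N → j ≠ N → HessControl N α i j N := fun i j hi hj =>
    (hjN j i hj hi).symm.cross hα₁
  by_cases hk : k = N
  · subst hk
    by_cases hi : i = k <;> by_cases hj : j = k
    · subst hi hj
      exact hessControl_normal_normal hα₁ fun l hl => hijN l l hl hl
    · subst hi
      exact ((hNN j hj).cross hα₁).symm
    · subst hj
      exact (hNN i hi).cross hα₁
    · exact hijN i j hi hj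
  · by_cases hi : i = N <;> by_cases hj : j = N
    · subst hi hj
      exact hNN k hk
    · subst hi
      exact (hjN j k hj hk).symm
    · subst hj
      exact hjN i k hi hk
    · exact hessControl_tangential hα₁ hα₂ hi hj hk

theorem exists_hess_control_coord {n : ℕ} (N : Fin n) {α : ℝ} (hα₁ : 0 < α) (hα₂ : α < 1)
    {δ : ℝ} (hδ : 0 < δ) :
    ∃ K C : ℝ, 1 ≤ K ∧ 0 ≤ C ∧ ∀ u p P x S F G, x ∈ upperHalf n N →
      HolderData N α u p P x K S F G → ∀ i j k,
      ∀ σ : ℝ, 0 ≤ σ → σ ≤ 1 → |P i j (x + σ • coordVec k) - P i j x| ≤ δ * S + C * (F + G) := by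
  obtain ⟨K₀, C₀, hK₀, hC₀, h₀⟩ := exists_hess_control_tangential N hα₁ hα₂ hδ
  obtain ⟨K, C, hK, hC, hKC⟩ := exists_forall_of_mono
    (Q := fun (t : Fin n × Fin n × Fin n) => HessBound N α δ K₀ t.1 t.2.1 t.2.2)
    (fun _ _ _ _ _ h1 h2 h => h.mono h1 h2)
    (fun t => hessControl N hα₁ hα₂ t.1 t.2.1 t.2.2 K₀ δ hδ) K₀
  refine ⟨K, C₀ + C, by linarith, by linarith, fun u p P x S F G hx hd i j k σ h0 h1 => ?_⟩
  obtain ⟨hS, hF, hG⟩ := hd.nonneg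
  have e1 : 0 ≤ C₀ * (F + G) := by positivity
  have e2 : 0 ≤ C * (F + G) := by positivity
  rcases le_total (x N) K₀ with hxK | hxK
  · have := hKC (i, j, k) u p P x S F G hx hxK hd σ h0 h1
    linarith
  · have := h₀ u p P x S F G hx (hd.recenter (by simpa using hK)) i j k (Or.inr hxK) σ h0 h1
    linarith

/-- The point with the coordinates of `y` on `T` and those of `x` elsewhere. -/
def coordSplice {n : ℕ} (T : Finset (Fin n)) (y x : EuclideanSpace ℝ (Fin n)) :
    EuclideanSpace ℝ (Fin n) := WithLp.toLp 2 (T.piecewise y x)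

theorem coordSplice_apply {n : ℕ} (T : Finset (Fin n)) (y x : EuclideanSpace ℝ (Fin n))
    (i : Fin n) : coordSplice T y x i = if i ∈ T then y i else x i := rfl

theorem coordSplice_mem {n : ℕ} {N : Fin n} (T : Finset (Fin n)) {y x : EuclideanSpace ℝ (Fin n)}
    (hy : y ∈ upperHalf n N) (hx : x ∈ upperHalf n N) : coordSplice T y x ∈ upperHalf n N := by
  change 0 ≤ coordSplice T y x N
  rw [coordSplice_apply]
  split_ifs
  exacts [hy, hx]

theorem dist_coordSplice_le {n : ℕ} (T : Finset (Fin n)) (y x : EuclideanSpace ℝ (Fin n)) :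
    dist (coordSplice T y x) x ≤ dist y x := by
  refine le_of_sq_le_sq ?_ dist_nonneg
  rw [EuclideanSpace.dist_sq_eq_sum, EuclideanSpace.dist_sq_eq_sum]
  refine Finset.sum_le_sum fun i _ => ?_
  rw [coordSplice_apply]
  split_ifs
  · rfl
  · simpa using sq_nonneg (y i - x i)

theorem coordSplice_insert {n : ℕ} {T : Finset (Fin n)} {k : Fin n} (hk : k ∉ T)
    (y x : EuclideanSpace ℝ (Fin n)) :
    coordSplice (insert k T) y x = coordSplice T y x + (y k - x k) • coordVec k := by
  ext i
  rw [add_smul_coordVec_apply, coordSplice_apply, coordSplice_apply]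
  by_cases hi : i = k
  · subst hi; simp [hk]
  · simp [hi]

/-- Up to a small multiple of its Hölder constant, the Hessian is controlled at unit scale by the
Laplacian and the Neumann datum. -/
theorem exists_hess_control_unit {n : ℕ} (N : Fin n) {α : ℝ} (hα₁ : 0 < α) (hα₂ : α < 1)
    {δ : ℝ} (hδ : 0 < δ) :
    ∃ K C : ℝ, 1 ≤ K ∧ 0 ≤ C ∧ ∀ u p P x S F G, x ∈ upperHalf n N →
      HolderData N α u p P x K S F G → ∀ i j, ∀ y ∈ upperHalf n N, dist y x ≤ 1 →
      |P i j y - P i j x| ≤ δ * S + C * (F + G) := by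
  have hn : (0 : ℝ) < n := by exact_mod_cast Fin.pos N
  obtain ⟨K, C, hK, hC, h⟩ := exists_hess_control_coord N hα₁ hα₂ (δ := δ / n) (by positivity)
  refine ⟨K + 1, n * C, by linarith, by positivity, fun u p P x S F G hx hd i j y hy hyx => ?_⟩
  have key : ∀ T : Finset (Fin n), |P i j (coordSplice T y x) - P i j x|
      ≤ T.card * (δ / n * S + C * (F + G)) := by
    intro T
    induction T using Finset.induction_on with
    | empty => simp [coordSplice]
    | insert k T hk ih =>
      have hT := coordSplice_mem T hy hx
      have hT' := coordSplice_mem (insert k T) hy hx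
      have dT := (dist_coordSplice_le T y x).trans hyx
      have dT' := (dist_coordSplice_le (insert k T) y x).trans hyx
      have hins := coordSplice_insert hk y x
      have hyk := abs_le.1 ((abs_sub_apply_le_dist y x k).trans hyx)
      have step : |P i j (coordSplice (insert k T) y x) - P i j (coordSplice T y x)|
          ≤ δ / n * S + C * (F + G) := by
        rcases le_total (x k) (y k) with hle | hle
        · rw [hins]
          exact h u p P _ S F G hT (hd.recenter (by linarith)) i j k _ (by linarith)
            (by linarith)
        · have e : coordSplice T y x = coordSplice (insert k T) y x + (x k - y k) • coordVec k := by
            rw [hins]; module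
          rw [abs_sub_comm, e]
          exact h u p P _ S F G hT' (hd.recenter (by linarith)) i j k _ (by linarith)
            (by linarith)
      rw [Finset.card_insert_of_notMem hk]
      push_cast
      have := abs_sub_le (P i j (coordSplice (insert k T) y x)) (P i j (coordSplice T y x))
        (P i j x)
      linarith
  have h1 := key Finset.univ
  have e : coordSplice Finset.univ y x = y := by ext i; simp [coordSplice_apply]
  rw [e, Finset.card_univ, Fintype.card_fin] at h1
  refine h1.trans (le_of_eq ?_)
  field_simp

/-- Scale-invariant form of the control of the Hessian. -/
theorem exists_hess_control {n : ℕ} (N : Fin n) {α : ℝ} (hα₁ : 0 < α) (hα₂ : α < 1)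
    {δ : ℝ} (hδ : 0 < δ) :
    ∃ K C : ℝ, 1 ≤ K ∧ 0 ≤ C ∧ ∀ u p P x S F G, x ∈ upperHalf n N → ∀ s : ℝ, 0 < s →
      HolderData N α u p P x (K * s) S F G → ∀ i j, ∀ y ∈ upperHalf n N, dist y x ≤ s →
      |P i j y - P i j x| ≤ (δ * S + C * (F + G)) * s ^ α := by
  obtain ⟨K, C, hK, hC, h⟩ := exists_hess_control_unit N hα₁ hα₂ hδ
  refine ⟨K, C, hK, hC, fun u p P x S F G hx s hs hd i j y hy hyx => ?_⟩
  obtain ⟨hS, hF, hG⟩ := hd.nonneg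
  have hmem : ∀ (c : ℝ) (y : EuclideanSpace ℝ (Fin n)), 0 ≤ c → y ∈ upperHalf n N →
      c • y ∈ upperHalf n N := by
    intro c y hc hy
    have hy' : 0 ≤ y N := hy
    change 0 ≤ (c • y) N
    simp only [PiLp.smul_apply, smul_eq_mul]; positivity
  have hsinv : ∀ y : EuclideanSpace ℝ (Fin n), s • s⁻¹ • y = y := fun y =>
    smul_inv_smul₀ hs.ne' y
  have hdist : ∀ y z : EuclideanSpace ℝ (Fin n), dist (s • y) (s • z) = s * dist y z :=
    fun y z => by rw [dist_smul₀, Real.norm_of_nonneg hs.le]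
  have hball : ∀ y, dist y (s⁻¹ • x) ≤ K → dist (s • y) x ≤ K * s := fun y hy => by
    rw [← hsinv x, hdist, mul_comm K]
    gcongr
  have hpow : ∀ (A : ℝ) (y z : EuclideanSpace ℝ (Fin n)),
      s * (s * (A * dist (s • y) (s • z) ^ α)) = s * (s * s ^ α) * A * dist y z ^ α :=
    fun A y z => by rw [hdist, Real.mul_rpow hs.le dist_nonneg]; ring
  have hd' : HolderData N α (fun x => u (s • x)) (fun i x => s * p i (s • x))
      (fun i j x => s * (s * P i j (s • x))) (s⁻¹ • x) K (s * (s * s ^ α) * S)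
      (s * (s * s ^ α) * F) (s * (s * s ^ α) * G) := by
    refine ⟨hd.sec.dilate hs, fun i j y hy z hz h1 h2 => ?_, fun y hy z hz h1 h2 => ?_,
      fun j hj y z hy hz h1 h2 => ?_, by positivity, by positivity, by positivity⟩
    · rw [← mul_sub, ← mul_sub, abs_mul, abs_mul, abs_of_pos hs, ← hpow]
      gcongr
      exact hd.hess i j _ (hmem s y hs.le hy) _ (hmem s z hs.le hz) (hball y h1) (hball z h2)
    · rw [← Finset.mul_sum, ← Finset.mul_sum, ← Finset.mul_sum, ← Finset.mul_sum, ← mul_sub,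
        ← mul_sub, abs_mul, abs_mul, abs_of_pos hs, ← hpow]
      gcongr
      exact hd.lap _ (hmem s y hs.le hy) _ (hmem s z hs.le hz) (hball y h1) (hball z h2)
    · rw [← mul_sub, ← mul_sub, abs_mul, abs_mul, abs_of_pos hs, ← hpow]
      gcongr
      exact hd.bdry j hj _ _ (by simp [hy]) (by simp [hz]) (hball y h1) (hball z h2)
  have hyx' : dist (s⁻¹ • y) (s⁻¹ • x) ≤ 1 := by
    rw [dist_smul₀, Real.norm_of_nonneg (by positivity), inv_mul_le_iff₀ hs]
    linarith
  have key := h _ _ _ _ _ _ _ (hmem _ _ (by positivity) hx) hd' i j _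
    (hmem s⁻¹ y (by positivity) hy) hyx'
  simp only [hsinv] at key
  rw [← mul_sub, ← mul_sub, abs_mul, abs_mul, abs_of_pos hs, ← mul_assoc] at key
  have hss : 0 < s * s := by positivity
  refine le_of_mul_le_mul_left (key.trans (le_of_eq ?_)) hss
  ring

/-- A function with positive Laplacian in the half-space and positive normal derivative on the
boundary has no maximum. -/
theorem HasSecondPartials.not_isMaxOn {n : ℕ} {N : Fin n} {v : EuclideanSpace ℝ (Fin n) → ℝ}
    {p : Fin n → EuclideanSpace ℝ (Fin n) → ℝ} {P : Fin n → Fin n → EuclideanSpace ℝ (Fin n) → ℝ}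
    (h : HasSecondPartials N v p P) {z : EuclideanSpace ℝ (Fin n)} (hz : z ∈ upperHalf n N)
    (hL : 0 < ∑ i, P i i z) (hB : z N = 0 → 0 < p N z) : ¬ IsMaxOn v (upperHalf n N) z := by
  intro hmax
  have hzN' : 0 ≤ z N := hz
  rcases hzN'.eq_or_lt with hzN | hzN
  · have hset : {τ : ℝ | z + τ • coordVec N ∈ upperHalf n N} = Set.Ici 0 := by
      ext τ
      change 0 ≤ (z + τ • coordVec N) N ↔ 0 ≤ τ
      rw [add_smul_coordVec_apply, if_pos rfl, ← hzN, zero_add]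
    have d1 := h.fst N z hz
    rw [hset] at d1
    have hloc : IsLocalMaxOn (fun τ : ℝ => v (z + τ • coordVec N)) (Set.Ici 0) 0 := by
      filter_upwards [self_mem_nhdsWithin] with τ hτ
      simp only [zero_smul, add_zero]
      exact hmax (add_smul_coordVec_mem hz hτ N)
    have h1 := hloc.hasFDerivWithinAt_nonpos d1.hasFDerivWithinAt (y := 1)
      (mem_posTangentConeAt_of_segment_subset (by
        rw [segment_eq_Icc (by norm_num)]
        exact fun τ hτ => by simpa using hτ.1))
    have := hB hzN.symm
    simp at h1
    linarith
  · refine hL.not_ge (Finset.sum_nonpos fun i _ => ?_)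
    have e0 : z + (0 : ℝ) • coordVec i = z := by simp
    have c3 : Continuous fun τ : ℝ => (z + τ • coordVec i) N := by fun_prop
    have c4 : ∀ᶠ τ : ℝ in 𝓝 0, 0 < (z + τ • coordVec i) N :=
      (c3.tendsto 0).eventually_const_lt (u := 0) (by rw [e0]; exact hzN)
    have hd := nonpos_of_isLocalMax_of_hasDerivAt (φ := fun τ => v (z + τ • coordVec i))
      (φ' := fun τ => p i (z + τ • coordVec i)) (d := P i i (z + (0 : ℝ) • coordVec i))
      (c4.mono fun τ hτ => (h.fst i).hasDerivAt_line (Or.inr hτ))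
      ((h.snd i i).hasDerivAt_line (Or.inr c4.self_of_nhds)) (by
        filter_upwards [c4] with τ hτ
        simp only [e0]
        exact hmax hτ.le)
    rwa [e0] at hd

theorem HasSecondPartials.add {n : ℕ} {N : Fin n} {v w : EuclideanSpace ℝ (Fin n) → ℝ}
    {p q : Fin n → EuclideanSpace ℝ (Fin n) → ℝ} {P Q : Fin n → Fin n → EuclideanSpace ℝ (Fin n) → ℝ}
    (h : HasSecondPartials N v p P) (h' : HasSecondPartials N w q Q) :
    HasSecondPartials N (fun x => v x + w x) (fun i x => p i x + q i x)
      (fun i j x => P i j x + Q i j x) where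
  cont := h.cont.add h'.cont
  fst i := (h.fst i).add (h'.fst i)
  snd i j := (h.snd i j).add (h'.snd i j)
  symm i j x hx := by rw [h.symm i j x hx, h'.symm i j x hx]

theorem HasPartial.of_hasDerivAt {n : ℕ} {N i : Fin n} {f f' : EuclideanSpace ℝ (Fin n) → ℝ}
    (h : ∀ x, HasDerivAt (fun τ : ℝ => f (x + τ • coordVec i)) (f' x) 0) : HasPartial N i f f' :=
  fun x _ => (h x).hasDerivWithinAt

theorem hasDerivAt_apply_line {n : ℕ} (x : EuclideanSpace ℝ (Fin n)) (i j : Fin n) :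
    HasDerivAt (fun τ : ℝ => (x + τ • coordVec i) j) (if j = i then 1 else 0) 0 := by
  simp only [add_smul_coordVec_apply]
  split_ifs
  · exact (hasDerivAt_id 0).const_add _
  · exact (hasDerivAt_const 0 _).const_add _

theorem norm_sq_add_smul_coordVec {n : ℕ} (x : EuclideanSpace ℝ (Fin n)) (i : Fin n) (τ : ℝ) :
    ‖x + τ • coordVec i‖ ^ 2 = ‖x‖ ^ 2 + 2 * x i * τ + τ ^ 2 := by
  simpa using dist_sq_add_smul_coordVec x 0 τ i

theorem hasDerivAt_rpow_line {n : ℕ} (x : EuclideanSpace ℝ (Fin n)) (i : Fin n) (β : ℝ) :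
    HasDerivAt (fun τ : ℝ => (1 + ‖x + τ • coordVec i‖ ^ 2) ^ β)
      (2 * β * x i * (1 + ‖x‖ ^ 2) ^ (β - 1)) 0 := by
  have hq : HasDerivAt (fun τ : ℝ => 1 + ‖x + τ • coordVec i‖ ^ 2) (2 * x i) 0 := by
    simp only [norm_sq_add_smul_coordVec]
    have := (hasDerivAt_quadratic (‖x‖ ^ 2) (2 * x i) 1 0).const_add 1
    simpa using this
  have h1 := hq.rpow_const (p := β) (Or.inl (by positivity))
  convert h1 using 1
  simp only [zero_smul, add_zero]
  ring

/-- The barrier `A (1+|x|²)^{γ/2} - xₙ (1+|x|²)^{(γ-1)/2}`. -/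
def barrier {n : ℕ} (N : Fin n) (A b c : ℝ) (x : EuclideanSpace ℝ (Fin n)) : ℝ :=
  A * (1 + ‖x‖ ^ 2) ^ b - x N * (1 + ‖x‖ ^ 2) ^ c

/-- First partial derivatives of `barrier`. -/
def barrierD {n : ℕ} (N : Fin n) (A b c : ℝ) (j : Fin n) (x : EuclideanSpace ℝ (Fin n)) : ℝ :=
  A * (2 * b * x j * (1 + ‖x‖ ^ 2) ^ (b - 1))
    - ((if N = j then 1 else 0) * (1 + ‖x‖ ^ 2) ^ c
      + x N * (2 * c * x j * (1 + ‖x‖ ^ 2) ^ (c - 1)))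

/-- Second partial derivatives of `barrier`. -/
def barrierDD {n : ℕ} (N : Fin n) (A b c : ℝ) (i j : Fin n) (x : EuclideanSpace ℝ (Fin n)) : ℝ :=
  A * (2 * b * (if j = i then 1 else 0) * (1 + ‖x‖ ^ 2) ^ (b - 1)
      + 2 * b * x j * (2 * (b - 1) * x i * (1 + ‖x‖ ^ 2) ^ (b - 1 - 1)))
    - ((if N = j then 1 else 0) * (2 * c * x i * (1 + ‖x‖ ^ 2) ^ (c - 1))
      + ((if N = i then 1 else 0) * (2 * c * x j * (1 + ‖x‖ ^ 2) ^ (c - 1))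
        + x N * (2 * c * (if j = i then 1 else 0) * (1 + ‖x‖ ^ 2) ^ (c - 1)
          + 2 * c * x j * (2 * (c - 1) * x i * (1 + ‖x‖ ^ 2) ^ (c - 1 - 1)))))

theorem hasSecondPartials_barrier {n : ℕ} (N : Fin n) (A b c : ℝ) :
    HasSecondPartials N (barrier N A b c) (barrierD N A b c) (barrierDD N A b c) where
  cont := by
    have : ∀ β : ℝ, Continuous fun x : EuclideanSpace ℝ (Fin n) => (1 + ‖x‖ ^ 2) ^ β := fun β =>
      Continuous.rpow_const (by fun_prop) (fun x => Or.inl (by positivity))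
    exact ((continuous_const.mul (this b)).sub
      ((show Continuous fun x : EuclideanSpace ℝ (Fin n) => x N by fun_prop).mul
        (this c))).continuousOn
  fst j := HasPartial.of_hasDerivAt fun x => by
    have := ((hasDerivAt_rpow_line x j b).const_mul A).fun_sub
      ((hasDerivAt_apply_line x j N).fun_mul (hasDerivAt_rpow_line x j c))
    simpa [barrier, barrierD] using this
  snd i j := HasPartial.of_hasDerivAt fun x => by
    have := ((((hasDerivAt_apply_line x i j).const_mul (2 * b)).fun_mul
        (hasDerivAt_rpow_line x i (b - 1))).const_mul A).fun_sub
      (((hasDerivAt_rpow_line x i c).const_mul (if N = j then 1 else 0)).fun_add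
        ((hasDerivAt_apply_line x i N).fun_mul
          (((hasDerivAt_apply_line x i j).const_mul (2 * c)).fun_mul
            (hasDerivAt_rpow_line x i (c - 1)))))
    simp only [zero_smul, add_zero] at this
    exact this
  symm i j x _ := by
    simp only [barrierDD, eq_comm (a := j) (b := i)]
    ring

theorem sum_barrierDD {n : ℕ} (N : Fin n) (A b c : ℝ) (x : EuclideanSpace ℝ (Fin n)) :
    ∑ i, barrierDD N A b c i i x
      = A * (2 * b * n * (1 + ‖x‖ ^ 2) ^ (b - 1)
          + 4 * b * (b - 1) * ‖x‖ ^ 2 * (1 + ‖x‖ ^ 2) ^ (b - 1 - 1))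
        - x N * (2 * c * (n + 2) * (1 + ‖x‖ ^ 2) ^ (c - 1)
          + 4 * c * (c - 1) * ‖x‖ ^ 2 * (1 + ‖x‖ ^ 2) ^ (c - 1 - 1)) := by
  have hsq : ‖x‖ ^ 2 = ∑ i, x i ^ 2 := by
    have := EuclideanSpace.dist_sq_eq_sum x 0
    simpa using this
  have e : ∀ i, barrierDD N A b c i i x
      = (A * (2 * b * (1 + ‖x‖ ^ 2) ^ (b - 1)) - x N * (2 * c * (1 + ‖x‖ ^ 2) ^ (c - 1)))
        + x i ^ 2 * (A * (4 * b * (b - 1) * (1 + ‖x‖ ^ 2) ^ (b - 1 - 1))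
          - x N * (4 * c * (c - 1) * (1 + ‖x‖ ^ 2) ^ (c - 1 - 1)))
        - (if N = i then x i else 0) * (4 * c * (1 + ‖x‖ ^ 2) ^ (c - 1)) := fun i => by
    simp only [barrierDD, if_true]
    split_ifs <;> ring
  simp only [e]
  rw [Finset.sum_sub_distrib, Finset.sum_add_distrib, ← Finset.sum_mul, ← Finset.sum_mul, ← hsq,
    Finset.sum_ite_eq]
  simp only [Finset.sum_const, Finset.card_univ, Fintype.card_fin, Finset.mem_univ, if_true,
    nsmul_eq_mul]
  ring

theorem sum_barrierDD_le {n : ℕ} (N : Fin n) {γ A : ℝ} (hγ₁ : 2 - (n : ℝ) < γ) (hγ₂ : γ < 0)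
    (hA : (1 - γ) * (n + 2) + 1 ≤ A * (-γ * (n + γ - 2))) {x : EuclideanSpace ℝ (Fin n)}
    (hx : x ∈ upperHalf n N) :
    ∑ i, barrierDD N A (γ / 2) ((γ - 1) / 2) i i x ≤ -(1 + ‖x‖ ^ 2) ^ (γ / 2 - 1) := by
  rw [sum_barrierDD]
  set q := 1 + ‖x‖ ^ 2 with hq
  have hq1 : 1 ≤ q := by rw [hq]; nlinarith [sq_nonneg ‖x‖]
  have hq0 : 0 < q := by linarith
  have hxN : 0 ≤ x N := hx
  have hxq : x N ≤ q ^ (1 / 2 : ℝ) := by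
    rw [← Real.sqrt_eq_rpow]
    refine Real.le_sqrt_of_sq_le ?_
    have h1 := abs_sub_apply_le_dist x 0 N
    have h2 : |x N| ≤ ‖x‖ := by simpa using h1
    rw [abs_of_nonneg hxN] at h2
    nlinarith
  have hn2 : ‖x‖ ^ 2 = q - 1 := by rw [hq]; ring
  rw [hn2]
  set a := q ^ (γ / 2 - 1 - 1) with ha
  set d := q ^ ((γ - 1) / 2 - 1 - 1) with hd
  have ha0 : 0 < a := Real.rpow_pos_of_pos hq0 _
  have hd0 : 0 < d := Real.rpow_pos_of_pos hq0 _
  have e1 : q ^ (γ / 2 - 1) = a * q := by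
    rw [ha, ← Real.rpow_add_one hq0.ne']; ring_nf
  have e2 : q ^ ((γ - 1) / 2 - 1) = d * q := by
    rw [hd, ← Real.rpow_add_one hq0.ne']; ring_nf
  have e3 : q ^ (1 / 2 : ℝ) * d = a := by
    rw [hd, ha, ← Real.rpow_add hq0]; ring_nf
  rw [e1, e2]
  have hxd : x N * d ≤ a := by rw [← e3]; gcongr
  have hn3 : 0 < (n : ℝ) + γ - 2 := by linarith
  have hκ : 0 < -γ * (n + γ - 2) := by nlinarith
  have hA0 : 0 < A := by
    by_contra! hA0
    nlinarith [mul_nonneg (neg_nonneg.2 hA0) hκ.le]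
  have t1 : A * (2 * (γ / 2) * n * (a * q) + 4 * (γ / 2) * (γ / 2 - 1) * (q - 1) * a)
      ≤ -(A * (-γ * (n + γ - 2))) * (a * q) := by
    have : A * (2 * (γ / 2) * n * (a * q) + 4 * (γ / 2) * (γ / 2 - 1) * (q - 1) * a)
      = -(A * (-γ * (n + γ - 2))) * (a * q) - A * a * (γ * (γ - 2)) := by ring
    rw [this]
    have : 0 ≤ A * a * (γ * (γ - 2)) := by
      have : 0 ≤ γ * (γ - 2) := by nlinarith
      positivity
    linarith
  have t2 : -(x N * (2 * ((γ - 1) / 2) * (n + 2) * (d * q)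
      + 4 * ((γ - 1) / 2) * ((γ - 1) / 2 - 1) * (q - 1) * d)) ≤ (1 - γ) * (n + 2) * (a * q) := by
    have : -(x N * (2 * ((γ - 1) / 2) * (n + 2) * (d * q)
      + 4 * ((γ - 1) / 2) * ((γ - 1) / 2 - 1) * (q - 1) * d))
      = (1 - γ) * (n + 2) * (x N * d * q) - x N * d * ((1 - γ) * (3 - γ)) * (q - 1) := by ring
    rw [this]
    have h1 : 0 ≤ x N * d * ((1 - γ) * (3 - γ)) * (q - 1) := by
      have : 0 ≤ (1 - γ) * (3 - γ) := by nlinarith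
      have : 0 ≤ q - 1 := by linarith
      positivity
    have h2 : (1 - γ) * (n + 2) * (x N * d * q) ≤ (1 - γ) * (n + 2) * (a * q) := by
      have : 0 ≤ 1 - γ := by linarith
      gcongr
    linarith
  have t3 : ((1 - γ) * (n + 2) + 1) * (a * q) ≤ A * (-γ * (n + γ - 2)) * (a * q) := by gcongr
  linarith

theorem one_add_norm_rpow_le {E : Type*} [NormedAddCommGroup E] (x : E) {γ : ℝ} (hγ : γ ≤ 0) :
    (1 + ‖x‖) ^ γ ≤ (1 + ‖x‖ ^ 2) ^ (γ / 2) := by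
  have : (1 + ‖x‖) ^ γ = ((1 + ‖x‖) ^ 2) ^ (γ / 2) := by
    rw [← Real.rpow_natCast, ← Real.rpow_mul (by positivity)]; congr 1; push_cast; ring
  rw [this]
  exact Real.rpow_le_rpow_of_nonpos (by positivity) (by nlinarith [norm_nonneg x]) (by linarith)

theorem one_add_norm_sq_rpow_le {E : Type*} [NormedAddCommGroup E] (x : E) {γ : ℝ} (hγ : γ ≤ 0) :
    (1 + ‖x‖ ^ 2) ^ (γ / 2) ≤ 2 ^ (-γ / 2) * (1 + ‖x‖) ^ γ := by
  have : 2 ^ (-γ / 2) * (1 + ‖x‖) ^ γ = ((1 + ‖x‖) ^ 2 / 2) ^ (γ / 2) := by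
    rw [Real.div_rpow (by positivity) (by norm_num), ← Real.rpow_natCast (1 + ‖x‖),
      ← Real.rpow_mul (by positivity), neg_div, Real.rpow_neg (by norm_num)]
    rw [inv_mul_eq_div]; congr 2; push_cast; ring
  rw [this]
  exact Real.rpow_le_rpow_of_nonpos (by positivity) (by nlinarith [sq_nonneg (1 - ‖x‖)])
    (by linarith)

/-- The weighted sup bound for the Neumann problem, one-sided version. -/
theorem exists_le_of_weighted_bounds {n : ℕ} (N : Fin n) {γ : ℝ} (hγ₁ : 2 - (n : ℝ) < γ)
    (hγ₂ : γ < 0) :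
    ∃ C, 0 ≤ C ∧ ∀ u p P F G M, HasSecondPartials N u p P → 0 ≤ F → 0 ≤ G →
      (∀ x ∈ upperHalf n N, |u x| ≤ M * (1 + ‖x‖) ^ γ) →
      (∀ x ∈ upperHalf n N, |∑ i, P i i x| ≤ F * (1 + ‖x‖) ^ (γ - 2)) →
      (∀ x, x N = 0 → |p N x| ≤ G * (1 + ‖x‖) ^ (γ - 1)) →
      ∀ x ∈ upperHalf n N, u x ≤ C * (F + G) * (1 + ‖x‖) ^ γ := by
  have hn3 : 0 < (n : ℝ) + γ - 2 := by linarith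
  have hκ : 0 < -γ * (n + γ - 2) := by nlinarith
  set A := ((1 - γ) * (n + 2) + 1) / (-γ * (n + γ - 2)) + 1 with hAdef
  have hA1 : 1 ≤ A := by
    have : 0 ≤ 1 - γ := by linarith
    have : 0 ≤ ((1 - γ) * (n + 2) + 1) / (-γ * (n + γ - 2)) := by positivity
    linarith
  have hA : (1 - γ) * (n + 2) + 1 ≤ A * (-γ * (n + γ - 2)) := by
    rw [hAdef, add_mul, div_mul_cancel₀ _ hκ.ne']; linarith
  refine ⟨A * 2 ^ (-γ / 2), by positivity, ?_⟩
  intro u p P F G M h hF hG hu hL hB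
  have hW0 : ∀ x ∈ upperHalf n N, 0 ≤ barrier N A (γ / 2) ((γ - 1) / 2) x ∧
      barrier N A (γ / 2) ((γ - 1) / 2) x ≤ A * (1 + ‖x‖ ^ 2) ^ (γ / 2) := by
    intro x hx
    have hxN : 0 ≤ x N := hx
    have hxq : x N ≤ (1 + ‖x‖ ^ 2) ^ (1 / 2 : ℝ) := by
      rw [← Real.sqrt_eq_rpow]
      refine Real.le_sqrt_of_sq_le ?_
      have h2 : |x N| ≤ ‖x‖ := by simpa using abs_sub_apply_le_dist x 0 N
      rw [abs_of_nonneg hxN] at h2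
      nlinarith
    have e : (1 + ‖x‖ ^ 2) ^ (γ / 2)
        = (1 + ‖x‖ ^ 2) ^ (1 / 2 : ℝ) * (1 + ‖x‖ ^ 2) ^ ((γ - 1) / 2) := by
      rw [← Real.rpow_add (by positivity)]; congr 1; ring
    have h1 : x N * (1 + ‖x‖ ^ 2) ^ ((γ - 1) / 2) ≤ (1 + ‖x‖ ^ 2) ^ (γ / 2) := by
      rw [e]; gcongr
    have h2 : 0 ≤ x N * (1 + ‖x‖ ^ 2) ^ ((γ - 1) / 2) := by positivity
    have h3 : (1 + ‖x‖ ^ 2) ^ (γ / 2) ≤ A * (1 + ‖x‖ ^ 2) ^ (γ / 2) :=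
      le_mul_of_one_le_left (by positivity) hA1
    rw [barrier]
    exact ⟨by linarith, by linarith⟩
  have key : ∀ η : ℝ, 0 < η → ∀ x ∈ upperHalf n N,
      u x ≤ (F + G + η) * barrier N A (γ / 2) ((γ - 1) / 2) x := by
    intro η hη
    by_contra! hcon
    obtain ⟨x₁, hx₁, hlt⟩ := hcon
    have hv := h.add ((hasSecondPartials_barrier N A (γ / 2) ((γ - 1) / 2)).const_mul
      (-(F + G + η)))
    set v := fun x => u x + -(F + G + η) * barrier N A (γ / 2) ((γ - 1) / 2) x with hvdef
    have hv1 : 0 < v x₁ := by rw [hvdef]; simp only; linarith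
    have hlim : Tendsto (fun x : EuclideanSpace ℝ (Fin n) => M * (1 + ‖x‖) ^ γ)
        (cocompact _) (𝓝 (M * 0)) := by
      refine Tendsto.const_mul _ ?_
      have := (tendsto_rpow_neg_atTop (y := -γ) (by linarith)).comp
        (tendsto_atTop_add_const_left _ 1 (tendsto_norm_cocompact_atTop
          (E := EuclideanSpace ℝ (Fin n))))
      simpa [Function.comp_def] using this
    rw [mul_zero] at hlim
    have hfar : ∀ᶠ x in cocompact _ ⊓ 𝓟 (upperHalf n N), v x ≤ v x₁ := by
      rw [eventually_inf_principal]
      filter_upwards [hlim.eventually_lt_const hv1] with x hx hxH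
      have h1 := (abs_le.1 (hu x hxH)).2
      have h2 : 0 ≤ (F + G + η) * barrier N A (γ / 2) ((γ - 1) / 2) x :=
        mul_nonneg (by positivity) (hW0 x hxH).1
      rw [hvdef]
      simp only
      rw [hvdef] at hx
      simp only at hx
      linarith
    obtain ⟨z, hz, hmax⟩ := hv.cont.exists_isMaxOn' (isClosed_upperHalf n N) hx₁ hfar
    refine hv.not_isMaxOn hz ?_ ?_ hmax
    · rw [Finset.sum_add_distrib, ← Finset.mul_sum]
      have h1 := (abs_le.1 (hL z hz)).1
      have h2 := sum_barrierDD_le N hγ₁ hγ₂ hA hz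
      have h3 := one_add_norm_rpow_le z (γ := γ - 2) (by linarith)
      rw [show (γ - 2) / 2 = γ / 2 - 1 by ring] at h3
      have h4 : 0 < (1 + ‖z‖ ^ 2) ^ (γ / 2 - 1) := by positivity
      have h5 := mul_le_mul_of_nonneg_left h3 hF
      have h6 := mul_le_mul_of_nonneg_left h2 (show 0 ≤ F + G + η by positivity)
      have h7 : 0 ≤ G * (1 + ‖z‖ ^ 2) ^ (γ / 2 - 1) := by positivity
      have h8 : 0 < η * (1 + ‖z‖ ^ 2) ^ (γ / 2 - 1) := by positivity
      linarith
    · intro hzN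
      have h1 := (abs_le.1 (hB z hzN)).1
      have h3 := one_add_norm_rpow_le z (γ := γ - 1) (by linarith)
      have h2 : barrierD N A (γ / 2) ((γ - 1) / 2) N z = -(1 + ‖z‖ ^ 2) ^ ((γ - 1) / 2) := by
        simp [barrierD, hzN]
      have h4 : 0 < (1 + ‖z‖ ^ 2) ^ ((γ - 1) / 2) := by positivity
      have h5 := mul_le_mul_of_nonneg_left h3 hG
      have h7 : 0 ≤ F * (1 + ‖z‖ ^ 2) ^ ((γ - 1) / 2) := by positivity
      have h8 : 0 < η * (1 + ‖z‖ ^ 2) ^ ((γ - 1) / 2) := by positivity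
      rw [h2]
      linarith
  intro x hx
  have hW := hW0 x hx
  have h1 : u x ≤ (F + G) * barrier N A (γ / 2) ((γ - 1) / 2) x := by
    refine le_of_forall_pos_le_add fun η hη => ?_
    have hpos : 0 < barrier N A (γ / 2) ((γ - 1) / 2) x + 1 := by linarith
    have h2 := key (η / (barrier N A (γ / 2) ((γ - 1) / 2) x + 1)) (by positivity) x hx
    have h3 : η / (barrier N A (γ / 2) ((γ - 1) / 2) x + 1)
        * barrier N A (γ / 2) ((γ - 1) / 2) x ≤ η := by
      rw [div_mul_eq_mul_div, div_le_iff₀ hpos]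
      nlinarith
    linarith
  refine h1.trans ?_
  have h2 := one_add_norm_sq_rpow_le x hγ₂.le
  calc (F + G) * barrier N A (γ / 2) ((γ - 1) / 2) x
      ≤ (F + G) * (A * (2 ^ (-γ / 2) * (1 + ‖x‖) ^ γ)) := by
        refine mul_le_mul_of_nonneg_left (hW.2.trans ?_) (by positivity)
        gcongr
    _ = _ := by ring

/-- The weighted sup bound for the Neumann problem. -/
theorem exists_abs_le_of_weighted_bounds {n : ℕ} (N : Fin n) {γ : ℝ} (hγ₁ : 2 - (n : ℝ) < γ)
    (hγ₂ : γ < 0) :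
    ∃ C, 0 ≤ C ∧ ∀ u p P F G M, HasSecondPartials N u p P → 0 ≤ F → 0 ≤ G →
      (∀ x ∈ upperHalf n N, |u x| ≤ M * (1 + ‖x‖) ^ γ) →
      (∀ x ∈ upperHalf n N, |∑ i, P i i x| ≤ F * (1 + ‖x‖) ^ (γ - 2)) →
      (∀ x, x N = 0 → |p N x| ≤ G * (1 + ‖x‖) ^ (γ - 1)) →
      ∀ x ∈ upperHalf n N, |u x| ≤ C * (F + G) * (1 + ‖x‖) ^ γ := by
  obtain ⟨C, hC, h⟩ := exists_le_of_weighted_bounds N hγ₁ hγ₂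
  refine ⟨C, hC, fun u p P F G M hu hF hG h0 h1 h2 x hx => ?_⟩
  have a1 := h u p P F G M hu hF hG h0 h1 h2 x hx
  have a2 := h _ _ _ F G M (hu.const_mul (-1)) hF hG
    (fun x hx => by rw [neg_one_mul, abs_neg]; exact h0 x hx)
    (fun x hx => by rw [← Finset.mul_sum, neg_one_mul, abs_neg]; exact h1 x hx)
    (fun x hx => by rw [neg_one_mul, abs_neg]; exact h2 x hx) x hx
  exact abs_le.2 ⟨by linarith, a1⟩

theorem one_add_norm_ge_half {E : Type*} [SeminormedAddCommGroup E] {x y : E}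
    (h : dist y x ≤ (1 + ‖x‖) / 2) : (1 + ‖x‖) / 2 ≤ 1 + ‖y‖ := by
  have := norm_sub_norm_le x y
  rw [← dist_eq_norm, dist_comm] at this
  linarith

theorem rpow_le_of_half_le {a b e : ℝ} (ha : 0 < a) (h : a / 2 ≤ b) (he : e ≤ 0) :
    b ^ e ≤ 2 ^ (-e) * a ^ e := by
  have : (2 : ℝ) ^ (-e) * a ^ e = (a / 2) ^ e := by
    rw [Real.div_rpow ha.le (by norm_num), Real.rpow_neg (by norm_num), inv_mul_eq_div]
  rw [this]
  exact Real.rpow_le_rpow_of_nonpos (by positivity) h he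

/-- `f` is Hölder on `A`, with constant `S` relative to the weight
`min (1 + ‖y‖) (1 + ‖z‖) ^ (γ - 2 - α)`, at points that are close relative to their norms. -/
def WHolderOn {n : ℕ} (A : Set (EuclideanSpace ℝ (Fin n))) (α γ S : ℝ)
    (f : EuclideanSpace ℝ (Fin n) → ℝ) : Prop :=
  ∀ y ∈ A, ∀ z ∈ A, dist y z ≤ min (1 + ‖y‖) (1 + ‖z‖) / 2 →
    |f y - f z| ≤ S * min (1 + ‖y‖) (1 + ‖z‖) ^ (γ - 2 - α) * dist y z ^ α

/-- A Hölder function with respect to the weights is Hölder on balls of small radius. -/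
theorem WHolderOn.abs_sub_le {n : ℕ} {A : Set (EuclideanSpace ℝ (Fin n))} {α γ S : ℝ}
    {f : EuclideanSpace ℝ (Fin n) → ℝ} (h : WHolderOn A α γ S f) (hS : 0 ≤ S) (hE : γ - 2 - α ≤ 0)
    {x y z : EuclideanSpace ℝ (Fin n)} (hy : y ∈ A) (hz : z ∈ A) (hyx : dist y x ≤ (1 + ‖x‖) / 8)
    (hzx : dist z x ≤ (1 + ‖x‖) / 8) :
    |f y - f z| ≤ S * (2 ^ (-(γ - 2 - α)) * (1 + ‖x‖) ^ (γ - 2 - α)) * dist y z ^ α := by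
  have hx0 : 0 < 1 + ‖x‖ := by positivity
  have h1 := one_add_norm_ge_half (hyx.trans (by linarith))
  have h2 := one_add_norm_ge_half (hzx.trans (by linarith))
  have hmin : (1 + ‖x‖) / 2 ≤ min (1 + ‖y‖) (1 + ‖z‖) := le_min h1 h2
  have hd : dist y z ≤ (1 + ‖x‖) / 4 := by
    linarith [dist_triangle_right y z x]
  refine (h y hy z hz (by linarith)).trans ?_
  gcongr
  exact rpow_le_of_half_le hx0 hmin hE

/-- Weighted bounds for a function `u` on the half-space, its Hessian (`S`), its Laplacian (`F`)
and its Neumann datum (`G`). -/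
structure WeightedData {n : ℕ} (N : Fin n) (α γ : ℝ) (u : EuclideanSpace ℝ (Fin n) → ℝ)
    (p : Fin n → EuclideanSpace ℝ (Fin n) → ℝ) (P : Fin n → Fin n → EuclideanSpace ℝ (Fin n) → ℝ)
    (S F G : ℝ) : Prop where
  sec : HasSecondPartials N u p P
  hess : ∀ i j, WHolderOn (upperHalf n N) α γ S (P i j)
  lap_le : ∀ x ∈ upperHalf n N, |∑ i, P i i x| ≤ F * (1 + ‖x‖) ^ (γ - 2)
  lap : WHolderOn (upperHalf n N) α γ F (fun x => ∑ i, P i i x)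
  bdry_le : ∀ x, x N = 0 → |p N x| ≤ G * (1 + ‖x‖) ^ (γ - 1)
  bdry : ∀ j, j ≠ N → WHolderOn {x | x N = 0} α γ G (P j N)
  nonneg : 0 ≤ S ∧ 0 ≤ F ∧ 0 ≤ G

namespace WeightedData

variable {n : ℕ} {N : Fin n} {α γ : ℝ} {u : EuclideanSpace ℝ (Fin n) → ℝ}
  {p : Fin n → EuclideanSpace ℝ (Fin n) → ℝ} {P : Fin n → Fin n → EuclideanSpace ℝ (Fin n) → ℝ}
  {S F G : ℝ}

theorem holderData (h : WeightedData N α γ u p P S F G) (hE : γ - 2 - α ≤ 0)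
    {x : EuclideanSpace ℝ (Fin n)} {K : ℝ} (hK : K ≤ (1 + ‖x‖) / 8) :
    HolderData N α u p P x K (S * (2 ^ (-(γ - 2 - α)) * (1 + ‖x‖) ^ (γ - 2 - α)))
      (F * (2 ^ (-(γ - 2 - α)) * (1 + ‖x‖) ^ (γ - 2 - α)))
      (G * (2 ^ (-(γ - 2 - α)) * (1 + ‖x‖) ^ (γ - 2 - α))) := by
  obtain ⟨hS, hF, hG⟩ := h.nonneg
  exact ⟨h.sec,
    fun i j y hy z hz h1 h2 =>
      (h.hess i j).abs_sub_le hS hE hy hz (h1.trans hK) (h2.trans hK),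
    fun y hy z hz h1 h2 => h.lap.abs_sub_le hF hE hy hz (h1.trans hK) (h2.trans hK),
    fun j hj y z hy hz h1 h2 =>
      (h.bdry j hj).abs_sub_le hG hE hy hz (h1.trans hK) (h2.trans hK),
    by positivity, by positivity, by positivity⟩

/-- Interpolation: second derivatives are controlled by the function and by a small multiple of
the Hölder constant of the Hessian. -/
theorem abs_hess_le (h : WeightedData N α γ u p P S F G) (hα : 0 ≤ α) (hγ : γ ≤ 0)
    {A ε : ℝ} (hε0 : 0 < ε) (hε1 : ε ≤ 1 / 16) (hA : 0 ≤ A)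
    (hu : ∀ x ∈ upperHalf n N, |u x| ≤ A * (1 + ‖x‖) ^ γ) (i j : Fin n)
    {x : EuclideanSpace ℝ (Fin n)} (hx : x ∈ upperHalf n N) :
    |P i j x| ≤ (2 ^ (-(γ - 2 - α)) * (2 * ε) ^ α * S + 4 * 2 ^ (-γ) / ε ^ 2 * A)
      * (1 + ‖x‖) ^ (γ - 2) := by
  obtain ⟨hS, hF, hG⟩ := h.nonneg
  set ρ := 1 + ‖x‖ with hρ
  have hρ0 : 0 < ρ := by positivity
  set r := ε * ρ with hr
  have hr0 : 0 < r := by positivity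
  have hr1 : r ≤ ρ / 16 := by rw [hr]; nlinarith
  obtain ⟨θ, τ, t0, t1, s0, s1, hmix⟩ := _root_.exists_mixedDiff_eq (h.sec.fst j) (h.sec.snd i j)
    hx hr0.le hr0.le
  set z := x + θ • coordVec j + τ • coordVec i with hz
  have hzH : z ∈ upperHalf n N := add_smul_coordVec_mem (add_smul_coordVec_mem hx t0 j) s0 i
  have hxj := add_smul_coordVec_mem hx hr0.le j
  have hxi := add_smul_coordVec_mem hx hr0.le i
  have hxij : x + (r • coordVec j + r • coordVec i) ∈ upperHalf n N := by
    rw [← add_assoc]; exact add_smul_coordVec_mem hxj hr0.le i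
  have hdz : dist z x ≤ 2 * r := by
    have := dist_triangle z (x + θ • coordVec j) x
    rw [dist_add_smul_coordVec_self x t0, hz, dist_add_smul_coordVec_self _ s0] at this
    linarith
  have hval : ∀ y ∈ upperHalf n N, dist y x ≤ 2 * r → |u y| ≤ A * (2 ^ (-γ) * ρ ^ γ) := by
    intro y hy hyx
    refine (hu y hy).trans ?_
    gcongr
    exact rpow_le_of_half_le hρ0 (one_add_norm_ge_half (by linarith)) hγ
  have hdij : dist (x + (r • coordVec j + r • coordVec i)) x ≤ 2 * r := by
    have := dist_triangle (x + (r • coordVec j + r • coordVec i)) (x + r • coordVec j) x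
    rw [dist_add_smul_coordVec_self x hr0.le, ← add_assoc,
      dist_add_smul_coordVec_self _ hr0.le] at this
    rw [← add_assoc]
    linarith
  have b1 := hval _ hxij hdij
  have b2 := hval _ hxj (by rw [dist_add_smul_coordVec_self x hr0.le]; linarith)
  have b3 := hval _ hxi (by rw [dist_add_smul_coordVec_self x hr0.le]; linarith)
  have b4 := hval _ hx (by simp; linarith)
  have hm : |r * r * P i j z| ≤ 4 * (A * (2 ^ (-γ) * ρ ^ γ)) := by
    rw [← hmix, _root_.mixedDiff]
    have b1 := abs_le.1 b1
    have b2 := abs_le.1 b2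
    have b3 := abs_le.1 b3
    have b4 := abs_le.1 b4
    exact abs_le.2 ⟨by linarith [b1.1, b2.2, b3.2, b4.1], by linarith [b1.2, b2.1, b3.1, b4.2]⟩
  have hPz : |P i j z| ≤ 4 * 2 ^ (-γ) / ε ^ 2 * A * ρ ^ (γ - 2) := by
    rw [abs_mul, abs_of_pos (by positivity), mul_comm, ← le_div_iff₀ (by positivity)] at hm
    refine hm.trans (le_of_eq ?_)
    rw [Real.rpow_sub hρ0, hr]
    norm_num
    field_simp
  have hdiff := (h.hess i j).abs_sub_le hS (by linarith) (x := x) hzH hx (by linarith)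
    (by simp; positivity)
  have hdiff2 : |P i j z - P i j x| ≤ 2 ^ (-(γ - 2 - α)) * (2 * ε) ^ α * S * ρ ^ (γ - 2) := by
    have e : ρ ^ (γ - 2) = ρ ^ (γ - 2 - α) * ρ ^ α := by
      rw [← Real.rpow_add hρ0]; ring_nf
    have hd : dist z x ^ α ≤ (2 * ε) ^ α * ρ ^ α := by
      rw [← Real.mul_rpow (by positivity) hρ0.le]
      gcongr
      rw [hr] at hdz
      linarith
    refine hdiff.trans ?_
    calc _ ≤ S * (2 ^ (-(γ - 2 - α)) * ρ ^ (γ - 2 - α)) * ((2 * ε) ^ α * ρ ^ α) := by gcongr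
      _ = _ := by rw [e]; ring
  have := abs_sub_abs_le_abs_sub (P i j x) (P i j z)
  rw [abs_sub_comm] at this
  linarith

theorem abs_grad_le (h : WeightedData N α γ u p P S F G) (hγ : γ ≤ 0) {A B : ℝ} (hA : 0 ≤ A)
    (hB : 0 ≤ B) (hu : ∀ x ∈ upperHalf n N, |u x| ≤ A * (1 + ‖x‖) ^ γ)
    (hP : ∀ i j, ∀ x ∈ upperHalf n N, |P i j x| ≤ B * (1 + ‖x‖) ^ (γ - 2)) (i : Fin n)
    {x : EuclideanSpace ℝ (Fin n)} (hx : x ∈ upperHalf n N) :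
    |p i x| ≤ (8 * 2 ^ (-γ) * A + 2 ^ (-(γ - 2)) * B) * (1 + ‖x‖) ^ (γ - 1) := by
  set ρ := 1 + ‖x‖ with hρ
  have hρ0 : 0 < ρ := by positivity
  obtain ⟨θ, t0, t1, h1⟩ := (h.sec.fst i).exists_sub_eq hx (s := ρ / 4) (by positivity)
  obtain ⟨τ, s0, s1, h2⟩ := (h.sec.snd i i).exists_sub_eq hx t0
  have hhalf : ∀ t : ℝ, 0 ≤ t → t ≤ ρ / 4 → ρ / 2 ≤ 1 + ‖x + t • coordVec i‖ := fun t h0 h1 =>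
    one_add_norm_ge_half (by rw [dist_add_smul_coordVec_self x h0]; linarith)
  have b1 : |u (x + (ρ / 4) • coordVec i)| ≤ A * (2 ^ (-γ) * ρ ^ γ) := by
    refine (hu _ (add_smul_coordVec_mem hx (by positivity) i)).trans ?_
    gcongr
    exact rpow_le_of_half_le hρ0 (hhalf _ (by positivity) le_rfl) hγ
  have b2 : |u x| ≤ A * (2 ^ (-γ) * ρ ^ γ) := by
    refine (hu x hx).trans ?_
    gcongr
    exact rpow_le_of_half_le hρ0 (by linarith) hγ
  have b3 : |P i i (x + τ • coordVec i)| ≤ B * (2 ^ (-(γ - 2)) * ρ ^ (γ - 2)) := by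
    refine (hP i i _ (add_smul_coordVec_mem hx s0 i)).trans ?_
    gcongr
    exact rpow_le_of_half_le hρ0 (hhalf _ s0 (s1.trans t1)) (by linarith)
  have c1 : |p i (x + θ • coordVec i)| ≤ 8 * 2 ^ (-γ) * A * ρ ^ (γ - 1) := by
    have hle : |ρ / 4 * p i (x + θ • coordVec i)| ≤ 2 * (A * (2 ^ (-γ) * ρ ^ γ)) := by
      rw [← h1]
      have b1 := abs_le.1 b1
      have b2 := abs_le.1 b2
      exact abs_le.2 ⟨by linarith [b1.1, b2.2], by linarith [b1.2, b2.1]⟩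
    rw [abs_mul, abs_of_pos (by positivity), mul_comm, ← le_div_iff₀ (by positivity)] at hle
    refine hle.trans (le_of_eq ?_)
    rw [Real.rpow_sub_one hρ0.ne']
    field_simp
    ring
  have c2 : |p i (x + θ • coordVec i) - p i x| ≤ 2 ^ (-(γ - 2)) * B * ρ ^ (γ - 1) := by
    rw [h2, abs_mul, abs_of_nonneg t0]
    have e : ρ ^ (γ - 1) = ρ * ρ ^ (γ - 2) := by
      rw [← Real.rpow_one_add' hρ0.le (by linarith)]; ring_nf
    calc θ * |P i i (x + τ • coordVec i)| ≤ ρ * (B * (2 ^ (-(γ - 2)) * ρ ^ (γ - 2))) := by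
          gcongr
          linarith
      _ = _ := by rw [e]; ring
  have := abs_sub_abs_le_abs_sub (p i x) (p i (x + θ • coordVec i))
  rw [abs_sub_comm] at this
  linarith

end WeightedData

/-- If a closed family of upper bounds is stable under `S ↦ S / 2 + D`, it contains `2 * D`. -/
theorem le_of_halving {Q : ℝ → Prop} {S D : ℝ} (hS : 0 ≤ S) (hD : 0 ≤ D) (hQ : Q S)
    (hstep : ∀ S, 0 ≤ S → Q S → Q (S / 2 + D))
    (hclosed : ∀ D, (∀ η, 0 < η → ∃ S, S ≤ D + η ∧ 0 ≤ S ∧ Q S) → Q D) : Q (2 * D) := by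
  have hk : ∀ k : ℕ, ∃ T, T ≤ 2 * D + S * (1 / 2) ^ k ∧ 0 ≤ T ∧ Q T := by
    intro k
    induction k with
    | zero => exact ⟨S, by simp; linarith, hS, hQ⟩
    | succ k ih =>
      obtain ⟨T, h1, h2, h3⟩ := ih
      exact ⟨T / 2 + D, by rw [pow_succ]; linarith, by positivity, hstep T h2 h3⟩
  refine hclosed _ fun η hη => ?_
  have hlim : Tendsto (fun k : ℕ => S * (1 / 2 : ℝ) ^ k) atTop (𝓝 (S * 0)) :=
    (tendsto_pow_atTop_nhds_zero_of_lt_one (by norm_num) (by norm_num)).const_mul S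
  rw [mul_zero] at hlim
  obtain ⟨k, hk'⟩ := (hlim.eventually_lt_const hη).exists
  obtain ⟨T, h1, h2, h3⟩ := hk k
  exact ⟨T, by linarith, h2, h3⟩

/-- The weighted Schauder estimate, in terms of partial derivatives. -/
theorem exists_weighted_schauder {n : ℕ} (N : Fin n) {α γ : ℝ} (hα₁ : 0 < α) (hα₂ : α < 1)
    (hγ₁ : 2 - (n : ℝ) < γ) (hγ₂ : γ < 0) :
    ∃ C, 0 ≤ C ∧ ∀ u p P M S F G, WeightedData N α γ u p P S F G →
      (∀ x ∈ upperHalf n N, |u x| ≤ M * (1 + ‖x‖) ^ γ) →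
      (∀ x ∈ upperHalf n N, |u x| ≤ C * (F + G) * (1 + ‖x‖) ^ γ) ∧
      (∀ i, ∀ x ∈ upperHalf n N, |p i x| ≤ C * (F + G) * (1 + ‖x‖) ^ (γ - 1)) ∧
      (∀ i j, ∀ x ∈ upperHalf n N, |P i j x| ≤ C * (F + G) * (1 + ‖x‖) ^ (γ - 2)) ∧
      ∀ i j, WHolderOn (upperHalf n N) α γ (C * (F + G)) (P i j) := by
  obtain ⟨C₀, hC₀, h₀⟩ := exists_abs_le_of_weighted_bounds N hγ₁ hγ₂
  have hE : γ - 2 - α ≤ 0 := by linarith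
  set L : ℝ := 2 ^ (-(γ - 2 - α)) with hL
  have hL0 : 0 < L := by positivity
  obtain ⟨K, C₁, hK, hC₁, h₁⟩ := exists_hess_control N hα₁ hα₂ (δ := 1 / (4 * L)) (by positivity)
  obtain ⟨ε', hε'0, hε'1, hε'⟩ := exists_rpow_le hα₁
    (δ := 1 / (4 * L * (8 * K) ^ α)) (by positivity)
  set ε := ε' / 8 with hεdef
  have hε0 : 0 < ε := by positivity
  have hε : 2 * (8 * K) ^ α * (L * (2 * ε) ^ α) ≤ 1 / 4 := by
    have h1 : (2 * ε) ^ α ≤ (2 * ε') ^ α := by gcongr; linarith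
    have h2 : 2 * (2 * ε) ^ α ≤ 1 / (4 * L * (8 * K) ^ α) := by linarith
    rw [le_div_iff₀ (by positivity)] at h2
    linarith
  set D₂ : ℝ := 4 * 2 ^ (-γ) / ε ^ 2 * C₀ with hD₂
  set D : ℝ := L * C₁ + 2 * (8 * K) ^ α * D₂ with hD
  have hD₂0 : 0 ≤ D₂ := by positivity
  have hD0 : 0 ≤ D := by positivity
  set B : ℝ := L * (2 * ε) ^ α * (2 * D) + D₂ with hB
  have hB0 : 0 ≤ B := by positivity
  set B₁ : ℝ := 8 * 2 ^ (-γ) * C₀ + 2 ^ (-(γ - 2)) * B with hB₁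
  have hB₁0 : 0 ≤ B₁ := by positivity
  refine ⟨C₀ + B₁ + B + 2 * D, by positivity, fun u p P M S F G hd hM => ?_⟩
  obtain ⟨hS, hF, hG⟩ := hd.nonneg
  have hFG : 0 ≤ F + G := by positivity
  have hu := h₀ u p P F G M hd.sec hF hG hM hd.lap_le hd.bdry_le
  have hrep : ∀ T, 0 ≤ T → (∀ i j, WHolderOn (upperHalf n N) α γ T (P i j)) →
      WeightedData N α γ u p P T F G := fun T hT hT' =>
    ⟨hd.sec, hT', hd.lap_le, hd.lap, hd.bdry_le, hd.bdry, hT, hF, hG⟩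
  have hbound : ∀ T, 0 ≤ T → (∀ i j, WHolderOn (upperHalf n N) α γ T (P i j)) →
      ∀ i j, ∀ x ∈ upperHalf n N,
        |P i j x| ≤ (L * (2 * ε) ^ α * T + D₂ * (F + G)) * (1 + ‖x‖) ^ (γ - 2) := by
    intro T hT hT' i j x hx
    refine ((hrep T hT hT').abs_hess_le hα₁.le hγ₂.le hε0 (by linarith)
      (A := C₀ * (F + G)) (by positivity) hu i j hx).trans (le_of_eq ?_)
    rw [hD₂, mul_assoc (4 * 2 ^ (-γ) / ε ^ 2)]
  have hstep : ∀ T, 0 ≤ T → (∀ i j, WHolderOn (upperHalf n N) α γ T (P i j)) →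
      ∀ i j, WHolderOn (upperHalf n N) α γ (T / 2 + D * (F + G)) (P i j) := by
    intro T hT hT' i j y hy z hz hyz
    set m := min (1 + ‖y‖) (1 + ‖z‖) with hm
    have hm0 : 0 < m := lt_min (by positivity) (by positivity)
    rcases eq_or_ne y z with rfl | hne
    · simp only [sub_self, abs_zero]
      positivity
    have hs : 0 < dist y z := dist_pos.2 hne
    rcases le_total (K * dist y z) (m / 8) with hKs | hKs
    · have hmz : m ≤ 1 + ‖z‖ := min_le_right _ _
      have key := h₁ u p P z _ _ _ hz (dist y z) hs
        ((hrep T hT hT').holderData hE (x := z) (by linarith)) i j y hy le_rfl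
      refine key.trans ?_
      have hw : (1 + ‖z‖) ^ (γ - 2 - α) ≤ m ^ (γ - 2 - α) :=
        Real.rpow_le_rpow_of_nonpos hm0 hmz hE
      have e1 : 1 / (4 * L) * (T * (L * (1 + ‖z‖) ^ (γ - 2 - α)))
          + C₁ * (F * (L * (1 + ‖z‖) ^ (γ - 2 - α)) + G * (L * (1 + ‖z‖) ^ (γ - 2 - α)))
          = (T / 4 + L * C₁ * (F + G)) * (1 + ‖z‖) ^ (γ - 2 - α) := by
        field_simp
      rw [e1]
      have e2 : T / 4 + L * C₁ * (F + G) ≤ T / 2 + D * (F + G) := by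
        have : 0 ≤ 2 * (8 * K) ^ α * D₂ * (F + G) := by positivity
        rw [hD]
        linarith
      gcongr
    · have b1 := hbound T hT hT' i j y hy
      have b2 := hbound T hT hT' i j z hz
      set Q := L * (2 * ε) ^ α * T + D₂ * (F + G) with hQ
      have hQ0 : 0 ≤ Q := by positivity
      have w1 : (1 + ‖y‖) ^ (γ - 2) ≤ m ^ (γ - 2) :=
        Real.rpow_le_rpow_of_nonpos hm0 (min_le_left _ _) (by linarith)
      have w2 : (1 + ‖z‖) ^ (γ - 2) ≤ m ^ (γ - 2) :=
        Real.rpow_le_rpow_of_nonpos hm0 (min_le_right _ _) (by linarith)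
      have w3 := mul_le_mul_of_nonneg_left w1 hQ0
      have w4 := mul_le_mul_of_nonneg_left w2 hQ0
      have e : m ^ (γ - 2) = m ^ (γ - 2 - α) * m ^ α := by
        rw [← Real.rpow_add hm0]; ring_nf
      have w5 : m ^ α ≤ (8 * K) ^ α * dist y z ^ α := by
        rw [← Real.mul_rpow (by positivity) hs.le]
        gcongr
        linarith
      have b3 : |P i j y - P i j z| ≤ 2 * (Q * m ^ (γ - 2)) := by
        have b1 := abs_le.1 b1
        have b2 := abs_le.1 b2
        exact abs_le.2 ⟨by linarith [b1.1, b2.2], by linarith [b1.2, b2.1]⟩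
      refine b3.trans ?_
      rw [e]
      have w6 : 2 * (8 * K) ^ α * Q ≤ T / 2 + D * (F + G) := by
        have h1 := mul_le_mul_of_nonneg_right hε hT
        have h2 : 0 ≤ L * C₁ * (F + G) := by positivity
        rw [hQ, hD]
        linarith
      calc 2 * (Q * (m ^ (γ - 2 - α) * m ^ α))
          ≤ 2 * (Q * (m ^ (γ - 2 - α) * ((8 * K) ^ α * dist y z ^ α))) := by gcongr
        _ = 2 * (8 * K) ^ α * Q * m ^ (γ - 2 - α) * dist y z ^ α := by ring
        _ ≤ _ := by gcongr
  have hfinal : ∀ i j, WHolderOn (upperHalf n N) α γ (2 * (D * (F + G))) (P i j) := by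
    refine le_of_halving (Q := fun T => ∀ i j, WHolderOn (upperHalf n N) α γ T (P i j)) hS
      (by positivity) hd.hess hstep ?_
    intro T hT i j y hy z hz hyz
    set m := min (1 + ‖y‖) (1 + ‖z‖) with hm
    have hm0 : 0 < m := lt_min (by positivity) (by positivity)
    refine le_of_forall_pos_le_add fun η hη => ?_
    have hw : 0 < m ^ (γ - 2 - α) * dist y z ^ α + 1 := by positivity
    obtain ⟨T', h1, h2, h3⟩ := hT (η / (m ^ (γ - 2 - α) * dist y z ^ α + 1)) (by positivity)
    have h4 := h3 i j y hy z hz hyz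
    rw [← hm, mul_assoc] at h4
    have h5 := mul_le_mul_of_nonneg_right h1
      (show 0 ≤ m ^ (γ - 2 - α) * dist y z ^ α by positivity)
    have h6 : η / (m ^ (γ - 2 - α) * dist y z ^ α + 1) * (m ^ (γ - 2 - α) * dist y z ^ α)
        ≤ η := by
      rw [div_mul_eq_mul_div, div_le_iff₀ hw]
      nlinarith
    linarith
  have hPB : ∀ i j, ∀ x ∈ upperHalf n N,
      |P i j x| ≤ B * (F + G) * (1 + ‖x‖) ^ (γ - 2) := by
    intro i j x hx
    refine (hbound _ (by positivity) hfinal i j x hx).trans (le_of_eq ?_)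
    rw [hB]; ring
  have hgrad : ∀ i, ∀ x ∈ upperHalf n N, |p i x| ≤ B₁ * (F + G) * (1 + ‖x‖) ^ (γ - 1) := by
    intro i x hx
    refine (hd.abs_grad_le hγ₂.le (A := C₀ * (F + G)) (B := B * (F + G)) (by positivity)
      (by positivity) hu hPB i hx).trans (le_of_eq ?_)
    rw [hB₁]; ring
  have hle : ∀ c, c ≤ C₀ + B₁ + B + 2 * D → ∀ w : ℝ, 0 ≤ w →
      c * (F + G) * w ≤ (C₀ + B₁ + B + 2 * D) * (F + G) * w := fun c hc w hw => by gcongr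
  refine ⟨fun x hx => (hu x hx).trans (hle _ (by linarith) _ (by positivity)),
    fun i x hx => (hgrad i x hx).trans (hle _ (by linarith) _ (by positivity)),
    fun i j x hx => (hPB i j x hx).trans (hle _ (by linarith) _ (by positivity)),
    fun i j y hy z hz hyz => (hfinal i j y hy z hz hyz).trans ?_⟩
  have hm0 : 0 < min (1 + ‖y‖) (1 + ‖z‖) := lt_min (by positivity) (by positivity)
  rw [← mul_assoc 2, mul_assoc, mul_assoc ((C₀ + B₁ + B + 2 * D) * (F + G))]
  exact hle _ (by linarith) _ (by positivity)

theorem le_wHolderNorm {m k : ℕ} {α γ : ℝ} {S : Set (EuclideanSpace ℝ (Fin m))}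
    {u : EuclideanSpace ℝ (Fin m) → ℝ}
    (hb : ∀ i, i ≤ k → ∃ M : ℝ, ∀ x ∈ S,
      (1 + ‖x‖) ^ (-γ + (i : ℝ)) * ‖iteratedFDerivWithin ℝ i u S x‖ ≤ M)
    (hh : ∃ M : ℝ, ∀ x ∈ S, ∀ y ∈ S, x ≠ y → dist x y ≤ min (1 + ‖x‖) (1 + ‖y‖) / 2 →
      (min (1 + ‖x‖) (1 + ‖y‖)) ^ (-γ + (k : ℝ) + α) *
        ‖iteratedFDerivWithin ℝ k u S x - iteratedFDerivWithin ℝ k u S y‖ ≤ M * dist x y ^ α) :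
    0 ≤ wHolderNorm m k α γ S u ∧
    (∀ i, i ≤ k → ∀ x ∈ S, ‖iteratedFDerivWithin ℝ i u S x‖
      ≤ wHolderNorm m k α γ S u * (1 + ‖x‖) ^ (γ - (i : ℝ))) ∧
    ∀ x ∈ S, ∀ y ∈ S, dist x y ≤ min (1 + ‖x‖) (1 + ‖y‖) / 2 →
      ‖iteratedFDerivWithin ℝ k u S x - iteratedFDerivWithin ℝ k u S y‖
        ≤ wHolderNorm m k α γ S u * (min (1 + ‖x‖) (1 + ‖y‖)) ^ (γ - (k : ℝ) - α)
          * dist x y ^ α := by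
  set T : ℕ → Set ℝ := fun i => {t : ℝ | ∃ x ∈ S,
      t = (1 + ‖x‖) ^ (-γ + (i : ℝ)) * ‖iteratedFDerivWithin ℝ i u S x‖} with hT
  set R : Set ℝ := {t : ℝ | ∃ x ∈ S, ∃ y ∈ S, x ≠ y ∧
    dist x y ≤ min (1 + ‖x‖) (1 + ‖y‖) / 2 ∧
    t = (min (1 + ‖x‖) (1 + ‖y‖)) ^ (-γ + (k : ℝ) + α) *
        ‖iteratedFDerivWithin ℝ k u S x - iteratedFDerivWithin ℝ k u S y‖ /
          dist x y ^ α} with hR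
  have hT0 : ∀ i, 0 ≤ sSup (T i) := fun i =>
    Real.sSup_nonneg (by rintro t ⟨x, -, rfl⟩; positivity)
  have hR0 : 0 ≤ sSup R := Real.sSup_nonneg (by rintro t ⟨x, -, y, -, -, -, rfl⟩; positivity)
  have hW : wHolderNorm m k α γ S u = (∑ i ∈ Finset.range (k + 1), sSup (T i)) + sSup R := rfl
  have hsum : 0 ≤ ∑ i ∈ Finset.range (k + 1), sSup (T i) := Finset.sum_nonneg fun i _ => hT0 i
  refine ⟨by rw [hW]; positivity, fun i hi x hx => ?_, fun x hx y hy hxy => ?_⟩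
  · obtain ⟨M, hM⟩ := hb i hi
    have hbdd : BddAbove (T i) := ⟨M, by rintro t ⟨x, hx, rfl⟩; exact hM x hx⟩
    have h1 := le_csSup hbdd ⟨x, hx, rfl⟩
    have h2 : sSup (T i) ≤ ∑ i ∈ Finset.range (k + 1), sSup (T i) :=
      Finset.single_le_sum (f := fun i => sSup (T i)) (fun i _ => hT0 i)
        (Finset.mem_range.2 (by omega))
    have hρ : 0 < 1 + ‖x‖ := by positivity
    rw [show γ - (i : ℝ) = -(-γ + i) by ring, Real.rpow_neg hρ.le, ← div_eq_mul_inv,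
      le_div_iff₀ (by positivity), mul_comm, hW]
    linarith
  · rcases eq_or_ne x y with rfl | hne
    · rw [sub_self, norm_zero, hW]
      positivity
    obtain ⟨M, hM⟩ := hh
    have hd : 0 < dist x y ^ α := Real.rpow_pos_of_pos (dist_pos.2 hne) α
    have hbdd : BddAbove R := by
      refine ⟨M, ?_⟩
      rintro t ⟨x, hx, y, hy, hne, hxy, rfl⟩
      have hd : 0 < dist x y ^ α := Real.rpow_pos_of_pos (dist_pos.2 hne) α
      rw [div_le_iff₀ hd]
      exact hM x hx y hy hne hxy
    have h1 := le_csSup hbdd ⟨x, hx, y, hy, hne, hxy, rfl⟩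
    have hρ : 0 < min (1 + ‖x‖) (1 + ‖y‖) := by positivity
    rw [← div_le_iff₀ hd, show γ - (k : ℝ) - α = -(-γ + k + α) by ring, Real.rpow_neg hρ.le,
      ← div_eq_mul_inv, le_div_iff₀ (by positivity), mul_comm, ← mul_div_assoc, hW]
    linarith

theorem wHolderNorm_le {m k : ℕ} {α γ A : ℝ} {S : Set (EuclideanSpace ℝ (Fin m))}
    {u : EuclideanSpace ℝ (Fin m) → ℝ} (hA : 0 ≤ A)
    (hb : ∀ i, i ≤ k → ∀ x ∈ S, ‖iteratedFDerivWithin ℝ i u S x‖ ≤ A * (1 + ‖x‖) ^ (γ - (i : ℝ)))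
    (hh : ∀ x ∈ S, ∀ y ∈ S, dist x y ≤ min (1 + ‖x‖) (1 + ‖y‖) / 2 →
      ‖iteratedFDerivWithin ℝ k u S x - iteratedFDerivWithin ℝ k u S y‖
        ≤ A * (min (1 + ‖x‖) (1 + ‖y‖)) ^ (γ - (k : ℝ) - α) * dist x y ^ α) :
    wHolderNorm m k α γ S u ≤ (k + 2) * A := by
  have h1 : ∀ i ∈ Finset.range (k + 1), sSup {t : ℝ | ∃ x ∈ S,
      t = (1 + ‖x‖) ^ (-γ + (i : ℝ)) * ‖iteratedFDerivWithin ℝ i u S x‖} ≤ A := by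
    intro i hi
    refine Real.sSup_le ?_ hA
    rintro t ⟨x, hx, rfl⟩
    have hρ : 0 < 1 + ‖x‖ := by positivity
    have := hb i (by have := Finset.mem_range.1 hi; omega) x hx
    rwa [show γ - (i : ℝ) = -(-γ + i) by ring, Real.rpow_neg hρ.le, ← div_eq_mul_inv,
      le_div_iff₀ (by positivity), mul_comm] at this
  have h2 := Finset.sum_le_card_nsmul _ _ _ h1
  rw [Finset.card_range, nsmul_eq_mul] at h2
  have h3 : sSup {t : ℝ | ∃ x ∈ S, ∃ y ∈ S, x ≠ y ∧
      dist x y ≤ min (1 + ‖x‖) (1 + ‖y‖) / 2 ∧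
      t = (min (1 + ‖x‖) (1 + ‖y‖)) ^ (-γ + (k : ℝ) + α) *
        ‖iteratedFDerivWithin ℝ k u S x - iteratedFDerivWithin ℝ k u S y‖ /
          dist x y ^ α} ≤ A := by
    refine Real.sSup_le ?_ hA
    rintro t ⟨x, hx, y, hy, hne, hxy, rfl⟩
    have hd : 0 < dist x y ^ α := Real.rpow_pos_of_pos (dist_pos.2 hne) α
    have hρ : 0 < min (1 + ‖x‖) (1 + ‖y‖) := by positivity
    have := hh x hx y hy hxy
    rwa [← div_le_iff₀ hd, show γ - (k : ℝ) - α = -(-γ + k + α) by ring, Real.rpow_neg hρ.le,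
      ← div_eq_mul_inv, le_div_iff₀ (by positivity), mul_comm, ← mul_div_assoc] at this
  unfold wHolderNorm
  push_cast at h2
  linarith

/-- A multilinear form is controlled by its values on the standard basis. -/
theorem ContinuousMultilinearMap.opNorm_le_of_coordVec {n k : ℕ} {A : ℝ} (hA : 0 ≤ A)
    (T : ContinuousMultilinearMap ℝ (fun _ : Fin k => EuclideanSpace ℝ (Fin n)) ℝ)
    (h : ∀ s : Fin k → Fin n, |T fun a => coordVec (s a)| ≤ A) : ‖T‖ ≤ n ^ k * A := by
  refine T.opNorm_le_bound (by positivity) fun m => ?_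
  have hm : m = fun a => ∑ i, m a i • coordVec i := by
    ext a j
    simp [coordVec, Pi.single_apply]
  have key : T m = ∑ s : Fin k → Fin n, (∏ a, m a (s a)) * T fun a => coordVec (s a) := by
    conv_lhs => rw [hm]
    rw [T.map_sum]
    refine Finset.sum_congr rfl fun s _ => ?_
    rw [T.map_smul_univ (fun a => m a (s a)) fun a => coordVec (s a), smul_eq_mul]
  rw [key]
  calc ‖∑ s : Fin k → Fin n, (∏ a, m a (s a)) * T fun a => coordVec (s a)‖
      ≤ ∑ s : Fin k → Fin n, (∏ a, ‖m a‖) * A := by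
        refine norm_sum_le_of_le _ fun s _ => ?_
        rw [norm_mul, norm_prod]
        gcongr with a
        · exact PiLp.norm_apply_le _ _
        · exact h s
    _ = n ^ k * A * ∏ a, ‖m a‖ := by
        simp
        ring

theorem norm_iteratedFDerivWithin_zero_sub {E : Type*} [NormedAddCommGroup E] [NormedSpace ℝ E]
    (f : E → ℝ) (S : Set E) (x y : E) :
    ‖iteratedFDerivWithin ℝ 0 f S x - iteratedFDerivWithin ℝ 0 f S y‖ = |f x - f y| := by
  rw [iteratedFDerivWithin_zero_eq_comp, Function.comp_apply, Function.comp_apply, ← map_sub,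
    LinearIsometryEquiv.norm_map, Real.norm_eq_abs]

theorem HasPartial.of_hasFDerivWithinAt {n : ℕ} {N : Fin n} (i : Fin n)
    {f : EuclideanSpace ℝ (Fin n) → ℝ}
    {f' : EuclideanSpace ℝ (Fin n) → EuclideanSpace ℝ (Fin n) →L[ℝ] ℝ}
    (h : ∀ x ∈ upperHalf n N, HasFDerivWithinAt f (f' x) (upperHalf n N) x) :
    HasPartial N i f (fun x => f' x (coordVec i)) := by
  intro x hx
  have h1 : HasDerivWithinAt (fun τ : ℝ => x + τ • coordVec i) (coordVec i)
      {τ : ℝ | x + τ • coordVec i ∈ upperHalf n N} 0 := by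
    simpa using (((hasDerivAt_id (0 : ℝ)).smul_const (coordVec i)).const_add x).hasDerivWithinAt
  have h2 : HasFDerivWithinAt f (f' x) (upperHalf n N) (x + (0 : ℝ) • coordVec i) := by
    simpa using h x hx
  exact h2.comp_hasDerivWithinAt (0 : ℝ) h1 fun τ hτ => hτ

theorem convex_upperHalf {n : ℕ} (N : Fin n) : Convex ℝ (upperHalf n N) := by
  intro x hx y hy a b ha hb _
  simp only [upperHalf, Set.mem_ofPred_eq, PiLp.add_apply, PiLp.smul_apply, smul_eq_mul] at *
  positivity

theorem interior_upperHalf_nonempty {n : ℕ} (N : Fin n) :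
    (interior (upperHalf n N)).Nonempty := by
  have ho : IsOpen {x : EuclideanSpace ℝ (Fin n) | 0 < x N} :=
    isOpen_lt continuous_const (by fun_prop)
  have hs : {x : EuclideanSpace ℝ (Fin n) | 0 < x N} ⊆ upperHalf n N := fun x hx =>
    show 0 ≤ x N from le_of_lt (show 0 < x N from hx)
  exact ⟨coordVec N, interior_maximal hs ho (by simp [coordVec])⟩

theorem uniqueDiffOn_upperHalf {n : ℕ} (N : Fin n) : UniqueDiffOn ℝ (upperHalf n N) :=
  uniqueDiffOn_convex (convex_upperHalf N) (interior_upperHalf_nonempty N)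

theorem subset_closure_interior_upperHalf {n : ℕ} (N : Fin n) :
    upperHalf n N ⊆ closure (interior (upperHalf n N)) := by
  rw [(convex_upperHalf N).closure_interior_eq_closure_of_nonempty_interior
    (interior_upperHalf_nonempty N)]
  exact subset_closure

theorem hasSecondPartials_of_contDiffOn {n : ℕ} {N : Fin n} {u : EuclideanSpace ℝ (Fin n) → ℝ}
    (hu : ContDiffOn ℝ 2 u (upperHalf n N)) :
    HasSecondPartials N u (fun i x => fderivWithin ℝ u (upperHalf n N) x (coordVec i))
      (fun i j x => fderivWithin ℝ (fderivWithin ℝ u (upperHalf n N)) (upperHalf n N) x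
        (coordVec i) (coordVec j)) := by
  have hD := uniqueDiffOn_upperHalf N
  have hu' : ContDiffOn ℝ 1 (fderivWithin ℝ u (upperHalf n N)) (upperHalf n N) :=
    hu.fderivWithin hD (by norm_num)
  refine ⟨hu.continuousOn, fun i => .of_hasFDerivWithinAt i fun x hx =>
    (hu.differentiableOn (by norm_num) x hx).hasFDerivWithinAt, fun i j => ?_,
    fun i j x hx => ?_⟩
  · have h1 : ∀ x ∈ upperHalf n N, HasFDerivWithinAt
        (fun x => fderivWithin ℝ u (upperHalf n N) x (coordVec j))
        ((fderivWithin ℝ (fderivWithin ℝ u (upperHalf n N)) (upperHalf n N) x).flip (coordVec j))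
        (upperHalf n N) x := fun x hx => by
      have h2 := (hu'.differentiableOn (by norm_num) x hx).hasFDerivWithinAt
      simpa using h2.clm_apply (hasFDerivWithinAt_const (coordVec j) x _)
    exact .of_hasFDerivWithinAt i h1
  · exact ((hu x hx).isSymmSndFDerivWithinAt (by simp) hD
      (subset_closure_interior_upperHalf N hx) hx) _ _

theorem emb_castLE {n : ℕ} (x' : EuclideanSpace ℝ (Fin (n - 1))) (i : Fin (n - 1)) :
    emb n x' (Fin.castLE (Nat.sub_le n 1) i) = x' i := by
  simp [emb, Pi.single_apply, Fin.castLE_inj]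

theorem emb_last {n : ℕ} (hn : n - 1 < n) (x' : EuclideanSpace ℝ (Fin (n - 1))) :
    emb n x' ⟨n - 1, hn⟩ = 0 := by
  simp only [emb, WithLp.ofLp_sum, Finset.sum_apply, PiLp.smul_apply, smul_eq_mul]
  refine Finset.sum_eq_zero fun i _ => ?_
  have : (⟨n - 1, hn⟩ : Fin n) ≠ Fin.castLE (Nat.sub_le n 1) i := by
    simp only [ne_eq, Fin.ext_iff, Fin.val_castLE]
    omega
  simp [this]

theorem eq_castLE_of_ne_last {n : ℕ} {hn : n - 1 < n} {j : Fin n} (hj : j ≠ ⟨n - 1, hn⟩) :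
    ∃ i, j = Fin.castLE (Nat.sub_le n 1) i := by
  refine ⟨⟨j, ?_⟩, rfl⟩
  have := j.2
  simp only [ne_eq, Fin.ext_iff] at hj
  omega

theorem exists_emb_eq {n : ℕ} {hn : n - 1 < n} {x : EuclideanSpace ℝ (Fin n)}
    (hx : x ⟨n - 1, hn⟩ = 0) : ∃ x', emb n x' = x := by
  refine ⟨WithLp.toLp 2 fun i => x (Fin.castLE (Nat.sub_le n 1) i), ?_⟩
  ext j
  by_cases hj : j = ⟨n - 1, hn⟩
  · rw [hj, emb_last, hx]
  · obtain ⟨i, rfl⟩ := eq_castLE_of_ne_last hj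
    rw [emb_castLE]

theorem norm_emb {n : ℕ} (x' : EuclideanSpace ℝ (Fin (n - 1))) : ‖emb n x'‖ = ‖x'‖ := by
  have ho : Orthonormal ℝ fun i : Fin (n - 1) =>
      (EuclideanSpace.single (Fin.castLE (Nat.sub_le n 1) i) 1 : EuclideanSpace ℝ (Fin n)) :=
    (EuclideanSpace.orthonormal_single).comp _ (Fin.castLE_injective _)
  rw [← sq_eq_sq₀ (norm_nonneg _) (norm_nonneg _), ← real_inner_self_eq_norm_sq, emb,
    ho.inner_sum, EuclideanSpace.real_norm_sq_eq]
  simp [sq]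

/-- The embedding of the boundary hyperplane, as a linear isometry. -/
def embIsometry (n : ℕ) : EuclideanSpace ℝ (Fin (n - 1)) →ₗᵢ[ℝ] EuclideanSpace ℝ (Fin n) where
  toFun := emb n
  map_add' x y := by simp [emb, add_smul, Finset.sum_add_distrib]
  map_smul' c x := by simp [emb, mul_smul, Finset.smul_sum]
  norm_map' := norm_emb

theorem emb_coordVec {n : ℕ} (i : Fin (n - 1)) :
    emb n (coordVec i) = coordVec (Fin.castLE (Nat.sub_le n 1) i) := by
  simp [emb, coordVec, ite_smul]

theorem emb_mem_upperHalf {n : ℕ} (hn : n - 1 < n) (x' : EuclideanSpace ℝ (Fin (n - 1))) :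
    emb n x' ∈ upperHalf n ⟨n - 1, hn⟩ := (emb_last hn x').ge

theorem dist_emb {n : ℕ} (x' y' : EuclideanSpace ℝ (Fin (n - 1))) :
    dist (emb n x') (emb n y') = dist x' y' :=
  (embIsometry n).dist_map x' y'

/-- The derivative of the Neumann datum of `u`. -/
theorem iteratedFDerivWithin_one_normal {n : ℕ} (hn : n - 1 < n) {u : EuclideanSpace ℝ (Fin n) → ℝ}
    (hu : ContDiffOn ℝ 2 u (upperHalf n ⟨n - 1, hn⟩)) (x' : EuclideanSpace ℝ (Fin (n - 1)))
    (v : Fin 1 → EuclideanSpace ℝ (Fin (n - 1))) (e : EuclideanSpace ℝ (Fin n)) :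
    iteratedFDerivWithin ℝ 1 (fun x' => fderivWithin ℝ u (upperHalf n ⟨n - 1, hn⟩) (emb n x') e)
      Set.univ x' v
      = iteratedFDerivWithin ℝ 2 u (upperHalf n ⟨n - 1, hn⟩) (emb n x') ![emb n (v 0), e] := by
  have hD := uniqueDiffOn_upperHalf (⟨n - 1, hn⟩ : Fin n)
  have hx := emb_mem_upperHalf hn x'
  have h1 := ((hu.fderivWithin hD (m := 1) (by norm_num)).differentiableOn (by norm_num) _
    hx).hasFDerivWithinAt
  have h2 : HasFDerivWithinAt (emb n) (embIsometry n).toContinuousLinearMap Set.univ x' :=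
    (embIsometry n).toContinuousLinearMap.hasFDerivWithinAt
  have h3 := (h1.comp x' h2 fun y' _ => emb_mem_upperHalf hn y').clm_apply
    (hasFDerivWithinAt_const e x' Set.univ)
  rw [iteratedFDerivWithin_one_apply (uniqueDiffWithinAt_univ),
    iteratedFDerivWithin_two_apply u hD hx]
  simp only [Function.comp_apply] at h3
  rw [h3.fderivWithin uniqueDiffWithinAt_univ]
  simp
  rfl

theorem ContinuousMultilinearMap.abs_apply_two_le {E : Type*} [NormedAddCommGroup E]
    [NormedSpace ℝ E] (T : ContinuousMultilinearMap ℝ (fun _ : Fin 2 => E) ℝ) (a b : E) :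
    |T ![a, b]| ≤ ‖T‖ * (‖a‖ * ‖b‖) := by
  simpa [Fin.prod_univ_two] using T.le_opNorm ![a, b]

theorem ContinuousMultilinearMap.abs_trace_le {n : ℕ}
    (T : ContinuousMultilinearMap ℝ (fun _ : Fin 2 => EuclideanSpace ℝ (Fin n)) ℝ) :
    |∑ i, T ![coordVec i, coordVec i]| ≤ n * ‖T‖ := by
  refine (norm_sum_le_of_le (f := fun i => T ![coordVec i, coordVec i]) (n := fun _ => ‖T‖)
    Finset.univ fun i _ => ?_).trans (by simp)
  simpa [norm_coordVec] using T.abs_apply_two_le (coordVec i) (coordVec i)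

section WeightedHolder

variable {n : ℕ} {hn : n - 1 < n} {α γ : ℝ} {u : EuclideanSpace ℝ (Fin n) → ℝ}

/-- The Laplacian of a weighted `C^{2,α}` function has finite weighted Hölder norm. -/
theorem le_wHolderNorm_lapWithin (hu : WMemHolder n 2 α γ (upperHalf n ⟨n - 1, hn⟩) u) :
    let F := wHolderNorm n 0 α (γ - 2) (upperHalf n ⟨n - 1, hn⟩)
      (lapWithin n (upperHalf n ⟨n - 1, hn⟩) u)
    0 ≤ F ∧
    (∀ x ∈ upperHalf n ⟨n - 1, hn⟩,
      |lapWithin n (upperHalf n ⟨n - 1, hn⟩) u x| ≤ F * (1 + ‖x‖) ^ (γ - 2)) ∧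
    WHolderOn (upperHalf n ⟨n - 1, hn⟩) α γ F (lapWithin n (upperHalf n ⟨n - 1, hn⟩) u) := by
  intro F
  set H := upperHalf n ⟨n - 1, hn⟩
  have hb : ∀ i : ℕ, i ≤ 0 → ∃ M : ℝ, ∀ x ∈ H, (1 + ‖x‖) ^ (-(γ - 2) + (i : ℝ)) *
      ‖iteratedFDerivWithin ℝ i (lapWithin n H u) H x‖ ≤ M := by
    intro i hi
    obtain rfl : i = 0 := by omega
    obtain ⟨M, hM⟩ := hu.1.2 2 le_rfl
    refine ⟨n * M, fun x hx => ?_⟩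
    rw [norm_iteratedFDerivWithin_zero,
      show -(γ - 2) + ((0 : ℕ) : ℝ) = -γ + ((2 : ℕ) : ℝ) by push_cast; ring]
    calc (1 + ‖x‖) ^ (-γ + ((2 : ℕ) : ℝ)) * ‖lapWithin n H u x‖
        ≤ (1 + ‖x‖) ^ (-γ + ((2 : ℕ) : ℝ)) * (n * ‖iteratedFDerivWithin ℝ 2 u H x‖) := by
          gcongr
          exact ContinuousMultilinearMap.abs_trace_le _
      _ = n * ((1 + ‖x‖) ^ (-γ + ((2 : ℕ) : ℝ)) * ‖iteratedFDerivWithin ℝ 2 u H x‖) := by ring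
      _ ≤ n * M := by
          gcongr
          exact hM x hx
  have hh : ∃ M : ℝ, ∀ x ∈ H, ∀ y ∈ H, x ≠ y → dist x y ≤ min (1 + ‖x‖) (1 + ‖y‖) / 2 →
      (min (1 + ‖x‖) (1 + ‖y‖)) ^ (-(γ - 2) + ((0 : ℕ) : ℝ) + α) *
        ‖iteratedFDerivWithin ℝ 0 (lapWithin n H u) H x
          - iteratedFDerivWithin ℝ 0 (lapWithin n H u) H y‖ ≤ M * dist x y ^ α := by
    obtain ⟨M, hM⟩ := hu.2
    refine ⟨n * M, fun x hx y hy hne hxy => ?_⟩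
    rw [norm_iteratedFDerivWithin_zero_sub,
      show -(γ - 2) + ((0 : ℕ) : ℝ) + α = -γ + ((2 : ℕ) : ℝ) + α by push_cast; ring]
    have h1 : |lapWithin n H u x - lapWithin n H u y|
        ≤ n * ‖iteratedFDerivWithin ℝ 2 u H x - iteratedFDerivWithin ℝ 2 u H y‖ := by
      rw [lapWithin, lapWithin, ← Finset.sum_sub_distrib]
      exact ContinuousMultilinearMap.abs_trace_le
        (iteratedFDerivWithin ℝ 2 u H x - iteratedFDerivWithin ℝ 2 u H y)
    calc _ ≤ min (1 + ‖x‖) (1 + ‖y‖) ^ (-γ + ((2 : ℕ) : ℝ) + α) *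
          (n * ‖iteratedFDerivWithin ℝ 2 u H x - iteratedFDerivWithin ℝ 2 u H y‖) := by gcongr
      _ = n * (min (1 + ‖x‖) (1 + ‖y‖) ^ (-γ + ((2 : ℕ) : ℝ) + α) *
          ‖iteratedFDerivWithin ℝ 2 u H x - iteratedFDerivWithin ℝ 2 u H y‖) := by ring
      _ ≤ n * (M * dist x y ^ α) :=
          mul_le_mul_of_nonneg_left (hM x hx y hy hne hxy) (by positivity)
      _ = n * M * dist x y ^ α := by ring
  obtain ⟨h0, h1, h2⟩ := le_wHolderNorm hb hh
  refine ⟨h0, fun x hx => ?_, fun x hx y hy hxy => ?_⟩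
  · simpa using h1 0 le_rfl x hx
  · simpa [norm_iteratedFDerivWithin_zero_sub] using h2 x hx y hy hxy

/-- The Neumann datum of a weighted `C^{2,α}` function has finite weighted Hölder norm. -/
theorem le_wHolderNorm_normal (hu : WMemHolder n 2 α γ (upperHalf n ⟨n - 1, hn⟩) u) :
    let g := fun x' => fderivWithin ℝ u (upperHalf n ⟨n - 1, hn⟩) (emb n x')
      (coordVec ⟨n - 1, hn⟩)
    let G := wHolderNorm (n - 1) 1 α (γ - 1) Set.univ g
    0 ≤ G ∧
    (∀ x', |g x'| ≤ G * (1 + ‖x'‖) ^ (γ - 1)) ∧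
    ∀ x' y', dist x' y' ≤ min (1 + ‖x'‖) (1 + ‖y'‖) / 2 →
      ‖iteratedFDerivWithin ℝ 1 g Set.univ x' - iteratedFDerivWithin ℝ 1 g Set.univ y'‖
        ≤ G * min (1 + ‖x'‖) (1 + ‖y'‖) ^ (γ - 2 - α) * dist x' y' ^ α := by
  intro g G
  have hD : ContDiffOn ℝ 2 u (upperHalf n ⟨n - 1, hn⟩) := hu.1.1
  have hg := fun x' v => iteratedFDerivWithin_one_normal hn hD x' v (coordVec ⟨n - 1, hn⟩)
  have hmem := emb_mem_upperHalf hn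
  change ∀ x' v, iteratedFDerivWithin ℝ 1 g Set.univ x' v = _ at hg
  set H := upperHalf n ⟨n - 1, hn⟩ with hH
  have hb : ∀ i : ℕ, i ≤ 1 → ∃ M : ℝ, ∀ x' ∈ Set.univ, (1 + ‖x'‖) ^ (-(γ - 1) + (i : ℝ)) *
      ‖iteratedFDerivWithin ℝ i g Set.univ x'‖ ≤ M := by
    intro i hi
    obtain ⟨M, hM⟩ := hu.1.2 (i + 1) (by omega)
    refine ⟨M, fun x' _ => le_trans ?_ (hM (emb n x') (hmem x'))⟩
    rw [norm_emb, show -(γ - 1) + (i : ℝ) = -γ + ((i + 1 : ℕ) : ℝ) by push_cast; ring]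
    gcongr
    interval_cases i
    · rw [norm_iteratedFDerivWithin_zero]
      have hd := uniqueDiffOn_upperHalf (⟨n - 1, hn⟩ : Fin n) _ (hmem x')
      rw [zero_add, norm_iteratedFDerivWithin_one u hd]
      simpa [norm_coordVec] using (fderivWithin ℝ u H (emb n x')).le_opNorm (coordVec ⟨n - 1, hn⟩)
    · refine ContinuousMultilinearMap.opNorm_le_bound (norm_nonneg _) fun v => ?_
      rw [hg]
      simpa [norm_coordVec, norm_emb] using ContinuousMultilinearMap.abs_apply_two_le
        (iteratedFDerivWithin ℝ 2 u H (emb n x')) (emb n (v 0)) (coordVec ⟨n - 1, hn⟩)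
  have hh : ∃ M : ℝ, ∀ x' ∈ Set.univ, ∀ y' ∈ Set.univ, x' ≠ y' →
      dist x' y' ≤ min (1 + ‖x'‖) (1 + ‖y'‖) / 2 →
      (min (1 + ‖x'‖) (1 + ‖y'‖)) ^ (-(γ - 1) + ((1 : ℕ) : ℝ) + α) *
        ‖iteratedFDerivWithin ℝ 1 g Set.univ x' - iteratedFDerivWithin ℝ 1 g Set.univ y'‖
        ≤ M * dist x' y' ^ α := by
    obtain ⟨M, hM⟩ := hu.2
    refine ⟨M, fun x' _ y' _ hne hxy => ?_⟩
    have h1 := hM (emb n x') (hmem x') (emb n y') (hmem y')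
      ((embIsometry n).injective.ne hne) (by rwa [dist_emb, norm_emb, norm_emb])
    rw [dist_emb, norm_emb, norm_emb] at h1
    refine le_trans ?_ h1
    rw [show -(γ - 1) + ((1 : ℕ) : ℝ) + α = -γ + ((2 : ℕ) : ℝ) + α by push_cast; ring]
    gcongr
    refine ContinuousMultilinearMap.opNorm_le_bound (norm_nonneg _) fun v => ?_
    rw [sub_apply, hg, hg]
    simpa [norm_coordVec, norm_emb] using ContinuousMultilinearMap.abs_apply_two_le
      (iteratedFDerivWithin ℝ 2 u H (emb n x') - iteratedFDerivWithin ℝ 2 u H (emb n y'))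
      (emb n (v 0)) (coordVec ⟨n - 1, hn⟩)
  obtain ⟨h0, h1, h2⟩ := le_wHolderNorm hb hh
  refine ⟨h0, fun x' => ?_, fun x' y' hxy => ?_⟩
  · simpa using h1 0 zero_le_one x' trivial
  · have := h2 x' trivial y' trivial hxy
    rwa [show γ - 1 - ((1 : ℕ) : ℝ) - α = γ - 2 - α by push_cast; ring] at this

theorem weightedData_of_wMemHolder (hu : WMemHolder n 2 α γ (upperHalf n ⟨n - 1, hn⟩) u) :
    WeightedData ⟨n - 1, hn⟩ α γ u
      (fun i x => fderivWithin ℝ u (upperHalf n ⟨n - 1, hn⟩) x (coordVec i))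
      (fun i j x => fderivWithin ℝ (fderivWithin ℝ u (upperHalf n ⟨n - 1, hn⟩))
        (upperHalf n ⟨n - 1, hn⟩) x (coordVec i) (coordVec j))
      (wHolderNorm n 2 α γ (upperHalf n ⟨n - 1, hn⟩) u)
      (wHolderNorm n 0 α (γ - 2) (upperHalf n ⟨n - 1, hn⟩)
        (lapWithin n (upperHalf n ⟨n - 1, hn⟩) u))
      (wHolderNorm (n - 1) 1 α (γ - 1) Set.univ
        fun x' => fderivWithin ℝ u (upperHalf n ⟨n - 1, hn⟩) (emb n x')
          (coordVec ⟨n - 1, hn⟩)) := by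
  have hD : ContDiffOn ℝ 2 u (upperHalf n ⟨n - 1, hn⟩) := hu.1.1
  obtain ⟨hU0, -, hU⟩ := le_wHolderNorm hu.1.2 hu.2
  obtain ⟨hF0, hF1, hF2⟩ := le_wHolderNorm_lapWithin hu
  obtain ⟨hG0, hG1, hG2⟩ := le_wHolderNorm_normal hu
  have hud := uniqueDiffOn_upperHalf (⟨n - 1, hn⟩ : Fin n)
  have hmem := emb_mem_upperHalf hn
  have hg := fun x' v => iteratedFDerivWithin_one_normal hn hD x' v (coordVec ⟨n - 1, hn⟩)
  set H := upperHalf n ⟨n - 1, hn⟩ with hH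
  have hP : ∀ i j, ∀ x ∈ H, fderivWithin ℝ (fderivWithin ℝ u H) H x (coordVec i) (coordVec j)
      = iteratedFDerivWithin ℝ 2 u H x ![coordVec i, coordVec j] := fun i j x hx => by
    rw [iteratedFDerivWithin_two_apply u hud hx]
    rfl
  have hlap : ∀ x ∈ H, ∑ i, fderivWithin ℝ (fderivWithin ℝ u H) H x (coordVec i) (coordVec i)
      = lapWithin n H u x := fun x hx => Finset.sum_congr rfl fun i _ => hP i i x hx
  refine ⟨hasSecondPartials_of_contDiffOn hD, fun i j x hx y hy hxy => ?_, fun x hx => ?_,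
    fun x hx y hy hxy => ?_, fun x hx => ?_, fun j hj x hx y hy hxy => ?_, hU0, hF0, hG0⟩
  · rw [hP i j x hx, hP i j y hy, ← sub_apply]
    refine le_trans ?_ (hU x hx y hy hxy)
    simpa [norm_coordVec] using ContinuousMultilinearMap.abs_apply_two_le
      (iteratedFDerivWithin ℝ 2 u H x - iteratedFDerivWithin ℝ 2 u H y) (coordVec i) (coordVec j)
  · rw [hlap x hx]
    exact hF1 x hx
  · simp only [hlap x hx, hlap y hy]
    exact hF2 x hx y hy hxy
  · obtain ⟨x', rfl⟩ := exists_emb_eq hx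
    rw [norm_emb]
    exact hG1 x'
  · obtain ⟨x', rfl⟩ := exists_emb_eq hx
    obtain ⟨y', rfl⟩ := exists_emb_eq hy
    obtain ⟨i, rfl⟩ := eq_castLE_of_ne_last hj
    rw [dist_emb, norm_emb, norm_emb] at hxy ⊢
    rw [hP _ _ _ (hmem x'), hP _ _ _ (hmem y'), ← emb_coordVec]
    refine le_trans ?_ (hG2 x' y' hxy)
    have h1 := (iteratedFDerivWithin ℝ 1 (fun x' => fderivWithin ℝ u H (emb n x')
        (coordVec ⟨n - 1, hn⟩)) Set.univ x' - iteratedFDerivWithin ℝ 1 (fun x' =>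
        fderivWithin ℝ u H (emb n x') (coordVec ⟨n - 1, hn⟩)) Set.univ y').le_opNorm
        fun _ => coordVec i
    rw [sub_apply, hg, hg] at h1
    simpa [norm_coordVec] using h1

end WeightedHolder

/-- the global weighted Schauder estimate: for `n ≥ 3`, `0 < α < 1` and
`2 - n < γ < 0` there is `C = C(n, α, γ) > 0` with
`‖u‖_{C^{2,α}_γ(ℝⁿ₊)} ≤ C ‖Δu‖_{C^{0,α}_{γ-2}(ℝⁿ₊)} + C ‖∂u/∂xₙ‖_{C^{1,α}_{γ-1}(∂ℝⁿ₊)}`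
for every `u ∈ C^{2,α}_γ(ℝⁿ₊)`. -/
theorem stmt_7 (n : ℕ) (hn : 3 ≤ n) (α γ : ℝ) (hα₁ : 0 < α) (hα₂ : α < 1)
    (hγ₁ : 2 - (n : ℝ) < γ) (hγ₂ : γ < 0) :
    ∃ C : ℝ, 0 < C ∧
      ∀ u : EuclideanSpace ℝ (Fin n) → ℝ,
        WMemHolder n 2 α γ (upperHalf n ⟨n - 1, by omega⟩) u →
          wHolderNorm n 2 α γ (upperHalf n ⟨n - 1, by omega⟩) u ≤
            C * wHolderNorm n 0 α (γ - 2) (upperHalf n ⟨n - 1, by omega⟩)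
                (lapWithin n (upperHalf n ⟨n - 1, by omega⟩) u) +
            C * wHolderNorm (n - 1) 1 α (γ - 1) Set.univ
                (fun x' => fderivWithin ℝ u (upperHalf n ⟨n - 1, by omega⟩) (emb n x')
                  (EuclideanSpace.single ⟨n - 1, by omega⟩ 1)) := by
  obtain ⟨C, hC, hmain⟩ :=
    exists_weighted_schauder (⟨n - 1, by omega⟩ : Fin n) hα₁ hα₂ hγ₁ hγ₂
  refine ⟨4 * n ^ 2 * C + 1, by positivity, fun u hu => ?_⟩
  have hdata := weightedData_of_wMemHolder hu
  obtain ⟨-, hU, -⟩ := le_wHolderNorm hu.1.2 hu.2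
  obtain ⟨h0, h1, h2, h3⟩ := hmain _ _ _ (wHolderNorm n 2 α γ (upperHalf n ⟨n - 1, by omega⟩) u)
    _ _ _ hdata fun x hx => by simpa using hU 0 (by norm_num) x hx
  obtain ⟨-, hF0, hG0⟩ := hdata.nonneg
  have hud := uniqueDiffOn_upperHalf (⟨n - 1, by omega⟩ : Fin n)
  simp only [coordVec] at h0 h1 h2 h3 hG0
  set H := upperHalf n ⟨n - 1, by omega⟩
  set F := wHolderNorm n 0 α (γ - 2) H (lapWithin n H u)
  set G := wHolderNorm (n - 1) 1 α (γ - 1) Set.univ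
    (fun x' => fderivWithin ℝ u H (emb n x') (EuclideanSpace.single ⟨n - 1, by omega⟩ 1))
  have hn1 : (1 : ℝ) ≤ n := by exact_mod_cast (by omega : 1 ≤ n)
  have hA : 0 ≤ C * (F + G) := by positivity
  have hpow : ∀ i, i ≤ 2 → (n : ℝ) ^ i * (C * (F + G)) ≤ n ^ 2 * (C * (F + G)) := fun i hi => by
    gcongr
  have hP : ∀ (s : Fin 2 → Fin n), ∀ x ∈ H,
      (iteratedFDerivWithin ℝ 2 u H x fun a => coordVec (s a))
      = fderivWithin ℝ (fderivWithin ℝ u H) H x (EuclideanSpace.single (s 0) 1)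
        (EuclideanSpace.single (s 1) 1) := fun s x hx => by
    rw [iteratedFDerivWithin_two_apply u hud hx]
    rfl
  have hle : wHolderNorm n 2 α γ H u ≤ ((2 : ℕ) + 2) * (n ^ 2 * (C * (F + G))) := by
    refine wHolderNorm_le (by positivity) (fun i hi x hx => ?_) fun x hx y hy hxy => ?_
    · have hb : ‖iteratedFDerivWithin ℝ i u H x‖
          ≤ n ^ i * (C * (F + G) * (1 + ‖x‖) ^ (γ - (i : ℝ))) := by
        refine ContinuousMultilinearMap.opNorm_le_of_coordVec (by positivity) _ fun s => ?_
        interval_cases i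
        · simpa using h0 x hx
        · rw [iteratedFDerivWithin_one_apply (hud x hx), Nat.cast_one]
          exact h1 (s 0) x hx
        · rw [hP s x hx]
          exact h2 (s 0) (s 1) x hx
      rw [← mul_assoc] at hb
      refine hb.trans ?_
      gcongr ?_ * _
      exact hpow i hi
    · rw [mul_assoc, mul_assoc]
      refine ContinuousMultilinearMap.opNorm_le_of_coordVec (by positivity) _ fun s => ?_
      rw [sub_apply, hP s x hx, hP s y hy, ← mul_assoc]
      exact h3 (s 0) (s 1) x hx y hy hxy
  push_cast at hle
  linarith
end
end

section
/- Let n ≥ 3, q > n and β ∈ ℝ. There exists a constant C > 0, depending only on n, q and β, such that every continuously differentiable function u : ℝⁿ₊ → ℝ satisfies sup_{x ∈ ℝⁿ₊} ρ(x)^{−β} |u(x)| ≤ C ( ∫_{ℝⁿ₊} ( ρ(x)^{−β} |u(x)| )^q ρ(x)^{−n} dx )^{1/q} + C ( ∫_{ℝⁿ₊} ( ρ(x)^{−β+1} |∇u(x)| )^q ρ(x)^{−n} dx )^{1/q}, the inequality being understood in the extended reals. -/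
open MeasureTheory Metric Filter
open scoped ENNReal Topology

noncomputable section

theorem rpow_le_two_rpow_abs_mul_rpow {r s : ℝ} (hr : 0 < r) (h₁ : r / 2 ≤ s) (h₂ : s ≤ 2 * r)
    (γ : ℝ) : r ^ γ ≤ 2 ^ |γ| * s ^ γ := by
  have hs : 0 < s := by linarith
  rcases le_total 0 γ with hγ | hγ
  · rw [abs_of_nonneg hγ, ← Real.mul_rpow zero_le_two hs.le]
    exact Real.rpow_le_rpow hr.le (by linarith) hγ
  · have h : (2 : ℝ) ^ |γ| = 2⁻¹ ^ γ := by
      rw [abs_of_nonpos hγ, Real.inv_rpow zero_le_two, Real.rpow_neg zero_le_two]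
    rw [h, ← Real.mul_rpow (by norm_num) hs.le]
    exact Real.rpow_le_rpow_of_nonpos (by linarith) (by linarith) hγ

theorem enorm_sub_le_lintegral_fderivWithin {E : Type*} [NormedAddCommGroup E]
    [NormedSpace ℝ E] {H : Set E} (hc : Convex ℝ H) {u : E → ℝ} (hu : ContDiffOn ℝ 1 u H) {x v : E}
    (hx : x ∈ H) (hxv : x + v ∈ H) :
    ‖u (x + v) - u x‖ₑ ≤ ∫⁻ t in Set.Icc (0 : ℝ) 1, ‖v‖ₑ * ‖fderivWithin ℝ u H (x + t • v)‖ₑ := by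
  have hmaps : Set.MapsTo (fun t : ℝ => x + t • v) (Set.Icc 0 1) H := fun t ht =>
    hc.add_smul_mem hx hxv ht
  have hγ : ContDiff ℝ 1 (fun t : ℝ => x + t • v) := by fun_prop
  have h := enorm_sub_le_lintegral_derivWithin_Icc_of_contDiffOn_Icc
    (hu.comp hγ.contDiffOn hmaps) zero_le_one
  simp only [Function.comp_apply, one_smul, zero_smul, add_zero] at h
  refine h.trans (setLIntegral_mono' measurableSet_Icc fun t ht => ?_)
  have hd : HasDerivWithinAt (fun t : ℝ => x + t • v) v (Set.Icc 0 1) t := by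
    simpa using (((hasDerivAt_id t).smul_const v).const_add x).hasDerivWithinAt
  have hfd := ((hu.differentiableOn one_ne_zero _ (hmaps ht)).hasFDerivWithinAt).comp_hasDerivWithinAt
    t hd hmaps
  rw [hfd.derivWithin (uniqueDiffOn_Icc zero_lt_one t ht), mul_comm]
  exact ContinuousLinearMap.le_opENorm _ _

section Haar

variable {E : Type*} [NormedAddCommGroup E] [NormedSpace ℝ E] [FiniteDimensional ℝ E]
  [MeasurableSpace E] [BorelSpace E]

theorem lintegral_comp_add_smul (μ : Measure E) [μ.IsAddHaarMeasure] {h : E → ℝ≥0∞}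
    (hh : Measurable h) (x : E) {r : ℝ} (hr : 0 < r) :
    ∫⁻ w, h (x + r • w) ∂μ =
      ENNReal.ofReal (r ^ (-(Module.finrank ℝ E : ℝ))) * ∫⁻ z, h z ∂μ := by
  have h₁ := lintegral_map (μ := μ) (f := fun z => h (x + z)) (g := fun w => r • w)
    (hh.comp (measurable_const_add x)) (measurable_const_smul r)
  rw [← h₁, Measure.map_addHaar_smul μ hr.ne', lintegral_smul_measure,
    lintegral_add_left_eq_self (μ := μ) h x, Real.rpow_neg hr.le, Real.rpow_natCast,
    abs_of_pos (by positivity), smul_eq_mul]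

/-- The weighted `L^q` norm on `H` of a function with values in `ℝ≥0∞`. -/
def weightedNorm (μ : Measure E) (H : Set E) (q γ : ℝ) (f : E → ℝ≥0∞) : ℝ≥0∞ :=
  (∫⁻ z in H, (ENNReal.ofReal ((1 + ‖z‖) ^ γ) * f z) ^ q *
    ENNReal.ofReal ((1 + ‖z‖) ^ (-(Module.finrank ℝ E : ℝ))) ∂μ) ^ (1 / q)

theorem setLIntegral_comp_add_smul_le_weightedNorm (μ : Measure E) [μ.IsAddHaarMeasure]
    {H K : Set E} (hH : MeasurableSet H) (hK : MeasurableSet K) (hKb : K ⊆ closedBall 0 (1 / 2))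
    {q : ℝ} (hq : 1 < q) (γ : ℝ) {f : E → ℝ≥0∞} (hf : Measurable f) {x : E} {t : ℝ}
    (ht : 0 < t) (ht1 : t ≤ 1) (hxK : ∀ w ∈ K, x + (t * (1 + ‖x‖)) • w ∈ H) :
    ∫⁻ w in K, ENNReal.ofReal ((1 + ‖x‖) ^ γ) * f (x + (t * (1 + ‖x‖)) • w) ∂μ ≤
      ENNReal.ofReal (2 ^ (|γ| + Module.finrank ℝ E / q)) * μ K ^ (1 - 1 / q) *
        ENNReal.ofReal (t ^ (-(Module.finrank ℝ E / q))) * weightedNorm μ H q γ f := by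
  have hq0 : 0 < q := by linarith
  set d : ℝ := (Module.finrank ℝ E : ℝ) with hd
  have hd0 : 0 ≤ d := Nat.cast_nonneg _
  set R : ℝ := 1 + ‖x‖ with hR
  have hR0 : 0 < R := by positivity
  let ρ : E → ℝ := fun z => 1 + ‖z‖
  have hρ0 : ∀ z, 0 < ρ z := fun z => by positivity
  let F : E → ℝ≥0∞ := fun z =>
    ENNReal.ofReal (ρ z ^ γ) * f z * ENNReal.ofReal (ρ z ^ (-(d / q)))
  have hFm : Measurable F := by
    have : Measurable ρ := by fun_prop
    fun_prop
  have hFq : ∀ z, F z ^ q = (ENNReal.ofReal (ρ z ^ γ) * f z) ^ q * ENNReal.ofReal (ρ z ^ (-d)) := by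
    intro z
    simp only [F]
    rw [ENNReal.mul_rpow_of_nonneg _ _ hq0.le,
      ENNReal.ofReal_rpow_of_nonneg (Real.rpow_nonneg (hρ0 z).le _) hq0.le,
      ← Real.rpow_mul (hρ0 z).le]
    congr 4
    field_simp
  have hpt : ∀ w ∈ K, ENNReal.ofReal (R ^ γ) * f (x + (t * R) • w) ≤
      ENNReal.ofReal (2 ^ (|γ| + d / q) * R ^ (d / q)) * F (x + (t * R) • w) := by
    intro w hw
    have hw' : ‖w‖ ≤ 1 / 2 := by simpa using hKb hw
    have hn : ‖(t * R) • w‖ ≤ R / 2 := by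
      rw [norm_smul, Real.norm_of_nonneg (by positivity)]
      have : t * R ≤ 1 * R := by gcongr
      nlinarith [norm_nonneg w]
    set z := x + (t * R) • w
    have h₁ : R / 2 ≤ ρ z := by
      have : ‖x‖ ≤ ‖z‖ + ‖(t * R) • w‖ := by
        simpa [z] using norm_sub_le z ((t * R) • w)
      simp only [ρ]; linarith
    have h₂ : ρ z ≤ 2 * R := by
      have := norm_add_le x ((t * R) • w)
      simp only [ρ, z]; linarith
    have e₁ := rpow_le_two_rpow_abs_mul_rpow hR0 h₁ h₂ γ
    have e₂ := rpow_le_two_rpow_abs_mul_rpow hR0 h₁ h₂ (-(d / q))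
    rw [abs_neg, abs_of_nonneg (div_nonneg hd0 hq0.le)] at e₂
    have e₃ : R ^ γ ≤ 2 ^ (|γ| + d / q) * R ^ (d / q) * (ρ z ^ γ * ρ z ^ (-(d / q))) := by
      calc R ^ γ = R ^ γ * R ^ (-(d / q)) * R ^ (d / q) := by
            rw [mul_assoc, ← Real.rpow_add hR0]; simp
        _ ≤ (2 ^ |γ| * ρ z ^ γ) * (2 ^ (d / q) * ρ z ^ (-(d / q))) * R ^ (d / q) := by gcongr
        _ = _ := by rw [Real.rpow_add two_pos]; ring
    calc ENNReal.ofReal (R ^ γ) * f z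
        ≤ ENNReal.ofReal (2 ^ (|γ| + d / q) * R ^ (d / q) * (ρ z ^ γ * ρ z ^ (-(d / q)))) * f z := by
          gcongr
      _ = _ := by
          have := hρ0 z
          rw [ENNReal.ofReal_mul (by positivity), ENNReal.ofReal_mul (p := ρ z ^ γ) (by positivity)]
          simp only [F]
          ring
  have hholder : ∫⁻ w in K, F (x + (t * R) • w) ∂μ ≤
      (∫⁻ w in K, F (x + (t * R) • w) ^ q ∂μ) ^ (1 / q) * μ K ^ (1 - 1 / q) := by
    have hpq := Real.HolderConjugate.conjExponent hq
    have := ENNReal.lintegral_mul_le_Lp_mul_Lq (μ.restrict K) hpq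
      (f := fun w => F (x + (t * R) • w)) (g := fun _ => 1)
      (hFm.comp (by fun_prop)).aemeasurable aemeasurable_const
    have hc : 1 / Real.conjExponent q = 1 - 1 / q := by
      have := hpq.inv_add_inv_eq_one
      simp only [one_div]; linarith
    simpa [hc] using this
  have hchange : ∫⁻ w in K, F (x + (t * R) • w) ^ q ∂μ ≤
      ENNReal.ofReal ((t * R) ^ (-d)) * ∫⁻ z in H, F z ^ q ∂μ := by
    rw [← lintegral_indicator hH, ← lintegral_comp_add_smul μ
      ((hFm.pow_const q).indicator hH) x (by positivity : 0 < t * R)]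
    refine le_trans (setLIntegral_mono' hK fun w hw => ?_) (setLIntegral_le_lintegral K _)
    rw [Set.indicator_of_mem (hxK w hw)]
  calc ∫⁻ w in K, ENNReal.ofReal (R ^ γ) * f (x + (t * R) • w) ∂μ
      ≤ ∫⁻ w in K, ENNReal.ofReal (2 ^ (|γ| + d / q) * R ^ (d / q)) * F (x + (t * R) • w) ∂μ :=
        setLIntegral_mono' hK hpt
    _ = ENNReal.ofReal (2 ^ (|γ| + d / q) * R ^ (d / q)) * ∫⁻ w in K, F (x + (t * R) • w) ∂μ :=
        lintegral_const_mul' _ _ ENNReal.ofReal_ne_top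
    _ ≤ ENNReal.ofReal (2 ^ (|γ| + d / q) * R ^ (d / q)) *
          ((ENNReal.ofReal ((t * R) ^ (-d)) * ∫⁻ z in H, F z ^ q ∂μ) ^ (1 / q) *
            μ K ^ (1 - 1 / q)) := by
        gcongr
        refine hholder.trans ?_
        gcongr
    _ = _ := by
        have hw : (∫⁻ z in H, F z ^ q ∂μ) ^ (1 / q) = weightedNorm μ H q γ f := by
          simp only [hFq]; rfl
        rw [ENNReal.mul_rpow_of_nonneg _ _ (by positivity), hw,
          ENNReal.ofReal_rpow_of_nonneg (by positivity) (by positivity),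
          ← Real.rpow_mul (by positivity), show -d * (1 / q) = -(d / q) by ring,
          Real.mul_rpow ht.le hR0.le, ENNReal.ofReal_mul (by positivity),
          ENNReal.ofReal_mul (by positivity)]
        have : ENNReal.ofReal (R ^ (d / q)) * ENNReal.ofReal (R ^ (-(d / q))) = 1 := by
          rw [← ENNReal.ofReal_mul (by positivity), ← Real.rpow_add hR0]; simp
        calc _ = (ENNReal.ofReal (R ^ (d / q)) * ENNReal.ofReal (R ^ (-(d / q)))) *
              (ENNReal.ofReal (2 ^ (|γ| + d / q)) * μ K ^ (1 - 1 / q) *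
              ENNReal.ofReal (t ^ (-(d / q))) * weightedNorm μ H q γ f) := by ring
          _ = _ := by rw [this, one_mul]

/-- Weighted Morrey inequality on a closed convex cone. -/
theorem exists_forall_le_weightedNorm_add (μ : Measure E) [μ.IsAddHaarMeasure] {H : Set E}
    (hHc : IsClosed H) (hadd : ∀ x ∈ H, ∀ y ∈ H, x + y ∈ H)
    (hsmul : ∀ c : ℝ, 0 ≤ c → ∀ x ∈ H, c • x ∈ H)
    (hint : (interior (H ∩ closedBall 0 (1 / 2))).Nonempty) {q : ℝ} (hq1 : 1 < q)
    (hq : (Module.finrank ℝ E : ℝ) < q) (β : ℝ) :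
    ∃ C : ℝ, 0 < C ∧ ∀ u : E → ℝ, ContDiffOn ℝ 1 u H → ∀ x ∈ H,
      ENNReal.ofReal ((1 + ‖x‖) ^ (-β)) * ‖u x‖ₑ ≤
        ENNReal.ofReal C * weightedNorm μ H q (-β) (fun z => ‖u z‖ₑ) +
          ENNReal.ofReal C *
            weightedNorm μ H q (-β + 1) (fun z => ‖fderivWithin ℝ u H z‖ₑ) := by
  classical
  set d : ℝ := (Module.finrank ℝ E : ℝ) with hd
  set K : Set E := H ∩ closedBall 0 (1 / 2) with hKdef
  have hH : MeasurableSet H := hHc.measurableSet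
  have hK : MeasurableSet K := hH.inter measurableSet_closedBall
  have hKb : K ⊆ closedBall 0 (1 / 2) := Set.inter_subset_right
  have hK0 : μ K ≠ 0 := (Measure.measure_pos_of_nonempty_interior μ hint).ne'
  have hKtop : μ K ≠ ∞ := ((measure_mono hKb).trans_lt measure_closedBall_lt_top).ne
  have hHi : (interior H).Nonempty := hint.mono (interior_mono Set.inter_subset_left)
  have hconv : Convex ℝ H := fun x hx y hy a b ha hb _ =>
    hadd _ (hsmul a ha x hx) _ (hsmul b hb y hy)
  have hq1' : 0 ≤ 1 - 1 / q := by
    rw [sub_nonneg, div_le_one (by linarith)]; exact hq1.le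
  have hMtop : μ K ^ (1 - 1 / q) ≠ ∞ := ENNReal.rpow_ne_top_of_nonneg hq1' hKtop
  let T : ℝ≥0∞ := ∫⁻ t in Set.Ioc (0 : ℝ) 1, ENNReal.ofReal (t ^ (-(d / q)))
  have hT : T ≠ ∞ := by
    have hint' : IntervalIntegrable (fun t : ℝ => t ^ (-(d / q))) volume 0 1 :=
      intervalIntegral.intervalIntegrable_rpow' (by
        rw [neg_lt_neg_iff, div_lt_one (by linarith)]; exact hq)
    rw [intervalIntegrable_iff_integrableOn_Ioc_of_le zero_le_one] at hint'
    exact hint'.lintegral_lt_top.ne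
  let A : ℝ≥0∞ := ENNReal.ofReal (2 ^ (|-β| + d / q)) * μ K ^ (1 - 1 / q)
  let B : ℝ≥0∞ := ENNReal.ofReal (2 ^ (|-β + 1| + d / q)) * μ K ^ (1 - 1 / q)
  have hA : A ≠ ∞ := ENNReal.mul_ne_top ENNReal.ofReal_ne_top hMtop
  have hB : B ≠ ∞ := ENNReal.mul_ne_top ENNReal.ofReal_ne_top hMtop
  let D : ℝ≥0∞ := (μ K)⁻¹ * (A + B * T)
  have hD : D ≠ ∞ := ENNReal.mul_ne_top (ENNReal.inv_ne_top.2 hK0)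
    (ENNReal.add_ne_top.2 ⟨hA, ENNReal.mul_ne_top hB hT⟩)
  refine ⟨D.toReal + 1, by positivity, fun u hu x hx => ?_⟩
  have hDle : D ≤ ENNReal.ofReal (D.toReal + 1) := by
    rw [← ENNReal.ofReal_toReal hD]
    exact ENNReal.ofReal_le_ofReal (by simp)
  set R : ℝ := 1 + ‖x‖ with hR
  have hR0 : 0 < R := by positivity
  have hmem : ∀ t : ℝ, 0 ≤ t → ∀ w ∈ K, x + (t * R) • w ∈ H := fun t ht w hw =>
    hadd _ hx _ (hsmul _ (by positivity) _ hw.1)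
  let f : E → ℝ≥0∞ := H.piecewise (fun z => ‖u z‖ₑ) 0
  let g : E → ℝ≥0∞ := H.piecewise (fun z => ‖fderivWithin ℝ u H z‖ₑ) 0
  have hf : Measurable f :=
    ContinuousOn.measurable_piecewise hu.continuousOn.enorm continuousOn_const hH
  have hg : Measurable g :=
    ContinuousOn.measurable_piecewise
      (hu.continuousOn_fderivWithin (uniqueDiffOn_convex hconv hHi) le_rfl).enorm
      continuousOn_const hH
  have hfw : weightedNorm μ H q (-β) f = weightedNorm μ H q (-β) (fun z => ‖u z‖ₑ) := by
    unfold weightedNorm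
    congr 1
    exact setLIntegral_congr_fun hH fun z hz => by simp [f, hz]
  have hgw : weightedNorm μ H q (-β + 1) g =
      weightedNorm μ H q (-β + 1) (fun z => ‖fderivWithin ℝ u H z‖ₑ) := by
    unfold weightedNorm
    congr 1
    exact setLIntegral_congr_fun hH fun z hz => by simp [g, hz]
  have hpt : ∀ w ∈ K, ENNReal.ofReal (R ^ (-β)) * ‖u x‖ₑ ≤
      ENNReal.ofReal (R ^ (-β)) * f (x + (1 * R) • w) +
        ∫⁻ t in Set.Ioc (0 : ℝ) 1, ENNReal.ofReal (R ^ (-β + 1)) * g (x + (t * R) • w) := by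
    intro w hw
    have hw' : ‖w‖ ≤ 1 / 2 := by simpa using hKb hw
    have hxw : x + R • w ∈ H := by simpa using hmem 1 zero_le_one w hw
    have h₁ := enorm_sub_le_lintegral_fderivWithin hconv hu hx hxw
    have h₂ : ‖u x‖ₑ ≤ ‖u (x + R • w)‖ₑ + ‖u (x + R • w) - u x‖ₑ := by
      calc ‖u x‖ₑ = ‖u (x + R • w) - (u (x + R • w) - u x)‖ₑ := by congr 1; ring
        _ ≤ _ := enorm_sub_le
    have h₃ : ‖R • w‖ₑ ≤ ENNReal.ofReal R := by
      rw [← ofReal_norm, norm_smul, Real.norm_of_nonneg hR0.le]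
      exact ENNReal.ofReal_le_ofReal (by nlinarith)
    have hfv : f (x + (1 * R) • w) = ‖u (x + R • w)‖ₑ := by simp [f, hxw]
    rw [hfv, lintegral_const_mul' _ _ ENNReal.ofReal_ne_top, Real.rpow_add hR0, Real.rpow_one,
      ENNReal.ofReal_mul (by positivity), mul_assoc, ← mul_add,
      ← lintegral_const_mul' _ _ ENNReal.ofReal_ne_top]
    gcongr
    refine h₂.trans ?_
    gcongr
    refine h₁.trans ?_
    rw [← restrict_Ioc_eq_restrict_Icc]
    refine setLIntegral_mono' measurableSet_Ioc fun t ht => ?_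
    have hgv : g (x + (t * R) • w) = ‖fderivWithin ℝ u H (x + t • R • w)‖ₑ := by
      have := hmem t ht.1.le w hw
      simp only [g, Set.piecewise_eq_of_mem _ _ _ this, smul_smul]
    rw [hgv]
    gcongr
  have hint_le : μ K * (ENNReal.ofReal (R ^ (-β)) * ‖u x‖ₑ) ≤
      A * weightedNorm μ H q (-β) f + B * T * weightedNorm μ H q (-β + 1) g := by
    calc μ K * (ENNReal.ofReal (R ^ (-β)) * ‖u x‖ₑ)
        = ∫⁻ w in K, ENNReal.ofReal (R ^ (-β)) * ‖u x‖ₑ ∂μ := by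
          rw [setLIntegral_const, mul_comm]
      _ ≤ ∫⁻ w in K, (ENNReal.ofReal (R ^ (-β)) * f (x + (1 * R) • w) +
            ∫⁻ t in Set.Ioc (0 : ℝ) 1, ENNReal.ofReal (R ^ (-β + 1)) * g (x + (t * R) • w)) ∂μ :=
          setLIntegral_mono' hK hpt
      _ = (∫⁻ w in K, ENNReal.ofReal (R ^ (-β)) * f (x + (1 * R) • w) ∂μ) +
            ∫⁻ t in Set.Ioc (0 : ℝ) 1, ∫⁻ w in K,
              ENNReal.ofReal (R ^ (-β + 1)) * g (x + (t * R) • w) ∂μ := by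
          rw [lintegral_add_left (by fun_prop), lintegral_lintegral_swap]
          refine Measurable.aemeasurable ?_
          simp only [Function.uncurry_def]
          fun_prop
      _ ≤ A * weightedNorm μ H q (-β) f + ∫⁻ t in Set.Ioc (0 : ℝ) 1,
            B * weightedNorm μ H q (-β + 1) g * ENNReal.ofReal (t ^ (-(d / q))) := by
          gcongr ?_ + ?_
          · have := setLIntegral_comp_add_smul_le_weightedNorm μ hH hK hKb hq1 (-β) hf
              zero_lt_one le_rfl (hmem 1 zero_le_one)
            simpa only [Real.one_rpow, ENNReal.ofReal_one, mul_one] using this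
          · refine setLIntegral_mono' measurableSet_Ioc fun t ht => ?_
            exact (setLIntegral_comp_add_smul_le_weightedNorm μ hH hK hKb hq1 (-β + 1) hg
              ht.1 ht.2 (hmem t ht.1.le)).trans_eq (mul_right_comm _ _ _)
      _ = _ := by
          rw [lintegral_const_mul _ (by fun_prop)]
          ring
  rw [← hfw, ← hgw]
  calc ENNReal.ofReal (R ^ (-β)) * ‖u x‖ₑ
      = (μ K)⁻¹ * (μ K * (ENNReal.ofReal (R ^ (-β)) * ‖u x‖ₑ)) := by
        rw [← mul_assoc, ENNReal.inv_mul_cancel hK0 hKtop, one_mul]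
    _ ≤ (μ K)⁻¹ * (A * weightedNorm μ H q (-β) f +
          B * T * weightedNorm μ H q (-β + 1) g) := by gcongr
    _ ≤ (μ K)⁻¹ * ((A + B * T) * weightedNorm μ H q (-β) f +
          (A + B * T) * weightedNorm μ H q (-β + 1) g) := by
        gcongr
        · exact le_self_add
        · exact le_add_self
    _ = D * weightedNorm μ H q (-β) f + D * weightedNorm μ H q (-β + 1) g := by
        simp only [D]; ring
    _ ≤ _ := by gcongr

end Haar

theorem nonempty_interior_upperHalf_inter_closedBall (n : ℕ) (k : Fin n) :
    (interior (upperHalf n k ∩ closedBall 0 (1 / 2))).Nonempty := by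
  have hopen : IsOpen ({x : EuclideanSpace ℝ (Fin n) | 0 < x k} ∩ ball 0 (1 / 2)) :=
    (isOpen_lt continuous_const (by fun_prop)).inter isOpen_ball
  refine ⟨EuclideanSpace.single k (1 / 4), interior_maximal ?_ hopen ⟨?_, ?_⟩⟩
  · exact Set.inter_subset_inter (fun x (hx : 0 < x k) => hx.le) ball_subset_closedBall
  · simp
  · simp only [mem_ball_zero_iff, PiLp.norm_single]
    norm_num

/-- the weighted Sobolev–Morrey embedding `L^q_{1,β}(ℝⁿ₊) ⊂ C⁰_β(ℝⁿ₊)` for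
`q > n`: there is `C = C(n, q, β) > 0` such that every `C¹` function `u` on `ℝⁿ₊` satisfies
`sup ρ^{-β}|u| ≤ C ‖u‖_{q,0,β} + C ‖∇u‖_{q,0,β-1}`, the inequality understood in `ℝ≥0∞`. -/
theorem stmt_14 (n : ℕ) (hn : 3 ≤ n) (q β : ℝ) (hq : (n : ℝ) < q) :
    ∃ C : ℝ, 0 < C ∧
      ∀ u : EuclideanSpace ℝ (Fin n) → ℝ,
        ContDiffOn ℝ 1 u (upperHalf n ⟨n - 1, by omega⟩) →
        ∀ x ∈ upperHalf n ⟨n - 1, by omega⟩,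
          ENNReal.ofReal ((1 + ‖x‖) ^ (-β) * |u x|) ≤
            ENNReal.ofReal C *
              (∫⁻ z in upperHalf n ⟨n - 1, by omega⟩,
                (ENNReal.ofReal ((1 + ‖z‖) ^ (-β) * |u z|)) ^ q *
                  ENNReal.ofReal ((1 + ‖z‖) ^ (-(n : ℝ)))) ^ (1 / q) +
            ENNReal.ofReal C *
              (∫⁻ z in upperHalf n ⟨n - 1, by omega⟩,
                (ENNReal.ofReal ((1 + ‖z‖) ^ (-β + 1) *
                    ‖fderivWithin ℝ u (upperHalf n ⟨n - 1, by omega⟩) z‖)) ^ q *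
                  ENNReal.ofReal ((1 + ‖z‖) ^ (-(n : ℝ)))) ^ (1 / q) := by
  have hfin : (Module.finrank ℝ (EuclideanSpace ℝ (Fin n)) : ℝ) = n := by simp
  have hn' : (3 : ℝ) ≤ n := by exact_mod_cast hn
  have hcl : IsClosed (upperHalf n ⟨n - 1, by omega⟩) :=
    isClosed_le continuous_const (by fun_prop)
  obtain ⟨C, hC, h⟩ := exists_forall_le_weightedNorm_add
    (volume : Measure (EuclideanSpace ℝ (Fin n))) hcl
    (fun x hx y hy => add_nonneg (α := ℝ) hx hy) (fun c hc x hx => mul_nonneg (α := ℝ) hc hx)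
    (nonempty_interior_upperHalf_inter_closedBall n _) (by linarith : 1 < q)
    (by rw [hfin]; exact hq) β
  refine ⟨C, hC, fun u hu x hx => ?_⟩
  have hmul : ∀ (z : EuclideanSpace ℝ (Fin n)) (γ : ℝ) {F : Type} [NormedAddCommGroup F] (v : F),
      ENNReal.ofReal ((1 + ‖z‖) ^ γ * ‖v‖) = ENNReal.ofReal ((1 + ‖z‖) ^ γ) * ‖v‖ₑ :=
    fun z γ F _ v => by rw [ENNReal.ofReal_mul (by positivity), ofReal_norm]
  simp only [← Real.norm_eq_abs, hmul]
  simpa only [weightedNorm, hfin] using h u hu x hx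
end
end
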